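/- arXiv:2506.11265 — 4 statements merged into one kernel-verified Lean document; each statement's English description precedes it below -/
import Mathlib

section
/- Let 𝒯 = {T_v} be an extended (n,d)-tope arrangement. Suppose that for every lattice point w of (n+1)Δ^{d−1}, the graph ⋃_{j̄ : w_j̄ ≥ 1} T_{w−e_j̄} is acyclic. Then for every lattice point u of (n−1)Δ^{d−1} and every tope T with T ⊆ 𝕋(u) = ⋃_{j̄∈[d̄]} T_{u+e_j̄}, T belongs to 𝒯; that is, T = T_v where v = RD(T). -/
open Finset

/-- A bipartite graph between `α` and `β`, identified with its edge set. -/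
abbrev BGraph (α β : Type*) := Finset (α × β)

section BipartiteDefs

variable {α β : Type*} [DecidableEq α] [DecidableEq β]

/-- Left degree vector. -/
def LD (G : BGraph α β) (a : α) : ℕ := (G.filter fun e => e.1 = a).card

/-- Right degree vector. -/
def RD (G : BGraph α β) (b : β) : ℕ := (G.filter fun e => e.2 = b).card

/-- The simple graph on `α ⊕ β` associated to a bipartite edge set. -/
def toGraph (G : BGraph α β) : SimpleGraph (α ⊕ β) :=
  SimpleGraph.fromRel fun x y => ∃ a b, x = Sum.inl a ∧ y = Sum.inr b ∧ (a, b) ∈ G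

/-- Acyclicity of a bipartite edge set. -/
def Acyclic (G : BGraph α β) : Prop := (toGraph G).IsAcyclic

/-- `U` is a tree on the vertex set `I ⊔ J`. -/
def IsTreeOn (U : BGraph α β) (I : Finset α) (J : Finset β) : Prop :=
  (∀ e ∈ U, e.1 ∈ I ∧ e.2 ∈ J) ∧ Acyclic U ∧
    ∀ x y : α ⊕ β, Sum.elim (· ∈ I) (· ∈ J) x → Sum.elim (· ∈ I) (· ∈ J) y →
      (toGraph U).Reachable x y

/-- `M` is a perfect matching between `I` and `J`. -/
def IsMatching (M : BGraph α β) (I : Finset α) (J : Finset β) : Prop :=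
  (∀ e ∈ M, e.1 ∈ I ∧ e.2 ∈ J) ∧ (∀ a ∈ I, ∃! b : β, (a, b) ∈ M) ∧
    ∀ b ∈ J, ∃! a : α, (a, b) ∈ M

/-- Compatibility of two bipartite graphs. -/
def Compatible (G G' : BGraph α β) : Prop :=
  ∀ (I : Finset α) (J : Finset β) (M M' : BGraph α β),
    M ⊆ G → M' ⊆ G' → IsMatching M I J → IsMatching M' I J → M = M'

end BipartiteDefs

section TopeDefs

variable {n d : ℕ}

/-- The graph of a tope `T : [n] → [d]`. -/
def topeGraph (T : Fin n → Fin d) : BGraph (Fin n) (Fin d) :=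
  Finset.univ.image fun i => (i, T i)

/-- The position (right degree vector) of a tope. -/
def topePos (T : Fin n → Fin d) : Fin d → ℕ :=
  fun j => (Finset.univ.filter fun i => T i = j).card

/-- Standard unit vector `e_j`. -/
def unitVec (j : Fin d) : Fin d → ℕ := fun k => if k = j then 1 else 0

end TopeDefs

/-- The union `𝕋(u)` of the topes at the vertices of the unit simplex `u + Δ^{d-1}`. -/
def deltaUnion {n d : ℕ} (T : (Fin d → ℕ) → Fin n → Fin d) (u : Fin d → ℕ) :
    BGraph (Fin n) (Fin d) :=
  Finset.univ.biUnion fun j => topeGraph (T (u + unitVec j))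


lemma mem_topeGraph {n d : ℕ} (S : Fin n → Fin d) (i : Fin n) (j : Fin d) :
    (i, j) ∈ topeGraph S ↔ S i = j := by
  simp [topeGraph]

/-- No closed set of moves. -/
def NoCyc {n d : ℕ} (A B : Fin n → Fin d) : Prop :=
  ∀ Y : Finset (Fin d), Y.Nonempty → (∀ y ∈ Y, ∃ i, A i = y ∧ B i ∈ Y ∧ B i ≠ y) → False

lemma exists_periodic {d : ℕ} (Y : Finset (Fin d)) (hY : Y.Nonempty) (g : Fin d → Fin d)
    (hg : ∀ y ∈ Y, g y ∈ Y) : ∃ y ∈ Y, y ∈ Function.periodicPts g := by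
  obtain ⟨y, hy⟩ := hY
  have hit : ∀ m, g^[m] y ∈ Y := by
    intro m
    induction m with
    | zero => simpa using hy
    | succ m ih => rw [Function.iterate_succ_apply']; exact hg _ ih
  obtain ⟨a, b, hab, h⟩ := Finite.exists_ne_map_eq_of_infinite (fun m : ℕ => g^[m] y)
  wlog hlt : a < b generalizing a b
  · exact this b a hab.symm h.symm (by omega)
  refine ⟨g^[a] y, hit a, b - a, by omega, ?_⟩
  rw [Function.IsPeriodicPt, Function.IsFixedPt, ← Function.iterate_add_apply,
    Nat.sub_add_cancel hlt.le]
  exact h.symm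

lemma noCyc_of_compatible {n d : ℕ} (A B : Fin n → Fin d)
    (h : Compatible (topeGraph A) (topeGraph B)) : NoCyc A B := by
  classical
  intro Y hY hcl
  have : ∀ y : Fin d, ∃ i : Fin n, y ∈ Y → A i = y ∧ B i ∈ Y ∧ B i ≠ y := by
    intro y
    by_cases hy : y ∈ Y
    · obtain ⟨i, hi⟩ := hcl y hy
      exact ⟨i, fun _ => hi⟩
    · obtain ⟨y', hy'⟩ := hY
      obtain ⟨i, hi⟩ := hcl y' hy'
      exact ⟨i, fun h => absurd h hy⟩
  choose f hf using this
  set g : Fin d → Fin d := fun y => B (f y) with hg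
  obtain ⟨y0, hy0, hp0⟩ := exists_periodic Y hY g (fun y hy => (hf y hy).2.1)
  set J : Finset (Fin d) := Y.filter (fun y => y ∈ Function.periodicPts g) with hJ
  have hbij := Function.bijOn_periodicPts (f := g)
  have hJg : ∀ y ∈ J, g y ∈ J := by
    intro y hy
    rw [hJ, Finset.mem_filter] at hy ⊢
    exact ⟨(hf y hy.1).2.1, hbij.mapsTo hy.2⟩
  have hinj : ∀ y ∈ J, ∀ y' ∈ J, g y = g y' → y = y' := by
    intro y hy y' hy' e
    rw [hJ, Finset.mem_filter] at hy hy'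
    exact hbij.injOn hy.2 hy'.2 e
  have hsurj : ∀ y ∈ J, ∃ y' ∈ J, g y' = y := by
    intro y hy
    exact Finset.surj_on_of_inj_on_of_card_le (s := J) (t := J) (fun a _ => g a)
      (fun a ha => hJg a ha) (fun a b ha hb e => hinj a ha b hb e) le_rfl y hy
      |>.imp fun a ha => by obtain ⟨h1, h2⟩ := ha; exact ⟨h1, h2.symm⟩
  have hA : ∀ y ∈ J, A (f y) = y := fun y hy => (hf y (Finset.mem_filter.1 hy).1).1
  have hfinj : ∀ y ∈ J, ∀ y' ∈ J, f y = f y' → y = y' := by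
    intro y hy y' hy' e
    rw [← hA y hy, ← hA y' hy', e]
  have hM := h (J.image f) J (J.image fun y => (f y, y)) (J.image fun y => (f y, g y))
    (by
      intro e he
      obtain ⟨y, hy, rfl⟩ := Finset.mem_image.1 he
      exact (mem_topeGraph _ _ _).2 (hA y hy))
    (by
      intro e he
      obtain ⟨y, hy, rfl⟩ := Finset.mem_image.1 he
      exact (mem_topeGraph _ _ _).2 rfl)
    (by
      refine ⟨?_, ?_, ?_⟩
      · intro e he
        obtain ⟨y, hy, rfl⟩ := Finset.mem_image.1 he
        exact ⟨Finset.mem_image_of_mem _ hy, hy⟩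
      · intro a ha
        obtain ⟨y, hy, rfl⟩ := Finset.mem_image.1 ha
        refine ⟨y, Finset.mem_image_of_mem (fun y => (f y, y)) hy, ?_⟩
        intro b hb
        obtain ⟨y', hy', e⟩ := Finset.mem_image.1 hb
        simp only [Prod.mk.injEq] at e
        rw [← e.2]
        exact hfinj _ hy' _ hy e.1
      · intro b hb
        refine ⟨f b, Finset.mem_image_of_mem (fun y => (f y, y)) hb, ?_⟩
        intro a ha
        obtain ⟨y', hy', e⟩ := Finset.mem_image.1 ha
        simp only [Prod.mk.injEq] at e
        rw [← e.1, e.2])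
    (by
      refine ⟨?_, ?_, ?_⟩
      · intro e he
        obtain ⟨y, hy, rfl⟩ := Finset.mem_image.1 he
        exact ⟨Finset.mem_image_of_mem _ hy, hJg y hy⟩
      · intro a ha
        obtain ⟨y, hy, rfl⟩ := Finset.mem_image.1 ha
        refine ⟨g y, Finset.mem_image_of_mem (fun y => (f y, g y)) hy, ?_⟩
        intro b hb
        obtain ⟨y', hy', e⟩ := Finset.mem_image.1 hb
        simp only [Prod.mk.injEq] at e
        rw [← e.2, hfinj _ hy' _ hy e.1]
      · intro b hb
        obtain ⟨y, hy, rfl⟩ := hsurj b hb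
        refine ⟨f y, Finset.mem_image_of_mem (fun y => (f y, g y)) hy, ?_⟩
        intro a ha
        obtain ⟨y', hy', e⟩ := Finset.mem_image.1 ha
        simp only [Prod.mk.injEq] at e
        rw [← e.1, hinj _ hy' _ hy e.2])
  have hy0J : y0 ∈ J := Finset.mem_filter.2 ⟨hy0, hp0⟩
  have : (f y0, y0) ∈ J.image fun y => (f y, g y) := by
    rw [← hM]; exact Finset.mem_image_of_mem (fun y => (f y, y)) hy0J
  obtain ⟨y', hy', e⟩ := Finset.mem_image.1 this
  simp only [Prod.mk.injEq] at e
  have := hfinj _ hy' _ hy0J e.1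
  subst this
  exact (hf y' hy0).2.2 e.2

lemma noCyc_of_acyclic {n d : ℕ} (G : BGraph (Fin n) (Fin d)) (hG : Acyclic G)
    (A B : Fin n → Fin d) (hA : topeGraph A ⊆ G) (hB : topeGraph B ⊆ G) : NoCyc A B := by
  classical
  intro Y hY hcl
  have : ∀ y : Fin d, ∃ i : Fin n, y ∈ Y → A i = y ∧ B i ∈ Y ∧ B i ≠ y := by
    intro y
    by_cases hy : y ∈ Y
    · obtain ⟨i, hi⟩ := hcl y hy
      exact ⟨i, fun _ => hi⟩
    · obtain ⟨y', hy'⟩ := hY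
      obtain ⟨i, hi⟩ := hcl y' hy'
      exact ⟨i, fun h => absurd h hy⟩
  choose f hf using this
  set g : Fin d → Fin d := fun y => B (f y) with hg
  have hgY : ∀ y ∈ Y, g y ∈ Y := fun y hy => (hf y hy).2.1
  obtain ⟨y0, hy0, hp0⟩ := exists_periodic Y hY g hgY
  have hadj : ∀ i j, (i, j) ∈ G → (toGraph G).Adj (Sum.inl i) (Sum.inr j) := by
    intro i j h
    rw [toGraph, SimpleGraph.fromRel_adj]
    exact ⟨by simp, Or.inl ⟨i, j, rfl, rfl, h⟩⟩
  have hAadj : ∀ i, (toGraph G).Adj (Sum.inl i) (Sum.inr (A i)) :=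
    fun i => hadj _ _ (hA ((mem_topeGraph _ _ _).2 rfl))
  have hBadj : ∀ i, (toGraph G).Adj (Sum.inl i) (Sum.inr (B i)) :=
    fun i => hadj _ _ (hB ((mem_topeGraph _ _ _).2 rfl))
  have hbr := SimpleGraph.isAcyclic_iff_forall_adj_isBridge.1 hG (hAadj (f y0))
  rw [SimpleGraph.isBridge_iff] at hbr
  rw [(hf y0 hy0).1] at hbr
  set G' := (toGraph G).deleteEdges {s(Sum.inl (f y0), Sum.inr y0)} with hG'
  have hkey : ∀ i j, (toGraph G).Adj (Sum.inl i) (Sum.inr j) → ¬ (i = f y0 ∧ j = y0) →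
      G'.Adj (Sum.inl i) (Sum.inr j) := by
    intro i j h hne
    rw [hG', SimpleGraph.deleteEdges_adj]
    refine ⟨h, ?_⟩
    simpa using hne
  have hit : ∀ m, g^[m] y0 ∈ Y := by
    intro m
    induction m with
    | zero => simpa using hy0
    | succ m ih => rw [Function.iterate_succ_apply']; exact hgY _ ih
  have h1 : G'.Reachable (Sum.inl (f y0)) (Sum.inr (g y0)) :=
    (hkey _ _ (hBadj (f y0)) (fun h => (hf y0 hy0).2.2 h.2)).reachable
  have hr : ∀ m, G'.Reachable (Sum.inl (f y0)) (Sum.inr (g^[m+1] y0)) := by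
    intro m
    induction m with
    | zero => simpa using h1
    | succ m ih =>
      rw [Function.iterate_succ_apply']
      set y := g^[m+1] y0 with hy
      have hyY : y ∈ Y := hit _
      by_cases hyy : y = y0
      · rw [hyy]; exact h1
      · have hfy : f y ≠ f y0 := by
          intro e
          apply hyy
          rw [← (hf y hyY).1, ← (hf y0 hy0).1, e]
        have e1 : (toGraph G).Adj (Sum.inl (f y)) (Sum.inr y) := by
          have := hAadj (f y)
          rwa [(hf y hyY).1] at this
        refine ih.trans ?_
        exact (hkey _ _ e1 (fun h => hfy h.1)).reachable.symm.trans
          (hkey _ _ (hBadj (f y)) (fun h => hfy h.1)).reachable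
  obtain ⟨m, hm, hper⟩ := hp0
  have := hr (m - 1)
  rw [Nat.sub_add_cancel hm, hper.eq] at this

  exact hbr this



/-- an in-edge gives an out-edge -/
lemma out_of_in {n d : ℕ} (A B : Fin n → Fin d) (y : Fin d) (i : Fin n)
    (hle : topePos B y ≤ topePos A y) (h1 : A i ≠ y) (h2 : B i = y) :
    ∃ i', A i' = y ∧ B i' ≠ y := by
  classical
  by_contra hcon
  push Not at hcon
  have : (univ.filter fun i => A i = y) ⊂ (univ.filter fun i => B i = y) := by
    rw [Finset.ssubset_iff_of_subset]
    · exact ⟨i, by simp [h2], by simp [h1]⟩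
    · intro x hx
      simp only [mem_filter, mem_univ, true_and] at hx ⊢
      exact hcon x hx
  have := Finset.card_lt_card this
  simp only [topePos] at hle
  omega

lemma out_of_lt {n d : ℕ} (A B : Fin n → Fin d) (y : Fin d)
    (hlt : topePos B y < topePos A y) :
    ∃ i', A i' = y ∧ B i' ≠ y := by
  classical
  by_contra hcon
  push Not at hcon
  have : (univ.filter fun i => A i = y) ⊆ (univ.filter fun i => B i = y) := by
    intro x hx
    simp only [mem_filter, mem_univ, true_and] at hx ⊢
    exact hcon x hx
  have := Finset.card_le_card this
  simp only [topePos] at hlt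
  omega

lemma eq_of_noCyc {n d : ℕ} (A B : Fin n → Fin d) (h : NoCyc A B)
    (hp : topePos A = topePos B) : A = B := by
  classical
  by_contra hne
  obtain ⟨i, hi⟩ := Function.ne_iff.1 hne
  refine h (univ.filter fun y => ∃ i, A i = y ∧ B i ≠ y) ⟨A i, by simpa using ⟨i, rfl, hi.symm⟩⟩ ?_
  intro y hy
  simp only [mem_filter, mem_univ, true_and] at hy ⊢
  obtain ⟨i, h1, h2⟩ := hy
  refine ⟨i, h1, ?_, h2⟩
  exact out_of_in A B (B i) i (by rw [hp]) (by rw [h1]; exact h2.symm) rfl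

lemma eq_of_rank {n d : ℕ} (A B : Fin n → Fin d) (h : Fin d → ℕ)
    (hr : ∀ i, A i ≠ B i → h (B i) < h (A i)) 
    (hp : topePos A = topePos B) : A = B := by
  apply eq_of_noCyc A B _ hp
  intro Y hY hcl
  obtain ⟨y, hy, hmin⟩ := Finset.exists_min_image Y h hY
  obtain ⟨i, h1, h2, h3⟩ := hcl y hy
  have := hr i (by rw [h1]; exact h3.symm)
  have := hmin _ h2
  rw [h1] at *
  omega

lemma topePos_update {n d : ℕ} (S : Fin n → Fin d) (i : Fin n) (c x : Fin d) :
    topePos (Function.update S i c) x + unitVec (S i) x = topePos S x + unitVec c x := by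
  classical
  have key : ∀ R : Fin n → Fin d, topePos R x =
      unitVec (R i) x + ∑ k ∈ univ.erase i, if R k = x then 1 else 0 := by
    intro R
    rw [topePos, Finset.card_filter, ← Finset.add_sum_erase _ _ (mem_univ i)]
    simp [unitVec, eq_comm]
  rw [key S, key (Function.update S i c)]
  have : (∑ k ∈ univ.erase i, if Function.update S i c k = x then 1 else 0)
      = ∑ k ∈ univ.erase i, if S k = x then 1 else 0 := by
    apply Finset.sum_congr rfl
    intro k hk
    rw [Function.update_of_ne (Finset.ne_of_mem_erase hk)]
  rw [this, Function.update_self]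
  ring

section Rooted

variable {n d : ℕ} (A : Fin d → Fin n → Fin d) (u : Fin d → ℕ)

lemma fact0 (hA : ∀ j, topePos (A j) = u + unitVec j) (hc : ∀ j k, NoCyc (A j) (A k))
    (k c : Fin d) (i : Fin n) (hi : A k i = c) : A c i = c := by
  classical
  by_contra hne
  have hkc : k ≠ c := by rintro rfl; exact hne hi
  refine hc k c (univ.filter fun y => ∃ i, A k i = y ∧ A c i ≠ y) ⟨c, by simpa using ⟨i, hi, hne⟩⟩ ?_
  intro y hy
  simp only [mem_filter, mem_univ, true_and] at hy ⊢
  obtain ⟨i', h1, h2⟩ := hy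
  refine ⟨i', h1, ?_, h2⟩
  by_cases hyc : A c i' = c
  · rw [hyc]; exact ⟨i, hi, hne⟩
  · refine out_of_in _ _ _ i' ?_ (by rw [h1]; exact h2.symm) rfl
    rw [hA, hA]
    simp [unitVec, hyc]

lemma rooted (hA : ∀ j, topePos (A j) = u + unitVec j) (hc : ∀ j k, NoCyc (A j) (A k))
    (b : Fin d) : ∃ (par : Fin d → Fin d) (h : Fin d → ℕ),
      (∀ i c, A c i = c → A b i ≠ c → par c = A b i) ∧
      (∀ i i' c, A c i = c → A b i ≠ c → A c i' = c → A b i' ≠ c → i = i') ∧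
      par b = b ∧ (∀ c, c ≠ b → h (par c) < h c) := by
  classical
  have huniq : ∀ i i' c, A c i = c → A b i ≠ c → A c i' = c → A b i' ≠ c → i = i' := by
    intro i i' c h1 h2 h3 h4
    by_contra hne
    have hcb : c ≠ b := by rintro rfl; exact h2 h1
    have hsub : (univ.filter fun x => A b x = c) ⊆
        ((univ.filter fun x => A c x = c).erase i).erase i' := by
      intro x hx
      simp only [mem_filter, mem_univ, true_and, mem_erase] at hx ⊢
      refine ⟨?_, ?_, fact0 A u hA hc b c x hx⟩
      · rintro rfl; exact h4 hx
      · rintro rfl; exact h2 hx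
    have hcard := Finset.card_le_card hsub
    rw [Finset.card_erase_of_mem (by simp [h3, Ne.symm hne]),
      Finset.card_erase_of_mem (by simp [h1])] at hcard
    have e1 := congrFun (hA b) c
    have e2 := congrFun (hA c) c
    have hpos : 1 < (univ.filter fun x => A c x = c).card :=
      Finset.one_lt_card.2 ⟨i, by simp [h1], i', by simp [h3], hne⟩
    simp [topePos, unitVec, hcb] at e1 e2
    omega
  have hex : ∀ c, c ≠ b → ∃ i, A c i = c ∧ A b i ≠ c := by
    intro c hcb
    apply out_of_lt
    rw [hA, hA]
    simp [unitVec, hcb]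
  have hpar : ∀ c, ∃ p, (c = b → p = b) ∧ (∀ i, A c i = c → A b i ≠ c → p = A b i) := by
    intro c
    by_cases hcb : c = b
    · exact ⟨b, fun _ => rfl, fun i h1 h2 => absurd (by rw [hcb] at h1 ⊢; exact h1) h2⟩
    · obtain ⟨i, h1, h2⟩ := hex c hcb
      exact ⟨A b i, fun h => absurd h hcb, fun i' h1' h2' => by rw [huniq i i' c h1 h2 h1' h2']⟩
  choose par hp1 hp2 using hpar
  have hreach : ∀ c, ∃ m, par^[m] c = b := by
    intro c
    by_contra hcon
    push Not at hcon
    have hcb : c ≠ b := by simpa using hcon 0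
    have hcout : ∃ i, A c i = c ∧ A b i ≠ c := hex c hcb
    refine hc c b (univ.filter fun y => (∃ m, par^[m] c = y) ∧ ∃ i, A c i = y ∧ A b i ≠ y)
      ⟨c, ?_⟩ ?_
    · simp only [mem_filter, mem_univ, true_and]
      exact ⟨⟨0, rfl⟩, hcout⟩
    · intro y hy
      simp only [mem_filter, mem_univ, true_and] at hy ⊢
      obtain ⟨⟨m, hm⟩, i, h1, h2⟩ := hy
      have hyi : A y i = y := fact0 A u hA hc c y i h1
      have hpy : par y = A b i := hp2 y i hyi h2
      have hm' : par^[m+1] c = A b i := by rw [Function.iterate_succ_apply', hm, hpy]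
      refine ⟨i, h1, ⟨⟨m+1, hm'⟩, ?_⟩, h2⟩
      have hb : A b i ≠ b := by rw [← hm']; exact hcon _
      refine out_of_in _ _ _ i ?_ (by rw [h1]; exact h2.symm) rfl
      rw [hA, hA]
      simp [unitVec, hb]
  refine ⟨par, fun c => Nat.find (hreach c), fun i c => hp2 c i, huniq, hp1 b rfl, ?_⟩
  intro c hcb
  have hs := Nat.find_spec (hreach c)
  have hpos : Nat.find (hreach c) ≠ 0 := by
    intro h0
    rw [h0] at hs
    exact hcb hs
  obtain ⟨m, hm⟩ := Nat.exists_eq_succ_of_ne_zero hpos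
  simp only
  rw [hm] at hs ⊢
  exact Nat.lt_succ_of_le (Nat.find_min' _ hs)

lemma down (hA : ∀ j, topePos (A j) = u + unitVec j) (hc : ∀ j k, NoCyc (A j) (A k))
    (b : Fin d) (par : Fin d → Fin d) (h : Fin d → ℕ)
    (hp1 : ∀ i c, A c i = c → A b i ≠ c → par c = A b i)
    (hp2 : ∀ i i' c, A c i = c → A b i ≠ c → A c i' = c → A b i' ≠ c → i = i')
    (hp3 : par b = b) (hp4 : ∀ c, c ≠ b → h (par c) < h c)
    (S : Fin n → Fin d) (hS : ∀ i, A (S i) i = S i) (N : ℕ) (hN : ∀ c, h c ≤ N) (t : ℕ) :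
    ∀ i, S i ≠ A b i → N - h (A b i) ≤ t → ∃ k S', u k < topePos S k ∧ (∀ i, A (S' i) i = S' i) ∧
      (∀ x, topePos S' x + unitVec k x = topePos S x + unitVec (A b i) x) ∧
      ∀ x, S' x ≠ S x → x = i ∨ ∃ m, par^[m] (A b x) = S i := by
  classical
  have hmono : ∀ m c, h (par^[m] c) ≤ h c := by
    intro m c
    induction m with
    | zero => simp
    | succ m ih =>
      rw [Function.iterate_succ_apply']
      by_cases e : par^[m] c = b
      · rw [e, hp3, ← e]; exact ih
      · exact (hp4 _ e).le.trans ih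
  have hpS : ∀ i, S i ≠ A b i → par (S i) = A b i := fun i hi => hp1 i (S i) (hS i) hi.symm
  have hneb : ∀ i, S i ≠ A b i → S i ≠ b := by
    intro i hi e
    have := hS i
    rw [e] at this
    rw [e, this] at hi
    exact hi rfl
  have hlt : ∀ i, S i ≠ A b i → h (A b i) < h (S i) := by
    intro i hi
    have := hp4 _ (hneb i hi)
    rwa [hpS i hi] at this
  induction t with
  | zero =>
    intro i hi ht
    have := hlt i hi
    have := hN (S i)
    omega
  | succ t ih =>
    intro i hi ht
    have hAi : A (A b i) i = A b i := fact0 A u hA hc b _ i rfl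
    by_cases hk : u (S i) < topePos S (S i)
    · refine ⟨S i, Function.update S i (A b i), hk, ?_, ?_, ?_⟩
      · intro x
        by_cases hx : x = i
        · subst hx; simpa using hAi
        · simpa [Function.update_of_ne hx] using hS x
      · intro x
        exact topePos_update S i (A b i) x
      · intro x hx
        by_contra hcon
        push Not at hcon
        exact hx (Function.update_of_ne hcon.1 _ _)
    · obtain ⟨i2, h1, h2⟩ := out_of_lt (A (S i)) S (S i) (by
        rw [hA]
        simp [unitVec]
        omega)
      have hbi2 : A b i2 = S i := by
        by_contra hne
        have := hp2 i2 i (S i) h1 hne (hS i) hi.symm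
        rw [this] at h2
        exact h2 rfl
      have hi2 : S i2 ≠ A b i2 := by rw [hbi2]; exact h2
      have l1 := hlt i hi
      have l2 := hlt i2 hi2
      have l3 := hN (S i)
      obtain ⟨k, S'', hk', hsub, hcnt, hdiff⟩ := ih i2 hi2 (by rw [hbi2]; omega)
      have hS''i : S'' i = S i := by
        by_contra hne
        rcases hdiff i hne with e | ⟨m, hm⟩
        · rw [← e] at h2; exact h2 rfl
        · have := hmono m (A b i)
          rw [hm] at this
          rw [hbi2] at l2
          omega
      refine ⟨k, Function.update S'' i (A b i), hk', ?_, ?_, ?_⟩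
      · intro x
        by_cases hx : x = i
        · subst hx; simpa using hAi
        · simpa [Function.update_of_ne hx] using hsub x
      · intro x
        have e1 := topePos_update S'' i (A b i) x
        have e2 := hcnt x
        rw [hS''i] at e1
        rw [hbi2] at e2
        omega
      · intro x hx
        by_cases hxi : x = i
        · exact Or.inl hxi
        · right
          rw [Function.update_of_ne hxi] at hx
          rcases hdiff x hx with e | ⟨m, hm⟩
          · exact ⟨0, by rw [e]; exact hbi2⟩
          · exact ⟨m+1, by rw [Function.iterate_succ_apply', hm, hpS i2 hi2, hbi2]⟩

end Rooted

lemma sum_topePos {n d : ℕ} (S : Fin n → Fin d) : ∑ j, topePos S j = n := by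
  have := Finset.card_eq_sum_card_fiberwise (s := (univ : Finset (Fin n)))
    (t := (univ : Finset (Fin d))) (f := S) (by simp)
  simpa [topePos] using this.symm

lemma sum_unitVec {d : ℕ} (j : Fin d) : ∑ k, unitVec j k = 1 := by
  simp [unitVec]

theorem statement3 {n d : ℕ} (T : (Fin d → ℕ) → Fin n → Fin d)
    (hpos : ∀ v : Fin d → ℕ, (∑ j, v j) = n → topePos (T v) = v)
    (hcompat : ∀ v v' : Fin d → ℕ, (∑ j, v j) = n → (∑ j, v' j) = n →
      Compatible (topeGraph (T v)) (topeGraph (T v')))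
    (hacyclic : ∀ w : Fin d → ℕ, (∑ j, w j) = n + 1 →
      Acyclic ((Finset.univ.filter fun j => 1 ≤ w j).biUnion
        fun j => topeGraph (T (w - unitVec j))))
    (u : Fin d → ℕ) (hu : (∑ j, u j) + 1 = n) (S : Fin n → Fin d)
    (hS : topeGraph S ⊆ deltaUnion T u) :
    S = T (topePos S) := by
  classical
  set A : Fin d → Fin n → Fin d := fun j => T (u + unitVec j) with hAdef
  have hsum : ∀ j, ∑ k, (u + unitVec j : Fin d → ℕ) k = n := by
    intro j
    simp only [Pi.add_apply, Finset.sum_add_distrib, sum_unitVec, hu]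
  have hA : ∀ j, topePos (A j) = u + unitVec j := fun j => hpos _ (hsum j)
  have hc : ∀ j k, NoCyc (A j) (A k) := fun j k =>
    noCyc_of_compatible _ _ (hcompat _ _ (hsum j) (hsum k))
  have hS' : ∀ i, A (S i) i = S i := by
    intro i
    have := hS ((mem_topeGraph S i (S i)).2 rfl)
    simp only [deltaUnion, mem_biUnion, mem_univ, true_and, mem_topeGraph] at this
    obtain ⟨j, hj⟩ := this
    exact fact0 A u hA hc j _ i hj
  clear hS
  obtain ⟨t, ht⟩ : ∃ t, ∑ c, (u c - topePos S c) = t := ⟨_, rfl⟩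
  induction t using Nat.strong_induction_on generalizing S with
  | _ t ih =>
  have hsS := sum_topePos S
  by_cases hb : ∃ b, topePos S b < u b
  · obtain ⟨b, hb⟩ := hb
    obtain ⟨par, h, hp1, hp2, hp3, hp4⟩ := rooted A u hA hc b
    have hdown := down A u hA hc b par h hp1 hp2 hp3 hp4 S hS' (univ.sup h)
      (fun c => Finset.le_sup (mem_univ c)) (univ.sup h)
    set w : Fin d → ℕ := topePos S + unitVec b with hw
    have hwsum : ∑ j, w j = n + 1 := by
      simp only [hw, Pi.add_apply, Finset.sum_add_distrib, sum_unitVec, hsS]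
    have hac := hacyclic w hwsum
    set G := ((Finset.univ.filter fun j => 1 ≤ w j).biUnion
        fun j => topeGraph (T (w - unitVec j))) with hG
    -- the flips lie in the graph G
    have hflip : ∀ i, S i ≠ b → A b i = b → ∃ S' : Fin n → Fin d, topeGraph S' ⊆ G ∧
        ∀ x, S' x ≠ S x → x = i ∨ ∃ m, par^[m] (A b x) = S i := by
      intro i h1 h2
      obtain ⟨k, S', hk, hsub, hcnt, hdiff⟩ := hdown i (by rw [h2]; exact h1) (by omega)
      rw [h2] at hcnt
      refine ⟨S', ?_, hdiff⟩
      have hkb : k ≠ b := by rintro rfl; omega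
      have hpS' : topePos S' = w - unitVec k := by
        funext x
        have := hcnt x
        simp only [hw, Pi.sub_apply, Pi.add_apply]
        omega
      have hS'T : S' = T (topePos S') := by
        refine ih (∑ c, (u c - topePos S' c)) ?_ S' hsub rfl
        rw [← ht]
        apply Finset.sum_lt_sum
        · intro x _
          have := hcnt x
          by_cases hxk : x = k
          · subst hxk
            simp [unitVec, hkb] at this
            omega
          · simp [unitVec, hxk] at this
            omega
        · refine ⟨b, mem_univ _, ?_⟩
          have := hcnt b
          simp [unitVec, hkb.symm] at this
          omega
      rw [hpS'] at hS'T
      rw [hG, hS'T]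
      apply Finset.subset_biUnion_of_mem (fun j => topeGraph (T (w - unitVec j)))
      simp only [mem_filter, mem_univ, true_and, hw, Pi.add_apply]
      omega
    obtain ⟨i1, hi1, hi1'⟩ := out_of_lt (A b) S b (by rw [hA]; simp [unitVec]; omega)
    obtain ⟨i2, hi2, hi2'⟩ := out_of_lt (A b) (Function.update S i1 b) b (by
      have := topePos_update S i1 b b
      rw [hA]
      simp [unitVec, hi1'.symm] at this ⊢
      omega)
    have hi12 : i2 ≠ i1 := by
      rintro rfl
      simp at hi2'
    rw [Function.update_of_ne hi12] at hi2'
    obtain ⟨S1, hS1, hd1⟩ := hflip i1 hi1' hi1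
    obtain ⟨S2, hS2, hd2⟩ := hflip i2 hi2' hi2
    have hpb : ∀ m, par^[m] b = b := fun m => Function.iterate_fixed hp3 m
    have hpar1 : par (S i1) = b := by
      rw [hp1 i1 (S i1) (hS' i1) (by rw [hi1]; exact hi1'.symm), hi1]
    have hpar2 : par (S i2) = b := by
      rw [hp1 i2 (S i2) (hS' i2) (by rw [hi2]; exact hi2'.symm), hi2]
    have hS12 : S i1 ≠ S i2 := by
      intro e
      refine hi12 (hp2 i2 i1 (S i1) ?_ ?_ (hS' i1) ?_)
      · rw [e]; exact hS' i2
      · rw [hi2]; exact hi1'.symm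
      · rw [hi1]; exact hi1'.symm
    have hclash : ∀ (y c c' : Fin d) (m m' : ℕ), par c = b → c' ≠ b → c ≠ c' → m ≤ m' →
        par^[m] y = c → par^[m'] y = c' → False := by
      intro y c c' m m' e1 e2 e3 hle e4 e5
      obtain ⟨r, rfl⟩ := Nat.exists_eq_add_of_le hle
      rw [add_comm, Function.iterate_add_apply, e4] at e5
      cases r with
      | zero => exact e3 e5
      | succ r =>
        rw [Function.iterate_succ_apply, e1, hpb] at e5
        exact e2 e5.symm
    have hSG : topeGraph S ⊆ G := by
      rintro ⟨x, y⟩ hxy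
      rw [mem_topeGraph] at hxy
      by_cases hx1 : S1 x = S x
      · exact hS1 ((mem_topeGraph _ _ _).2 (hx1.trans hxy))
      by_cases hx2 : S2 x = S x
      · exact hS2 ((mem_topeGraph _ _ _).2 (hx2.trans hxy))
      exfalso
      rcases hd1 x hx1 with e1 | ⟨m1, e1⟩ <;> rcases hd2 x hx2 with e2 | ⟨m2, e2⟩
      · exact hi12 (e2.symm.trans e1)
      · rw [e1, hi1, hpb] at e2; exact hi2' e2.symm
      · rw [e2, hi2, hpb] at e1; exact hi1' e1.symm
      · rcases le_total m1 m2 with hle | hle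
        · exact hclash _ _ _ _ _ hpar1 hi2' hS12 hle e1 e2
        · exact hclash _ _ _ _ _ hpar2 hi1' hS12.symm hle e2 e1
    have hTG : topeGraph (T (topePos S)) ⊆ G := by
      have e : topePos S = w - unitVec b := by
        funext x; simp [hw]
      rw [hG]
      conv_lhs => rw [e]
      apply Finset.subset_biUnion_of_mem (fun j => topeGraph (T (w - unitVec j)))
      simp [hw, unitVec]
    exact eq_of_noCyc _ _ (noCyc_of_acyclic G hac _ _ hSG hTG) (hpos _ hsS).symm
  · push Not at hb
    obtain ⟨j, hj⟩ : ∃ j, u j < topePos S j := by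
      by_contra hcon
      push Not at hcon
      have : ∑ j, topePos S j ≤ ∑ j, u j := Finset.sum_le_sum fun j _ => hcon j
      omega
    have hv : u + unitVec j = topePos S := by
      have hle : ∀ x ∈ univ, (u + unitVec j : Fin d → ℕ) x ≤ topePos S x := by
        intro x _
        by_cases hx : x = j
        · subst hx; simp [unitVec]; omega
        · simpa [unitVec, hx] using hb x
      have := (Finset.sum_eq_sum_iff_of_le hle).1 (by rw [hsum, hsS])
      funext x
      exact this x (mem_univ x)
    obtain ⟨par, h, hp1, hp2, hp3, hp4⟩ := rooted A u hA hc j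
    have : S = A j := by
      apply eq_of_rank S (A j) h
      · intro i hi
        have hne : S i ≠ j := by
          intro e
          have := hS' i
          rw [e] at this
          rw [e, this] at hi
          exact hi rfl
        have := hp4 _ hne
        rwa [hp1 i (S i) (hS' i) hi.symm] at this
      · rw [hA, hv]
    rw [← hv]
    exact this
end

section
/- Assume n ≥ 2 and let t be a lattice point of (n−2)Δ^{d−1}. Set T_t = ⋂_{j̄∈[d̄]} 𝕋(t+e_j̄). Then: (a) for every j̄ ∈ [d̄], the tree 𝕋(t+e_j̄) is the disjoint union of T_t and the j̄-pull G(t)^{→j̄}; (b) LD(T_t) = (1,…,1), i.e. T_t is a tope (it has exactly n edges, one incident to each vertex of [n]). -/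
open Finset

/-- Two edge sets differ in exactly one edge. -/
def diffOne {α β : Type*} [DecidableEq α] [DecidableEq β] (A B : BGraph α β) : Prop :=
  (A \ B).card = 1 ∧ (B \ A).card = 1

/-- The tree-linkage graph `G(t)` on the vertex set `[d]`. -/
def TLGraph {n d : ℕ} (Tr : (Fin d → ℕ) → BGraph (Fin n) (Fin d)) (t : Fin d → ℕ) :
    SimpleGraph (Fin d) :=
  SimpleGraph.fromRel fun j j' => diffOne (Tr (t + unitVec j)) (Tr (t + unitVec j'))

/-- The intersection `T_t` of the trees at positions `t + e_j`, `j ∈ [d]`. -/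
def interTree {n d : ℕ} (Tr : (Fin d → ℕ) → BGraph (Fin n) (Fin d)) (t : Fin d → ℕ) :
    BGraph (Fin n) (Fin d) :=
  Finset.univ.filter fun e => ∀ j : Fin d, e ∈ Tr (t + unitVec j)

/-- The `jb`-pull of the tree-linkage graph `G(t)`. -/
noncomputable def TLpull {n d : ℕ} (Tr : (Fin d → ℕ) → BGraph (Fin n) (Fin d))
    (t : Fin d → ℕ) (jb : Fin d) : BGraph (Fin n) (Fin d) := by
  classical
  exact Finset.univ.filter fun e : Fin n × Fin d =>
    ∃ j' : Fin d, (TLGraph Tr t).Adj e.2 j' ∧ e ∈ Tr (t + unitVec e.2) ∧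
      e ∉ Tr (t + unitVec j') ∧
      ((TLGraph Tr t).deleteEdges {s(e.2, j')}).Reachable jb e.2

section Core2

theorem core_nbr {V α : Type*} [Fintype V] (x : V → V → α)
    (star : ∀ j k c : V, j ≠ k → c ≠ j → c ≠ k → x c j = x k j ∨ x c k = x j k)
    (Q : V → Prop) (b : V) (i : α) (hb : ¬ Q b)
    (hQ : ∀ c, Q c → x c b = i)
    (hQ1 : ∀ c m, Q c → m ≠ b → m ≠ c → x m b = i → x c m ≠ x b m → Q m)
    (hex : ∃ c, Q c) :
    ∃ c, Q c ∧ c ≠ b ∧ ∀ m, m ≠ b → m ≠ c → x b m = x c m := by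
  classical
  let S : V → Finset V := fun c => Finset.univ.filter fun m => m ≠ c ∧ x m c = x b c
  obtain ⟨c, hc, hmin⟩ : ∃ c, Q c ∧ ∀ c', Q c' → (S c).card ≤ (S c').card := by
    obtain ⟨c0, hc0⟩ := hex
    obtain ⟨c, hc, hm⟩ := Finset.exists_min_image (Finset.univ.filter Q) (fun c => (S c).card)
      ⟨c0, by simpa using hc0⟩
    exact ⟨c, by simpa using hc, fun c' h' => hm c' (by simpa using h')⟩
  have hcb : c ≠ b := fun h => hb (h ▸ hc)
  refine ⟨c, hc, hcb, fun m hmb hmc => ?_⟩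
  by_contra hne
  have hne' : x c m ≠ x b m := fun h => hne h.symm
  have hmi : x m b = i := by
    rcases star m b c hmb hmc.symm hcb with h | h
    · exact absurd h hne'
    · rw [← h]; exact hQ c hc
  have hQm := hQ1 c m hc hmb hmc hmi hne'
  have hlt : (S m).card < (S c).card := by
    apply Finset.card_lt_card
    have hbm : x b c = x m c := by
      rcases star m c b hmc hmb.symm hcb.symm with h | h
      · exact absurd h hne
      · exact h
    rw [Finset.ssubset_iff_of_subset]
    · exact ⟨m, by simp [S, hmc, hbm], by simp [S]⟩
    · intro y hy
      simp only [S, Finset.mem_filter, Finset.mem_univ, true_and] at hy ⊢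
      have hyc : y ≠ c := by rintro rfl; exact hne' hy.2
      refine ⟨hyc, ?_⟩
      rcases star m c y hmc hy.1 hyc with h | h
      · exact absurd (hy.2.symm.trans h) hne
      · rw [h, hbm]
  exact absurd (hmin m hQm) (by omega)

variable {V α : Type*} [Fintype V] (x : V → V → α) (G : SimpleGraph V)

theorem core_exists
    (star : ∀ j k c : V, j ≠ k → c ≠ j → c ≠ k → x c j = x k j ∨ x c k = x j k)
    (hG : ∀ j k, G.Adj j k ↔ j ≠ k ∧ ∀ m, m ≠ j → m ≠ k → x j m = x k m)
    (b c : V) (hcb : c ≠ b) : ∃ j', G.Adj b j' ∧ x j' b = x c b := by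
  obtain ⟨j', ⟨h1, h2⟩, h3, h4⟩ := core_nbr x star (fun m => m ≠ b ∧ x m b = x c b) b (x c b)
    (by simp) (fun c h => h.2) (fun _ m _ h _ h' _ => ⟨h, h'⟩) ⟨c, hcb, rfl⟩
  exact ⟨j', (hG _ _).2 ⟨h3.symm, h4⟩, h2⟩

theorem core_conn
    (star : ∀ j k c : V, j ≠ k → c ≠ j → c ≠ k → x c j = x k j ∨ x c k = x j k)
    (hG : ∀ j k, G.Adj j k ↔ j ≠ k ∧ ∀ m, m ≠ j → m ≠ k → x j m = x k m)
    (notri : ∀ b j k, G.Adj b j → G.Adj b k → j ≠ k → x j b ≠ x k b) :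
    ∀ b j, G.Reachable b j := by
  classical
  suffices H : ∀ N, ∀ b j, b ≠ j →
      (Finset.univ.filter fun m => m ≠ b ∧ x m b = x j b).card ≤ N → G.Reachable b j by
    intro b j
    by_cases h : b = j
    · subst h; rfl
    · exact H _ b j h le_rfl
  intro N
  induction N with
  | zero =>
    intro b j hbj h
    exfalso
    have : j ∈ (Finset.univ.filter fun m => m ≠ b ∧ x m b = x j b) := by simp [hbj.symm]
    rw [Nat.le_zero, Finset.card_eq_zero] at h
    simp [h] at this
  | succ N ih =>
    intro b j hbj h
    obtain ⟨k, hk, hkj⟩ := core_exists x G star hG b j hbj.symm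
    refine hk.reachable.trans ?_
    by_cases hkj' : k = j
    · subst hkj'; rfl
    have hkb : k ≠ b := hk.ne.symm
    have hkG := ((hG _ _).1 hk).2
    have hne : x j k ≠ x b k := by
      intro hcon
      obtain ⟨c, ⟨h1, h1', h1''⟩, h3, h4⟩ := core_nbr x star
        (fun m => m ≠ b ∧ (x m b = x j b ∧ m ≠ k ∧ x m k = x b k) ∧ True) b (x j b)
        (by simp) (fun c h => h.2.1.1) (by
          rintro c m ⟨hc, ⟨hc2, hck, hc3⟩, -⟩ hmb hmc hmi hne
          have hmk : m ≠ k := by rintro rfl; exact hne hc3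
          refine ⟨hmb, ⟨hmi, hmk, ?_⟩, trivial⟩
          rcases star k m c hmk.symm hck hmc.symm with h | h
          · rw [← h, hc3]
          · exact absurd (h.trans (hkG m hmb hmk).symm) hne)
        ⟨j, hbj.symm, ⟨rfl, fun h => hkj' h.symm, hcon⟩, trivial⟩
      exact notri b k c hk ((hG _ _).2 ⟨h3.symm, h4⟩) h1'.2.1.symm (hkj.trans h1'.1.symm)
    apply ih k j hkj'
    refine Nat.lt_succ_iff.1 (lt_of_lt_of_le (Finset.card_lt_card ?_) h)
    rw [Finset.ssubset_iff_of_subset]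
    · exact ⟨k, by simp [hkb, hkj], by simp⟩
    · intro y hy
      simp only [Finset.mem_filter, Finset.mem_univ, true_and] at hy ⊢
      have hyb : y ≠ b := by rintro rfl; exact hne hy.2.symm
      refine ⟨hyb, ?_⟩
      rcases star k b y hkb hy.1 hyb with h | h
      · exact absurd (hy.2.symm.trans h) hne
      · rw [h, hkj]

theorem core_cut
    (star : ∀ j k c : V, j ≠ k → c ≠ j → c ≠ k → x c j = x k j ∨ x c k = x j k)
    (hG : ∀ j k, G.Adj j k ↔ j ≠ k ∧ ∀ m, m ≠ j → m ≠ k → x j m = x k m)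
    (notri : ∀ b j k, G.Adj b j → G.Adj b k → j ≠ k → x j b ≠ x k b)
    (b j' j : V) (hbj : G.Adj b j') :
    (G.deleteEdges {s(b, j')}).Reachable j b ↔ (j = b ∨ x j b ≠ x j' b) := by
  have key1 : ∀ m, (G.deleteEdges {s(b, j')}).Reachable b m → (m = b ∨ x m b ≠ x j' b) := by
    intro m hm
    rw [SimpleGraph.reachable_iff_reflTransGen] at hm
    induction hm with
    | refl => exact Or.inl rfl
    | @tail p q _ hpq ih =>
      rw [SimpleGraph.deleteEdges_adj] at hpq
      obtain ⟨hpq, hne⟩ := hpq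
      by_cases hq : q = b
      · exact Or.inl hq
      right
      rcases ih with rfl | ih
      · have : j' ≠ q := by rintro rfl; simp at hne
        exact (notri _ _ _ hbj hpq this).symm
      · by_cases hp : p = b
        · subst hp
          have : j' ≠ q := by rintro rfl; simp at hne
          exact (notri _ _ _ hbj hpq this).symm
        · rw [← ((hG _ _).1 hpq).2 b (Ne.symm hp) (Ne.symm hq)]; exact ih
  have key2 : ∀ m, (G.deleteEdges {s(b, j')}).Reachable j' m → (m ≠ b ∧ x m b = x j' b) := by
    intro m hm
    rw [SimpleGraph.reachable_iff_reflTransGen] at hm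
    induction hm with
    | refl => exact ⟨hbj.ne.symm, rfl⟩
    | @tail p q _ hpq ih =>
      rw [SimpleGraph.deleteEdges_adj] at hpq
      obtain ⟨hpq, hne⟩ := hpq
      by_cases hq : q = b
      · subst hq
        exfalso
        have : j' ≠ p := by rintro rfl; simp [Sym2.eq_swap] at hne
        exact notri _ _ _ hbj hpq.symm this ih.2.symm
      · exact ⟨hq, by rw [← ((hG _ _).1 hpq).2 b (Ne.symm ih.1) (Ne.symm hq)]; exact ih.2⟩
  have key3 : ∀ m, (G.deleteEdges {s(b, j')}).Reachable b m ∨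
      (G.deleteEdges {s(b, j')}).Reachable j' m := by
    intro m
    have hm := core_conn x G star hG notri b m
    rw [SimpleGraph.reachable_iff_reflTransGen] at hm
    induction hm with
    | refl => exact Or.inl (SimpleGraph.Reachable.refl _)
    | @tail p q _ hpq ih =>
      by_cases he : s(p, q) = s(b, j')
      · rcases Sym2.eq_iff.1 he with ⟨rfl, rfl⟩ | ⟨rfl, rfl⟩
        · exact Or.inr (SimpleGraph.Reachable.refl _)
        · exact Or.inl (SimpleGraph.Reachable.refl _)
      · have : (G.deleteEdges {s(b, j')}).Adj p q := by
          rw [SimpleGraph.deleteEdges_adj]; exact ⟨hpq, by simpa using he⟩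
        rcases ih with ih | ih
        · exact Or.inl (ih.trans this.reachable)
        · exact Or.inr (ih.trans this.reachable)
  constructor
  · intro h; exact key1 j h.symm
  · intro h
    rcases key3 j with h' | h'
    · exact h'.symm
    · have := key2 j h'
      tauto

end Core2

section TreeFacts

theorem tope_unique {n d : ℕ} {G G' : BGraph (Fin n) (Fin d)} (hc : Compatible G G')
    (f g : Fin n → Fin d) (hf : ∀ i, (i, f i) ∈ G) (hg : ∀ i, (i, g i) ∈ G')
    (hpos : ∀ b, (Finset.univ.filter fun i => f i = b).card =
      (Finset.univ.filter fun i => g i = b).card) : f = g := by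
  classical
  by_contra hne
  let D : Finset (Fin n) := Finset.univ.filter fun i => f i ≠ g i
  let F : Finset (Finset (Fin n)) :=
    D.powerset.filter fun I => I.Nonempty ∧ I.image g ⊆ I.image f
  have hD : D ∈ F := by
    simp only [F, Finset.mem_filter, Finset.mem_powerset, Finset.Subset.refl, true_and]
    constructor
    · obtain ⟨i, hi⟩ := Function.ne_iff.1 hne
      exact ⟨i, by simpa [D] using hi⟩
    · intro b hb
      obtain ⟨i, hi, rfl⟩ := Finset.mem_image.1 hb
      by_contra hcon
      have hsub : (Finset.univ.filter fun i' => f i' = g i) ⊂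
          (Finset.univ.filter fun i' => g i' = g i) := by
        rw [Finset.ssubset_iff_of_subset]
        · refine ⟨i, by simp, ?_⟩
          simpa [D] using hi
        · intro i' hi'
          simp only [Finset.mem_filter, Finset.mem_univ, true_and] at hi' ⊢
          by_contra h
          apply hcon
          rw [Finset.mem_image]
          refine ⟨i', ?_, hi'⟩
          simp only [D, Finset.mem_filter, Finset.mem_univ, true_and]
          rw [hi']; exact fun h' => h h'.symm
      exact absurd (hpos (g i)) (Finset.card_lt_card hsub).ne
  obtain ⟨I, hI, hmin⟩ := Finset.exists_min_image F Finset.card ⟨D, hD⟩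
  simp only [F, Finset.mem_filter, Finset.mem_powerset] at hI hmin
  obtain ⟨hID, hIne, hIs⟩ := hI
  have hfne : ∀ i ∈ I, f i ≠ g i := fun i hi => by simpa [D] using hID hi
  have herase : ∀ i ∈ I, ¬ ((I.erase i).Nonempty ∧ (I.erase i).image g ⊆ (I.erase i).image f) := by
    intro i hi h
    have := hmin (I.erase i) ⟨(Finset.erase_subset _ _).trans hID, h⟩
    have := Finset.card_erase_lt_of_mem hi
    omega
  have hinj : Set.InjOn f I := by
    intro a ha b hb hab
    by_contra hne
    apply herase a ha
    refine ⟨⟨b, Finset.mem_erase.2 ⟨Ne.symm hne, hb⟩⟩, ?_⟩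
    intro y hy
    have : y ∈ I.image f := hIs (Finset.image_subset_image (Finset.erase_subset _ _) hy)
    obtain ⟨c, hc, rfl⟩ := Finset.mem_image.1 this
    rw [Finset.mem_image]
    by_cases hca : c = a
    · exact ⟨b, Finset.mem_erase.2 ⟨Ne.symm hne, hb⟩, by rw [hca, hab]⟩
    · exact ⟨c, Finset.mem_erase.2 ⟨hca, hc⟩, rfl⟩
  have hfg : I.image f ⊆ I.image g := by
    intro y hy
    obtain ⟨a, ha, rfl⟩ := Finset.mem_image.1 hy
    by_contra hcon
    have hmap : ∀ c ∈ I, ∃ e ∈ I.erase a, f e = g c := by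
      intro c hc
      obtain ⟨e, he, hec⟩ := Finset.mem_image.1 (hIs (Finset.mem_image_of_mem g hc))
      refine ⟨e, Finset.mem_erase.2 ⟨?_, he⟩, hec⟩
      rintro rfl
      exact hcon (hec ▸ Finset.mem_image_of_mem g hc)
    apply herase a ha
    constructor
    · obtain ⟨e, he, -⟩ := hmap a ha
      exact ⟨e, he⟩
    · intro y hy
      obtain ⟨c, hc, rfl⟩ := Finset.mem_image.1 hy
      obtain ⟨e, he, hec⟩ := hmap c (Finset.mem_of_mem_erase hc)
      exact Finset.mem_image.2 ⟨e, he, hec⟩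
  have heq : I.image f = I.image g := Finset.Subset.antisymm hfg hIs
  have hinjg : Set.InjOn g I := by
    rw [← Finset.card_image_iff, ← heq, Finset.card_image_iff]; exact hinj
  have hmatch : ∀ h : Fin n → Fin d, Set.InjOn h I → I.image h = I.image f →
      IsMatching (I.image fun i => (i, h i)) I (I.image f) := by
    intro h hh him
    refine ⟨?_, ?_, ?_⟩
    · intro e he
      obtain ⟨i, hi, rfl⟩ := Finset.mem_image.1 he
      exact ⟨hi, him ▸ Finset.mem_image_of_mem h hi⟩
    · intro a ha
      refine ⟨h a, Finset.mem_image.2 ⟨a, ha, rfl⟩, ?_⟩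
      intro b hb
      obtain ⟨i, hi, hie⟩ := Finset.mem_image.1 hb
      simp only [Prod.mk.injEq] at hie
      rw [← hie.2, hie.1]
    · intro b hb
      rw [← him] at hb
      obtain ⟨a, ha, rfl⟩ := Finset.mem_image.1 hb
      refine ⟨a, Finset.mem_image.2 ⟨a, ha, rfl⟩, ?_⟩
      intro c hc
      obtain ⟨i, hi, hie⟩ := Finset.mem_image.1 hc
      simp only [Prod.mk.injEq] at hie
      rw [← hie.1]
      exact hh hi ha hie.2
  have := hc I (I.image f) (I.image fun i => (i, f i)) (I.image fun i => (i, g i))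
    (by intro e he; obtain ⟨i, hi, rfl⟩ := Finset.mem_image.1 he; exact hf i)
    (by intro e he; obtain ⟨i, hi, rfl⟩ := Finset.mem_image.1 he; exact hg i)
    (hmatch f hinj rfl) (hmatch g hinjg heq.symm)
  obtain ⟨a, ha⟩ := hIne
  have h1 : (a, f a) ∈ I.image fun i => (i, g i) := by
    rw [← this]; exact Finset.mem_image.2 ⟨a, ha, rfl⟩
  obtain ⟨i, hi, hie⟩ := Finset.mem_image.1 h1
  simp only [Prod.mk.injEq] at hie
  exact hfne a ha (by rw [← hie.2, hie.1])

theorem toGraph_adj_lr {n d : ℕ} (T : BGraph (Fin n) (Fin d)) (i : Fin n) (b : Fin d) :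
    (toGraph T).Adj (Sum.inl i) (Sum.inr b) ↔ (i, b) ∈ T := by
  simp [toGraph]

theorem tree_parent {V : Type*} {G : SimpleGraph V} (hG : G.IsTree) (r v : V) (hv : v ≠ r) :
    ∃ w, G.Adj v w ∧ G.dist r v = G.dist r w + 1 ∧
      ∀ w', G.Adj v w' → G.dist r v = G.dist r w' + 1 → w' = w := by
  obtain ⟨p, hp, hlen⟩ := hG.connected.exists_path_of_dist v r
  have hnil : ¬ p.Nil := SimpleGraph.Walk.not_nil_of_ne hv
  have key : ∀ w', G.Adj v w' → G.dist r v = G.dist r w' + 1 → w' = p.snd := by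
    intro w' hw' hd
    obtain ⟨q, hq, hql⟩ := hG.connected.exists_path_of_dist w' r
    have hlen2 : (SimpleGraph.Walk.cons hw' q).length = G.dist v r := by
      rw [SimpleGraph.Walk.length_cons, hql, SimpleGraph.dist_comm, ← hd, SimpleGraph.dist_comm]
    have hq' := SimpleGraph.Walk.isPath_of_length_eq_dist _ hlen2
    have := (hG.existsUnique_path v r).unique hp hq'
    rw [this]; simp
  refine ⟨p.snd, p.adj_snd hnil, ?_, key⟩
  have h1 : p.tail.length + 1 = p.length := SimpleGraph.Walk.length_tail_add_one hnil
  have h2 := SimpleGraph.dist_le p.tail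
  have h3 := hG.dist_eq_dist_add_one_of_adj r (p.adj_snd hnil)
  rw [SimpleGraph.dist_comm] at h2 hlen
  omega

theorem tree_root {n d : ℕ} (hd : 1 ≤ d) (T : BGraph (Fin n) (Fin d))
    (hT : IsTreeOn T Finset.univ Finset.univ) :
    ∃ (A : Fin d → Fin n → Fin d) (h : Fin d → Fin n → ℕ),
      (∀ k i, (i, A k i) ∈ T) ∧ (∀ i b, (i, b) ∈ T → A b i = b) ∧
      (∀ k b, b ≠ k → ∃ i', (i', b) ∈ T ∧ A k i' ≠ b ∧
        (∀ i, (i, b) ∈ T → A k i ≠ b → i = i') ∧ (∀ i, A k i = b → h k i' < h k i)) := by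
  have htree : (toGraph T).IsTree := by
    refine ⟨?_, hT.2.1⟩
    haveI : Nonempty (Fin n ⊕ Fin d) := ⟨Sum.inr ⟨0, hd⟩⟩
    refine ⟨fun x y => hT.2.2 x y ?_ ?_⟩
    · cases x <;> simp
    · cases y <;> simp
  set G := toGraph T with hGdef
  have hA : ∀ (k : Fin d) (i : Fin n), ∃ b : Fin d, (i, b) ∈ T ∧
      G.dist (Sum.inr k) (Sum.inl i) = G.dist (Sum.inr k) (Sum.inr b) + 1 ∧
      ∀ b', (i, b') ∈ T → G.dist (Sum.inr k) (Sum.inl i) = G.dist (Sum.inr k) (Sum.inr b') + 1 →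
        b' = b := by
    intro k i
    obtain ⟨w, hw, hd, hu⟩ := tree_parent htree (Sum.inr k) (Sum.inl i) (by simp)
    rcases w with w | w
    · simp [hGdef, toGraph] at hw
    · refine ⟨w, (toGraph_adj_lr T i w).1 hw, hd, fun b' hb' hd' => ?_⟩
      exact Sum.inr_injective (hu _ ((toGraph_adj_lr T i b').2 hb') hd')
  choose A hA1 hA2 hA3 using hA
  refine ⟨A, fun k i => G.dist (Sum.inr k) (Sum.inl i), hA1, ?_, ?_⟩
  · intro i b hib
    refine (hA3 b i b hib ?_).symm
    rw [SimpleGraph.dist_self, zero_add, SimpleGraph.dist_eq_one_iff_adj]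
    exact ((toGraph_adj_lr T i b).2 hib).symm
  · intro k b hbk
    obtain ⟨w, hw, hd, hu⟩ := tree_parent htree (Sum.inr k) (Sum.inr b) (by simpa using hbk)
    rcases w with w | w
    swap
    · simp [hGdef, toGraph] at hw
    have hwT := (toGraph_adj_lr T w b).1 hw.symm
    refine ⟨w, hwT, ?_, ?_, ?_⟩
    · intro h
      have := hA2 k w
      rw [h] at this
      omega
    · intro i hib hne
      refine Sum.inl_injective (hu _ ((toGraph_adj_lr T i b).2 hib).symm ?_)
      rcases htree.dist_eq_dist_add_one_of_adj (Sum.inr k) ((toGraph_adj_lr T i b).2 hib) with h | h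
      · exact absurd (hA3 k i b hib h).symm hne
      · exact h
    · intro i hi
      have := hA2 k i
      rw [hi] at this
      simp only
      omega

theorem root_pos {n d : ℕ} (T : BGraph (Fin n) (Fin d)) (f : Fin n → Fin d) (k : Fin d)
    (h1 : ∀ i, (i, f i) ∈ T) (h2 : ∀ i, (i, k) ∈ T → f i = k)
    (h3 : ∀ b, b ≠ k → ∃ i', (i', b) ∈ T ∧ f i' ≠ b ∧ (∀ i, (i, b) ∈ T → f i ≠ b → i = i'))
    (b : Fin d) :
    (Finset.univ.filter fun i => f i = b).card + 1 = RD T b + (if b = k then 1 else 0) := by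
  classical
  have hRD : RD T b = (Finset.univ.filter fun i : Fin n => (i, b) ∈ T).card := by
    unfold RD
    refine Finset.card_bij' (fun e _ => e.1) (fun i _ => (i, b)) ?_ ?_ ?_ ?_
    · rintro ⟨i, c⟩ h
      simp only [Finset.mem_filter, Finset.mem_univ, true_and] at h ⊢
      rw [← h.2]; exact h.1
    · intro i h; simpa using h
    · rintro ⟨i, c⟩ h
      simp only [Finset.mem_filter] at h
      simp [h.2]
    · intro i h; rfl
  rw [hRD]
  by_cases hbk : b = k
  · subst hbk
    simp only [if_true]
    congr 2
    ext i
    simp only [Finset.mem_filter, Finset.mem_univ, true_and]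
    exact ⟨fun h => h ▸ h1 i, h2 i⟩
  · obtain ⟨i', hi', hne, hu⟩ := h3 b hbk
    rw [if_neg hbk, add_zero]
    have : (Finset.univ.filter fun i : Fin n => (i, b) ∈ T) =
        insert i' (Finset.univ.filter fun i => f i = b) := by
      ext i
      simp only [Finset.mem_filter, Finset.mem_univ, true_and, Finset.mem_insert]
      constructor
      · intro h
        by_cases hf : f i = b
        · exact Or.inr hf
        · exact Or.inl (hu i h hf)
      · rintro (rfl | h)
        · exact hi'
        · exact h ▸ h1 i
    rw [this, Finset.card_insert_of_notMem (by simpa using hne)]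

end TreeFacts

section Core1

theorem core_data {n d : ℕ} (hd : 1 ≤ d) (T : Fin d → BGraph (Fin n) (Fin d)) (t : Fin d → ℕ)
    (htree : ∀ j, IsTreeOn (T j) Finset.univ Finset.univ)
    (hRD : ∀ j b, RD (T j) b = t b + (if b = j then 1 else 0) + 1)
    (hcompat : ∀ j k, Compatible (T j) (T k)) :
    (∀ i, ∃ b, ∀ j, (i, b) ∈ T j) ∧
    (∀ i b c, (i, c) ∈ T b → (i, b) ∈ T c → b = c) ∧
    (∀ j i b, (i, b) ∈ T j → (i, b) ∈ T b) ∧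
    ∃ x : Fin d → Fin d → Fin n,
      (∀ j b, j ≠ b → (x j b, b) ∈ T b ∧ (x j b, b) ∉ T j ∧
        ∀ i, (i, b) ∈ T b → (i, b) ∉ T j → i = x j b) ∧
      (∀ j k c, j ≠ k → c ≠ j → c ≠ k → x c j = x k j ∨ x c k = x j k) ∧
      (∀ b j k, b ≠ j → b ≠ k → j ≠ k → (∀ m, m ≠ b → m ≠ j → x b m = x j m) →
        (∀ m, m ≠ b → m ≠ k → x b m = x k m) → x j b ≠ x k b) := by
  classical
  choose A h hA1 hA2 hA3 using fun j => tree_root hd (T j) (htree j)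
  have hpos : ∀ j k b, (Finset.univ.filter fun i => A j k i = b).card =
      t b + (if b = j then 1 else 0) + (if b = k then 1 else 0) := by
    intro j k b
    have := root_pos (T j) (A j k) k (hA1 j k) (fun i => hA2 j i k) (by
      intro b hb
      obtain ⟨i', a1, a2, a3, -⟩ := hA3 j k b hb
      exact ⟨i', a1, a2, a3⟩) b
    rw [hRD] at this
    omega
  have hsymm : ∀ j k, A j k = A k j := by
    intro j k
    apply tope_unique (hcompat j k) _ _ (hA1 j k) (hA1 k j)
    intro b
    rw [hpos, hpos]; omega
  have hP : ∀ j i b, (i, b) ∈ T j ↔ A b j i = b := by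
    intro j i b
    rw [hsymm]
    exact ⟨hA2 j i b, fun h => by have := hA1 j b i; rwa [h] at this⟩
  have hsub : ∀ j i b, (i, b) ∈ T j → (i, b) ∈ T b := by
    intro j i b hib
    rw [hP] at hib
    have := hA1 b j i
    rwa [hib] at this
  have htwo : ∀ i b c, (i, c) ∈ T b → (i, b) ∈ T c → b = c := by
    intro i b c h1 h2
    rw [hP] at h1 h2
    rw [← h1, hsymm, h2]
  have hx : ∀ j b, ∃ i, j ≠ b → ((i, b) ∈ T b ∧ (i, b) ∉ T j ∧
        ∀ i', (i', b) ∈ T b → (i', b) ∉ T j → i' = i) := by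
    intro j b
    by_cases hjb : j = b
    · have : 0 < RD (T j) b := by rw [hRD]; omega
      unfold RD at this
      obtain ⟨e, -⟩ := Finset.card_pos.1 this
      exact ⟨e.1, fun h => absurd hjb h⟩
    · obtain ⟨i', a1, a2, a3, -⟩ := hA3 b j b (Ne.symm hjb)
      refine ⟨i', fun _ => ⟨a1, ?_, ?_⟩⟩
      · rw [hP]; exact a2
      · intro i hi hi'
        rw [hP] at hi'
        exact a3 i hi hi'
  choose x hx using hx
  have hL : ∀ j c k, j ≠ k → c ≠ k → x j k ≠ x c k → ∀ i, (i, A j c i) ∈ T k := by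
    intro j c k hjk hck hne
    have hdis : ∀ N i, h k k i ≤ N → A k j i ≠ A k k i → A k c i = A k k i := by
      intro N
      induction N using Nat.strong_induction_on with
      | _ N ih =>
        intro i hN hj
        by_contra hc
        by_cases hb : A k k i = k
        · have h1 := hA1 k k i
          rw [hb] at h1 hj hc
          have e1 := (hx j k hjk).2.2 i h1 (by rw [hP]; exact hj)
          have e2 := (hx c k hck).2.2 i h1 (by rw [hP]; exact hc)
          exact hne (e1.symm.trans e2)
        · obtain ⟨i', a1, a2, a3, a4⟩ := hA3 k k _ hb
          have hi' := a4 i rfl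
          have hii : i ≠ i' := by
            rintro rfl
            exact a2 rfl
          have hib := hA1 k k i
          have aux : ∀ m, A k m i ≠ A k k i → A k m i' = A k k i := by
            intro m hm
            have hbm : A k k i ≠ m := by
              intro hbm
              have := hA2 k i _ hib
              rw [hbm] at this hm
              exact hm this
            obtain ⟨i'', c1, c2, c3, -⟩ := hA3 k m _ hbm
            by_contra hcon
            exact hii ((c3 i hib hm).trans (c3 i' a1 hcon).symm)
          have := ih (h k k i') (by omega) i' le_rfl (by rw [aux j hj]; exact a2.symm)
          rw [aux c hc] at this
          exact a2 this.symm
    let B : Fin n → Fin d := fun i => if A k j i = A k k i then A k c i else A k j i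
    have hB : B = A j c := by
      apply tope_unique (hcompat k j) B (A j c) _ (hA1 j c)
      · intro b
        have hpt : ∀ i, (if B i = b then 1 else 0) + (if A k k i = b then 1 else 0) =
            (if A k j i = b then 1 else 0) + (if A k c i = b then 1 else 0) := by
          intro i
          by_cases hj : A k j i = A k k i
          · simp only [B, if_pos hj]; rw [hj]; omega
          · simp only [B, if_neg hj]; rw [hdis _ i le_rfl hj]
        have hs := Finset.sum_congr (rfl : (Finset.univ : Finset (Fin n)) = Finset.univ)
          (fun i _ => hpt i)
        rw [Finset.sum_add_distrib, Finset.sum_add_distrib] at hs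
        simp only [← Finset.card_filter] at hs
        rw [hpos, hpos, hpos] at hs
        rw [hpos]
        omega
      · intro i
        simp only [B]
        split_ifs
        · exact hA1 k c i
        · exact hA1 k j i
    intro i
    rw [← hB]
    simp only [B]
    split_ifs
    · exact hA1 k c i
    · exact hA1 k j i
  have hstar : ∀ j k c, j ≠ k → c ≠ j → c ≠ k → x c j = x k j ∨ x c k = x j k := by
    intro j k c hjk hcj hck
    by_contra! hcon
    obtain ⟨h1, h2⟩ := hcon
    have := hL j c k hjk hck (Ne.symm h2) (x k j)
    obtain ⟨k1, k2, k3⟩ := hx k j hjk.symm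
    have hm : A j c (x k j) = j := by
      rw [← hP]
      by_contra hcon
      exact h1 ((hx c j hcj).2.2 _ k1 hcon).symm
    rw [hm] at this
    exact k2 this
  refine ⟨?_, htwo, hsub, x, hx, hstar, ?_⟩
  · -- existence of a sink
    intro i
    let R : Fin d → Fin d → Prop := fun m j => (i, m) ∈ T j ∧ j ≠ m
    have htrans : ∀ k m j, R k m → R m j → R k j := by
      rintro k m j ⟨h1, h2⟩ ⟨h3, h4⟩
      have hkj : j ≠ k := by
        rintro rfl
        exact h4 (htwo i j m h3 h1)
      refine ⟨?_, hkj⟩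
      by_contra hcon
      have hik := hsub _ _ _ h1
      have him := hsub _ _ _ h3
      have e1 : i = x j k := (hx j k hkj).2.2 i hik hcon
      have e2 : i ≠ x m k := by
        intro e; exact (hx m k h2).2.1 (e ▸ h1)
      have e3 : i = x k m := (hx k m h2.symm).2.2 i him
        (fun hh => h2 (htwo i m k h1 hh))
      have e4 : i ≠ x j m := by
        intro e; exact (hx j m h4).2.1 (e ▸ h3)
      rcases hstar m k j h2 h4 hkj with e | e
      · exact e4 (by rw [e, ← e3])
      · exact e2 (by rw [← e, ← e1])
    have hirr : ∀ a, ¬ R a a := fun a ha => ha.2 rfl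
    haveI : IsTrans (Fin d) R := ⟨htrans⟩
    haveI : Std.Irrefl R := ⟨hirr⟩
    have hwf : WellFounded R := Finite.wellFounded_of_trans_of_irrefl R
    obtain ⟨b, -, hb⟩ := hwf.has_min Set.univ ⟨⟨0, hd⟩, trivial⟩
    have hleaf : ∀ c, (i, c) ∈ T b → c = b := by
      intro c hc
      by_contra hne
      exact hb c trivial ⟨hc, Ne.symm hne⟩
    refine ⟨b, fun j => ?_⟩
    rw [hP]
    exact hleaf _ (hA1 b j i)
  · -- no triangles
    intro b j k hbj hbk hjk hj hk hjkb
    obtain ⟨p1, p2, p3⟩ := hx j b hbj.symm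
    obtain ⟨q1, q2, q3⟩ := hx k b hbk.symm
    set i1 := x j b with hi1
    rw [← hjkb] at q1 q2
    set S := (T b).erase (i1, b) with hS
    let W : Fin n ⊕ Fin d → Prop := fun v => (toGraph S).Reachable (Sum.inl i1) v
    have hWi : W (Sum.inl i1) := SimpleGraph.Reachable.refl _
    have hWb : ¬ W (Sum.inr b) := by
      intro hw
      have hbr := SimpleGraph.isAcyclic_iff_forall_adj_isBridge.1 (htree b).2.1
        ((toGraph_adj_lr (T b) i1 b).2 p1)
      rw [SimpleGraph.isBridge_iff] at hbr
      apply hbr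
      refine hw.mono ?_
      intro u v huv
      rw [SimpleGraph.deleteEdges_adj]
      rcases u with u | u <;> rcases v with v | v
      · simp [toGraph] at huv
      · rw [toGraph_adj_lr] at huv ⊢
        rw [hS, Finset.mem_erase] at huv
        refine ⟨huv.2, ?_⟩
        simpa using huv.1
      · have huv := huv.symm
        rw [SimpleGraph.adj_comm]
        rw [toGraph_adj_lr] at huv ⊢
        rw [hS, Finset.mem_erase] at huv
        refine ⟨huv.2, ?_⟩
        have := huv.1
        simp only [ne_eq, Prod.mk.injEq] at this
        simp
        tauto
      · simp [toGraph] at huv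
    have hWS : ∀ i m, (i, m) ∈ S → (W (Sum.inl i) ↔ W (Sum.inr m)) := by
      intro i m him
      have := (toGraph_adj_lr S i m).2 him
      exact ⟨fun hw => hw.trans this.reachable, fun hw => hw.trans this.symm.reachable⟩
    let WR : Finset (Fin d) := Finset.univ.filter fun m => W (Sum.inr m)
    have hcount : ∀ f : Fin n → Fin d, (Finset.univ.filter fun i => f i ∈ WR).card =
        ∑ m ∈ WR, (Finset.univ.filter fun i => f i = m).card := by
      intro f
      rw [Finset.card_eq_sum_card_fiberwise (f := f) (t := WR)]
      · apply Finset.sum_congr rfl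
        intro m hm
        congr 1
        ext i
        simp only [Finset.mem_filter, Finset.mem_univ, true_and]
        exact ⟨fun h => h.2, fun h => ⟨h ▸ hm, h⟩⟩
      · intro i hi; simpa using hi
    have hcount2 : ∀ p q, (Finset.univ.filter fun i => A p q i ∈ WR).card =
        (∑ m ∈ WR, t m) + (if p ∈ WR then 1 else 0) + (if q ∈ WR then 1 else 0) := by
      intro p q
      rw [hcount]
      simp only [hpos, Finset.sum_add_distrib, Finset.sum_ite_eq']
    have hcount3 : ∀ p q, (∀ i, (i, A p q i) ∈ S) →
        (Finset.univ.filter fun i => A p q i ∈ WR).card =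
          (Finset.univ.filter fun i : Fin n => W (Sum.inl i)).card := by
      intro p q hpq
      congr 1
      ext i
      simp only [Finset.mem_filter, Finset.mem_univ, true_and, WR]
      exact (hWS _ _ (hpq i)).symm
    have hbb : (Finset.univ.filter fun i => A b b i ∈ WR).card + 1 =
          (Finset.univ.filter fun i : Fin n => W (Sum.inl i)).card := by
      have : (Finset.univ.filter fun i : Fin n => W (Sum.inl i)) =
          insert i1 (Finset.univ.filter fun i => A b b i ∈ WR) := by
        ext i
        simp only [Finset.mem_filter, Finset.mem_univ, true_and, WR, Finset.mem_insert]
        by_cases hii : i = i1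
        · subst hii; simp [hWi]
        · simp only [hii, false_or]
          apply hWS
          rw [hS, Finset.mem_erase]
          exact ⟨by simp [hii], hA1 b b i⟩
      rw [this, Finset.card_insert_of_notMem]
      simp only [Finset.mem_filter, Finset.mem_univ, true_and, WR]
      rw [hA2 b i1 b p1]; exact hWb
    have s1 : ∀ i, (i, A b j i) ∈ S := by
      intro i
      rw [hS, Finset.mem_erase]
      refine ⟨?_, hA1 b j i⟩
      intro he
      apply p2
      rw [← he, hsymm]; exact hA1 j b i
    have s2 : ∀ i, (i, A b k i) ∈ S := by
      intro i
      rw [hS, Finset.mem_erase]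
      refine ⟨?_, hA1 b k i⟩
      intro he
      apply q2
      rw [← he, hsymm]; exact hA1 k b i
    have s3 : ∀ i, (i, A j k i) ∈ S := by
      intro i
      have m1 := hA1 j k i
      have m2 := hA1 k j i
      rw [hsymm k j] at m2
      rw [hS, Finset.mem_erase]
      refine ⟨fun he => p2 (he ▸ m1), ?_⟩
      generalize A j k i = m at m1 m2
      have mm := hsub _ _ _ m1
      by_cases hmb : m = b
      · subst hmb; exact mm
      by_contra hcon
      have e := (hx b m (Ne.symm hmb)).2.2 i mm hcon
      by_cases hmj : m = j
      · subst hmj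
        rw [hk m hmb hjk] at e
        exact (hx k m hjk.symm).2.1 (e ▸ m2)
      · rw [hj m hmb hmj] at e
        exact (hx j m (Ne.symm hmj)).2.1 (e ▸ m1)
    have c1 := hcount3 _ _ s1
    have c2 := hcount3 _ _ s2
    have c3 := hcount3 _ _ s3
    rw [hcount2] at c1 c2 c3 hbb
    have hbW : b ∉ WR := by simpa [WR] using hWb
    simp only [hbW, if_false] at c1 c2 hbb
    split_ifs at c1 c2 c3 <;> omega

end Core1

theorem statement6 {n d : ℕ} (hn : 2 ≤ n) (hd : 1 ≤ d)
    (Tr : (Fin d → ℕ) → BGraph (Fin n) (Fin d))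
    (htree : ∀ u : Fin d → ℕ, (∑ j, u j) + 1 = n → IsTreeOn (Tr u) Finset.univ Finset.univ)
    (hRDeg : ∀ u : Fin d → ℕ, (∑ j, u j) + 1 = n → ∀ j, RD (Tr u) j = u j + 1)
    (hcompat : ∀ u u' : Fin d → ℕ, (∑ j, u j) + 1 = n → (∑ j, u' j) + 1 = n →
      Compatible (Tr u) (Tr u'))
    (hlink : ∀ u : Fin d → ℕ, (∑ j, u j) + 1 = n → ∀ e ∈ Tr u,
      2 ≤ LD (Tr u) e.1 → 2 ≤ RD (Tr u) e.2 →
      ∃ u' : Fin d → ℕ, ((∑ j, u' j) + 1 = n) ∧ ∃ e' ∈ Tr u',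
        (Tr u).erase e = (Tr u').erase e')
    (t : Fin d → ℕ) (ht : (∑ j, t j) + 2 = n) :
    (∀ jb : Fin d,
      Tr (t + unitVec jb) = interTree Tr t ∪ TLpull Tr t jb ∧
        Disjoint (interTree Tr t) (TLpull Tr t jb)) ∧
    (∀ i : Fin n, LD (interTree Tr t) i = 1) ∧
    (interTree Tr t).card = n := by
  classical
  have hsum : ∀ j : Fin d, (∑ k, (t + unitVec j) k) + 1 = n := by
    intro j
    simp only [Pi.add_apply, unitVec, Finset.sum_add_distrib, Finset.sum_ite_eq',
      Finset.mem_univ, if_true]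
    omega
  obtain ⟨hsink, htwo, hsub, x, hx, hstar, hnotri⟩ := core_data hd
    (fun j => Tr (t + unitVec j)) t (fun j => htree _ (hsum j))
    (fun j b => by rw [hRDeg _ (hsum j)]; simp [unitVec])
    (fun j k => hcompat _ _ (hsum j) (hsum k))
  set T : Fin d → BGraph (Fin n) (Fin d) := fun j => Tr (t + unitVec j) with hT
  have hmem : ∀ j i b, (i, b) ∈ T j ↔ (i, b) ∈ T b ∧ (j = b ∨ i ≠ x j b) := by
    intro j i b
    by_cases hjb : j = b
    · subst hjb; simp
    · constructor
      · intro h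
        exact ⟨hsub _ _ _ h, Or.inr fun e => (hx j b hjb).2.1 (e ▸ h)⟩
      · rintro ⟨h1, h2 | h2⟩
        · exact absurd h2 hjb
        · by_contra hcon
          exact h2 ((hx j b hjb).2.2 i h1 hcon)
  have hdiff : ∀ j k, j ≠ k → ((T j \ T k).card = 1 ↔ ∀ m, m ≠ j → m ≠ k → x j m = x k m) := by
    intro j k hjk
    have hin : (x k j, j) ∈ T j \ T k := by
      obtain ⟨h1, h2, -⟩ := hx k j hjk.symm
      exact Finset.mem_sdiff.2 ⟨h1, h2⟩
    constructor
    · intro hc m hmj hmk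
      obtain ⟨e, he⟩ := Finset.card_eq_one.1 hc
      by_contra hne
      have h1 : (x k m, m) ∈ T j \ T k := by
        obtain ⟨h1, h2, -⟩ := hx k m (Ne.symm hmk)
        exact Finset.mem_sdiff.2 ⟨(hmem _ _ _).2 ⟨h1, Or.inr (Ne.symm hne)⟩, h2⟩
      rw [he, Finset.mem_singleton] at hin h1
      have := hin.trans h1.symm
      simp only [Prod.mk.injEq] at this
      exact hmj this.2.symm
    · intro hm
      rw [Finset.card_eq_one]
      refine ⟨(x k j, j), ?_⟩
      ext ⟨i, b⟩
      rw [Finset.mem_singleton]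
      constructor
      · intro h
        rw [Finset.mem_sdiff] at h
        have hib := hsub _ _ _ h.1
        by_cases hbk : b = k
        · subst hbk; exact absurd hib h.2
        have e := (hx k b (Ne.symm hbk)).2.2 i hib h.2
        by_cases hbj : b = j
        · subst hbj; rw [e]
        · rw [← hm b hbj hbk] at e
          exact absurd (e ▸ h.1) (hx j b (Ne.symm hbj)).2.1
      · intro h; rw [h]; exact hin
  have hG : ∀ j k, (TLGraph Tr t).Adj j k ↔
      j ≠ k ∧ ∀ m, m ≠ j → m ≠ k → x j m = x k m := by
    intro j k
    unfold TLGraph diffOne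
    rw [SimpleGraph.fromRel_adj]
    apply and_congr_right
    intro hjk
    have h1 := hdiff j k hjk
    have h2 := hdiff k j hjk.symm
    simp only [hT] at h1 h2
    rw [h1, h2]
    constructor
    · rintro (h | h)
      · exact h.1
      · exact h.2
    · intro h
      exact Or.inl ⟨h, fun m a b => (h m b a).symm⟩
  have hnotri' : ∀ b j k, (TLGraph Tr t).Adj b j → (TLGraph Tr t).Adj b k → j ≠ k →
      x j b ≠ x k b := by
    intro b j k h1 h2 hjk
    rw [hG] at h1 h2
    exact hnotri b j k h1.1 h2.1 hjk h1.2 h2.2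
  have hpull : ∀ jb i b, (i, b) ∈ TLpull Tr t jb ↔
      ∃ j', (TLGraph Tr t).Adj b j' ∧ i = x j' b ∧ (jb = b ∨ x jb b ≠ i) := by
    intro jb i b
    unfold TLpull
    simp only [Finset.mem_filter, Finset.mem_univ, true_and]
    apply exists_congr
    intro j'
    apply and_congr_right
    intro hadj
    rw [core_cut x _ hstar hG hnotri' b j' jb hadj]
    have hs := hx j' b hadj.ne.symm
    constructor
    · rintro ⟨h1, h2, h3⟩
      have e := hs.2.2 i h1 h2
      exact ⟨e, by rw [e]; exact h3⟩
    · rintro ⟨h1, h2⟩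
      subst h1
      exact ⟨hs.1, hs.2.1, h2⟩
  have hint : ∀ i b, (i, b) ∈ interTree Tr t ↔ ∀ j, (i, b) ∈ T j := by
    intro i b
    simp [interTree, hT]
  choose τ hτ using hsink
  have hint2 : ∀ i b, (i, b) ∈ interTree Tr t ↔ b = τ i := by
    intro i b
    rw [hint]
    constructor
    · intro h
      exact htwo i b (τ i) (hτ i b) (h (τ i))
    · rintro rfl; exact hτ i
  refine ⟨fun jb => ⟨?_, ?_⟩, ?_, ?_⟩
  · ext ⟨i, b⟩
    change (i, b) ∈ T jb ↔ _
    rw [Finset.mem_union, hpull, hmem]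
    constructor
    · rintro ⟨h1, h2⟩
      by_cases hall : (i, b) ∈ interTree Tr t
      · exact Or.inl hall
      right
      rw [hint] at hall
      push Not at hall
      obtain ⟨c, hc⟩ := hall
      have hcb : c ≠ b := by rintro rfl; exact hc h1
      obtain ⟨j', hj', hxj⟩ := core_exists x _ hstar hG b c hcb
      refine ⟨j', hj', ?_, ?_⟩
      · rw [hxj]; exact (hx c b hcb).2.2 i h1 hc
      · exact h2.imp id Ne.symm
    · rintro (h | ⟨j', hj', rfl, h⟩)
      · rw [hint] at h
        exact (hmem _ _ _).1 (h jb)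
      · exact ⟨(hx j' b hj'.ne.symm).1, h.imp id Ne.symm⟩
  · rw [Finset.disjoint_left]
    rintro ⟨i, b⟩ h1 h2
    rw [hint] at h1
    rw [hpull] at h2
    obtain ⟨j', hj', rfl, -⟩ := h2
    exact (hx j' b hj'.ne.symm).2.1 (h1 j')
  · intro i
    unfold LD
    rw [Finset.card_eq_one]
    refine ⟨(i, τ i), ?_⟩
    ext ⟨a, b⟩
    simp only [Finset.mem_filter, Finset.mem_singleton, Prod.mk.injEq, hint2]
    constructor
    · rintro ⟨h, rfl⟩; exact ⟨rfl, h⟩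
    · rintro ⟨rfl, h⟩; exact ⟨h, rfl⟩
  · have : interTree Tr t = Finset.univ.image fun i => (i, τ i) := by
      ext ⟨a, b⟩
      simp only [hint2, Finset.mem_image, Finset.mem_univ, true_and, Prod.mk.injEq]
      constructor
      · intro h; exact ⟨a, rfl, h.symm⟩
      · rintro ⟨i, rfl, h⟩; exact h.symm
    rw [this, Finset.card_image_of_injective]
    · simp
    · intro a b h
      simp only [Prod.mk.injEq] at h
      exact h.1
end

section
/- Assume n ≥ 2. For every lattice point t of (n−2)Δ^{d−1} and every j̄ ∈ [d̄], the number of edges of the tree-linkage graph G(t) incident to j̄, plus the degree of j̄ in T_t = ⋂_{j̄'∈[d̄]} 𝕋(t+e_j̄'), equals t_j̄ + 2. -/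
open Finset

/-- The number of edges of the tree-linkage graph incident to `jb`. -/
noncomputable def TLdeg {n d : ℕ} (Tr : (Fin d → ℕ) → BGraph (Fin n) (Fin d))
    (t : Fin d → ℕ) (jb : Fin d) : ℕ := by
  classical
  exact (Finset.univ.filter fun j' : Fin d => (TLGraph Tr t).Adj jb j').card


set_option linter.unusedSectionVars false
section Cyc

variable {α β : Type*} [DecidableEq α] [DecidableEq β] [Fintype α] [Fintype β]

/-- integer matrix supported on an edge set -/
def SuppOn (f : α → β → ℤ) (U : BGraph α β) : Prop := ∀ a b, f a b ≠ 0 → (a, b) ∈ U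

/-- equal margins -/
def SameM (f g : α → β → ℤ) : Prop :=
  (∀ a, ∑ b, f a b = ∑ b, g a b) ∧ ∀ b, ∑ a, f a b = ∑ a, g a b

/-- indicator matrix -/
def ind (U : BGraph α β) : α → β → ℤ := fun a b => if (a, b) ∈ U then 1 else 0

lemma exists_neg_of_sum_zero {γ : Type*} [Fintype γ] (x : γ → ℤ) (h : ∑ c, x c = 0) (c : γ)
    (hc : x c ≠ 0) : (∃ c', x c' < 0) ∧ ∃ c', 0 < x c' := by
  constructor
  · by_contra! hcon
    have := (Finset.sum_eq_zero_iff_of_nonneg (fun i _ => hcon i)).1 h c (Finset.mem_univ _)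
    exact hc this
  · by_contra! hcon
    have := (Finset.sum_eq_zero_iff_of_nonpos (fun i _ => hcon i)).1 h c (Finset.mem_univ _)
    exact hc this

lemma exists_cycle (h : α → β → ℤ) (hr : ∀ a, ∑ b, h a b = 0) (hcol : ∀ b, ∑ a, h a b = 0)
    (a₀ : α) (b₀ : β) (h0 : h a₀ b₀ ≠ 0) :
    ∃ (M M' : BGraph α β) (I : Finset α) (J : Finset β), IsMatching M I J ∧ IsMatching M' I J ∧
      (∀ a b, (a, b) ∈ M → 0 < h a b) ∧ (∀ a b, (a, b) ∈ M' → h a b < 0) ∧ M.Nonempty := by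
  classical
  have hc : ∀ a : α, ∃ b : β, (∃ b', h a b' ≠ 0) → 0 < h a b := by
    intro a
    by_cases hx : ∃ b', h a b' ≠ 0
    · obtain ⟨b', hb'⟩ := hx
      obtain ⟨b, hb⟩ := (exists_neg_of_sum_zero _ (hr a) b' hb').2
      exact ⟨b, fun _ => hb⟩
    · exact ⟨b₀, fun h => absurd h hx⟩
  have hd : ∀ b : β, ∃ a : α, (∃ a', h a' b ≠ 0) → h a b < 0 := by
    intro b
    by_cases hx : ∃ a', h a' b ≠ 0
    · obtain ⟨b', hb'⟩ := hx
      obtain ⟨b, hb⟩ := (exists_neg_of_sum_zero _ (hcol b) b' hb').1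
      exact ⟨b, fun _ => hb⟩
    · exact ⟨a₀, fun h => absurd h hx⟩
  choose c hc using hc
  choose r hr' using hd
  let R : Finset α := Finset.univ.filter fun a => ∃ b, h a b ≠ 0
  have hRs : ∀ a ∈ R, r (c a) ∈ R := by
    intro a ha
    simp only [R, Finset.mem_filter, Finset.mem_univ, true_and] at ha ⊢
    exact ⟨c a, (hr' _ ⟨a, (hc a ha).ne'⟩).ne⟩
  -- minimal invariant set
  let fam : Finset (Finset α) := R.powerset.filter fun O => O.Nonempty ∧ ∀ a ∈ O, r (c a) ∈ O
  have hfam : fam.Nonempty := ⟨R, by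
    simp only [fam, Finset.mem_filter, Finset.mem_powerset, Finset.Subset.refl, true_and]
    exact ⟨⟨a₀, by simp only [R, Finset.mem_filter, Finset.mem_univ, true_and]; exact ⟨b₀, h0⟩⟩, hRs⟩⟩
  obtain ⟨O, hO, hmin⟩ := Finset.exists_min_image fam Finset.card hfam
  simp only [fam, Finset.mem_filter, Finset.mem_powerset] at hO
  obtain ⟨hOR, hOne, hOinv⟩ := hO
  have himg : O.image (fun a => r (c a)) = O := by
    have hsub : O.image (fun a => r (c a)) ⊆ O := by
      intro x hx
      obtain ⟨a, ha, rfl⟩ := Finset.mem_image.1 hx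
      exact hOinv a ha
    refine Finset.eq_of_subset_of_card_le hsub (hmin _ ?_)
    simp only [fam, Finset.mem_filter, Finset.mem_powerset]
    refine ⟨hsub.trans hOR, hOne.image _, ?_⟩
    intro a ha
    exact Finset.mem_image_of_mem _ (hsub ha)
  have hinj : Set.InjOn (fun a => r (c a)) O := by
    apply Finset.card_image_iff.1
    rw [himg]
  have hcinj : ∀ a ∈ O, ∀ a' ∈ O, c a = c a' → a = a' := fun a ha a' ha' he =>
    hinj ha ha' (by simp [he])
  have hne : ∀ a ∈ O, ∃ b, h a b ≠ 0 := by
    intro a ha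
    have := hOR ha
    simpa [R] using this
  refine ⟨O.image fun a => (a, c a), O.image fun a => (r (c a), c a), O, O.image c, ?_, ?_, ?_, ?_,
    hOne.image _⟩
  · refine ⟨?_, ?_, ?_⟩
    · intro e he
      obtain ⟨a, ha, rfl⟩ := Finset.mem_image.1 he
      exact ⟨ha, Finset.mem_image_of_mem _ ha⟩
    · intro a ha
      refine ⟨c a, Finset.mem_image_of_mem _ ha, ?_⟩
      intro b hb
      obtain ⟨a', ha', he⟩ := Finset.mem_image.1 hb
      simp only [Prod.mk.injEq] at he
      rw [← he.2, he.1]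
    · intro b hb
      obtain ⟨a, ha, rfl⟩ := Finset.mem_image.1 hb
      refine ⟨a, Finset.mem_image_of_mem _ ha, ?_⟩
      intro a'' hb
      obtain ⟨a', ha', he⟩ := Finset.mem_image.1 hb
      simp only [Prod.mk.injEq] at he
      rw [← he.1]
      exact hcinj _ ha' _ ha he.2
  · refine ⟨?_, ?_, ?_⟩
    · intro e he
      obtain ⟨a, ha, rfl⟩ := Finset.mem_image.1 he
      exact ⟨hOinv a ha, Finset.mem_image_of_mem _ ha⟩
    · intro a ha
      rw [← himg] at ha
      obtain ⟨a1, ha1, rfl⟩ := Finset.mem_image.1 ha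
      refine ⟨c a1, Finset.mem_image_of_mem _ ha1, ?_⟩
      intro b hb
      obtain ⟨a', ha', he⟩ := Finset.mem_image.1 hb
      simp only [Prod.mk.injEq] at he
      rw [← he.2, hinj ha' ha1 he.1]
    · intro b hb
      obtain ⟨a, ha, rfl⟩ := Finset.mem_image.1 hb
      refine ⟨r (c a), Finset.mem_image_of_mem _ ha, ?_⟩
      intro a'' hb
      obtain ⟨a', ha', he⟩ := Finset.mem_image.1 hb
      simp only [Prod.mk.injEq] at he
      rw [← he.1, he.2]
  · intro a b hab
    obtain ⟨a', ha', he⟩ := Finset.mem_image.1 hab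
    simp only [Prod.mk.injEq] at he
    rw [← he.1, ← he.2]
    exact hc _ (hne _ ha')
  · intro a b hab
    obtain ⟨a', ha', he⟩ := Finset.mem_image.1 hab
    simp only [Prod.mk.injEq] at he
    rw [← he.1, ← he.2]
    exact hr' _ ⟨a', (hc _ (hne _ ha')).ne'⟩

lemma compat_eq {T T' : BGraph α β} (hC : Compatible T T') (f g : α → β → ℤ)
    (hf : SuppOn f T) (hg : SuppOn g T') (hf0 : ∀ a b, 0 ≤ f a b) (hg0 : ∀ a b, 0 ≤ g a b)
    (hm : SameM f g) : f = g := by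
  by_contra hne
  have : ∃ a b, f a b - g a b ≠ 0 := by
    by_contra! hcon
    apply hne
    funext a b
    linarith [hcon a b]
  obtain ⟨a, b, hab⟩ := this
  obtain ⟨M, M', I, J, hM, hM', hp, hn, hMne⟩ := exists_cycle (fun a b => f a b - g a b)
    (fun a => by rw [Finset.sum_sub_distrib, hm.1 a, sub_self])
    (fun b => by rw [Finset.sum_sub_distrib, hm.2 b, sub_self]) a b hab
  have hMM : M = M' := by
    refine hC I J M M' ?_ ?_ hM hM'
    · rintro ⟨x, y⟩ hxy
      apply hf
      have := hp x y hxy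
      have := hg0 x y
      omega
    · rintro ⟨x, y⟩ hxy
      apply hg
      have := hn x y hxy
      have := hf0 x y
      omega
  obtain ⟨⟨x, y⟩, hxy⟩ := hMne
  have h1 := hp x y hxy
  have h2 := hn x y (hMM ▸ hxy)
  omega

lemma ind_matching_row {M : BGraph α β} {I : Finset α} {J : Finset β} (hM : IsMatching M I J)
    (a : α) : ∑ b, ind M a b = if a ∈ I then 1 else 0 := by
  split_ifs with h
  · obtain ⟨b, hb, hu⟩ := hM.2.1 a h
    rw [Finset.sum_eq_single b]
    · simp [ind, hb]
    · intro b' _ hne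
      simp only [ind, ite_eq_right_iff]
      intro hb'
      exact absurd (hu b' hb') hne
    · simp
  · apply Finset.sum_eq_zero
    intro b _
    simp only [ind, ite_eq_right_iff]
    intro hb
    exact absurd (hM.1 _ hb).1 h

lemma ind_matching_col {M : BGraph α β} {I : Finset α} {J : Finset β} (hM : IsMatching M I J)
    (b : β) : ∑ a, ind M a b = if b ∈ J then 1 else 0 := by
  split_ifs with h
  · obtain ⟨a, ha, hu⟩ := hM.2.2 b h
    rw [Finset.sum_eq_single a]
    · simp [ind, ha]
    · intro b' _ hne
      simp only [ind, ite_eq_right_iff]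
      intro hb'
      exact absurd (hu b' hb') hne
    · simp
  · apply Finset.sum_eq_zero
    intro b _
    simp only [ind, ite_eq_right_iff]
    intro hb
    exact absurd (hM.1 _ hb).2 h

/-- The wall lemma. -/
lemma wall {T T' F : BGraph α β} (hC : Compatible T T') (e : α × β) (heT : e ∈ T)
    (hF : F = T.erase e)
    (g : α → β → ℤ) (hg : SuppOn g T') (hg0 : ∀ a b, 0 ≤ g a b)
    (hm : SameM (fun a b => 2 * ind F a b) (fun a b => g a b + ind {e} a b)) :
    F ⊆ T' ∧ e ∉ T' := by
  have heF : e ∉ F := by simp [hF]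
  have hFT : F ⊆ T := by rw [hF]; exact Finset.erase_subset _ _
  have hfF : SuppOn (fun a b => 2 * ind F a b) T := by
    intro a b hab
    apply hFT
    by_contra h
    simp [ind, h] at hab
  have hf0 : ∀ a b, 0 ≤ 2 * ind F a b := by
    intro a b; unfold ind; split_ifs <;> simp
  have hi0 : ∀ a b, 0 ≤ ind {e} a b := by
    intro a b; unfold ind; split_ifs <;> simp
  have heT' : e ∉ T' := by
    intro heT'
    have := compat_eq hC (fun a b => 2 * ind F a b) (fun a b => g a b + ind {e} a b) hfF (by
      intro a b hab
      by_cases h : (a, b) = e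
      · rw [h]; exact heT'
      · apply hg
        simpa [ind, h] using hab) hf0 (fun a b => add_nonneg (hg0 a b) (hi0 a b)) hm
    have h2 := congrFun (congrFun this e.1) e.2
    have := hg0 e.1 e.2
    simp [ind, heF] at h2
    omega
  refine ⟨?_, heT'⟩
  have hge : g e.1 e.2 = 0 := by
    by_contra h
    exact heT' (hg _ _ h)
  obtain ⟨M, M', I, J, hM, hM', hp, hn, hMne⟩ :=
    exists_cycle (fun a b => 2 * ind F a b - (g a b + ind {e} a b))
    (fun a => by rw [Finset.sum_sub_distrib, hm.1 a, sub_self])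
    (fun b => by rw [Finset.sum_sub_distrib, hm.2 b, sub_self]) e.1 e.2
    (by simp [ind, heF, hge])
  have hMT : ∀ a b, (a, b) ∈ M → (a, b) ∈ F := by
    intro x y hxy
    have h1 := hp x y hxy
    by_contra h
    have h3 := hg0 x y
    have h4 := hi0 x y
    simp only [ind, h, if_false] at h1 h4
    omega
  have hM'T : ∀ a b, (a, b) ∈ M' → (a, b) ≠ e → 0 < g a b := by
    intro x y hxy hne
    have h1 := hn x y hxy
    have h3 := hf0 x y
    simp only [ind, Finset.mem_singleton, hne, if_false] at h1 h3
    omega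
  have heM' : e ∈ M' := by
    by_contra h
    have hMM : M = M' := by
      refine hC I J M M' ?_ ?_ hM hM'
      · rintro ⟨x, y⟩ hxy
        exact hFT (hMT x y hxy)
      · rintro ⟨x, y⟩ hxy
        exact hg _ _ (hM'T x y hxy (fun h' => h (h' ▸ hxy))).ne'
    obtain ⟨⟨x, y⟩, hxy⟩ := hMne
    have h1 := hp x y hxy
    have h2 := hn x y (hMM ▸ hxy)
    omega
  have key := compat_eq hC (fun a b => 2 * ind F a b - ind M a b)
    (fun a b => g a b + ind {e} a b - ind M' a b) (by
      intro a b hab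
      by_contra h
      apply hab
      have h1 : (a, b) ∉ F := fun h' => h (hFT h')
      have h2 : (a, b) ∉ M := fun h' => h1 (hMT _ _ h')
      simp [ind, h1, h2]) (by
      intro a b hab
      by_cases he : (a, b) = e
      · exfalso
        apply hab
        subst he
        simp [ind, heM']
        exact hge
      · by_contra h
        apply hab
        have h1 : g a b = 0 := by
          by_contra h'
          exact h (hg _ _ h')
        have h2 : (a, b) ∉ M' := fun h' => by
          have := hM'T a b h' he
          omega
        simp [ind, h1, h2, he]) (by
      intro a b
      by_cases h : (a, b) ∈ M
      · simp [ind, h, hMT _ _ h]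
      · have := hf0 a b
        simp only [ind, h, if_false] at this ⊢
        omega) (by
      intro a b
      have := hg0 a b
      have h4 := hi0 a b
      by_cases h : (a, b) ∈ M'
      · by_cases he : (a, b) = e
        · simp [ind, he, heM', this]
        · have := hM'T a b h he
          simp [ind, h, he]
          omega
      · simp only [ind, h, if_false] at h4 ⊢
        omega) (by
      constructor
      · intro a
        simp only [Finset.sum_sub_distrib, ind_matching_row hM, ind_matching_row hM']
        rw [hm.1 a]
      · intro b
        simp only [Finset.sum_sub_distrib, ind_matching_col hM, ind_matching_col hM']
        rw [hm.2 b])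
  rintro ⟨x, y⟩ hxy
  have h1 := congrFun (congrFun key x) y
  apply hg
  have hne : (x, y) ≠ e := fun h => heF (h ▸ hxy)
  have h5 : ind M x y ≤ 1 := by unfold ind; split_ifs <;> simp
  have h6 : 0 ≤ ind M' x y := by unfold ind; split_ifs <;> simp
  simp only [ind, hxy, hne, Finset.mem_singleton, if_true, if_false] at h1 h5 h6
  omega

end Cyc

section Counting

variable {β : Type*} [DecidableEq β]

lemma card_piAntidiag' (s : Finset β) (n : ℕ) (hs : s.Nonempty) :
    (Finset.piAntidiag s n).card = (n + s.card - 1).choose (s.card - 1) := by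
  have h1 : (Finset.piAntidiag s n).card = (Finset.finsuppAntidiag s n).card := by
    symm
    refine Finset.card_bij (fun f _ => (f : β → ℕ)) ?_ ?_ ?_
    · intro f hf
      rw [Finset.mem_finsuppAntidiag] at hf
      rw [Finset.mem_piAntidiag]
      refine ⟨hf.1, fun i hi => hf.2 (by simpa using hi)⟩
    · intro f _ g _ h
      exact DFunLike.coe_injective h
    · intro f hf
      rw [Finset.mem_piAntidiag] at hf
      refine ⟨Finsupp.onFinset s f hf.2, ?_, by simp⟩
      rw [Finset.mem_finsuppAntidiag]
      refine ⟨hf.1, ?_⟩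
      intro i hi
      apply hf.2
      simpa using hi
  rw [h1, Finset.card_finsuppAntidiag_nat_eq_choose]
  have := hs.card_pos
  rw [add_comm n]
  apply Nat.choose_symm_of_eq_add
  omega

/-- Vectors supported on `s`, positive on `s` except possibly at `a`, with total `p`. -/
def rowSet [Fintype β] (s : Finset β) (a : β) (p : ℕ) : Finset (β → ℕ) :=
  (Finset.piAntidiag s p).filter fun x => ∀ b ∈ s, b ≠ a → 1 ≤ x b

lemma card_rowSet [Fintype β] (s : Finset β) (a : β) (ha : a ∈ s) (p : ℕ) :
    (rowSet s a p).card = p.choose (s.card - 1) := by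
  have hpos : 0 < s.card := Finset.card_pos.2 ⟨a, ha⟩
  have hce : (s.erase a).card = s.card - 1 := Finset.card_erase_of_mem ha
  have hone : ∑ b ∈ s, (if b ≠ a then 1 else 0) = s.card - 1 := by
    rw [Finset.sum_ite, Finset.sum_const, Finset.sum_const_zero, add_zero, smul_eq_mul, mul_one,
      Finset.filter_ne', hce]
  rcases lt_or_ge p (s.card - 1) with h | h
  · rw [Nat.choose_eq_zero_of_lt h, Finset.card_eq_zero, Finset.eq_empty_iff_forall_notMem]
    intro x hx
    rw [rowSet, Finset.mem_filter, Finset.mem_piAntidiag] at hx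
    have : ∑ b ∈ s, (if b ≠ a then 1 else 0) ≤ ∑ b ∈ s, x b := by
      apply Finset.sum_le_sum
      intro b hb
      split_ifs with hne
      · exact hx.2 b hb hne
      · exact Nat.zero_le _
    have h2 : ∑ b ∈ s, x b = p := hx.1.1
    omega
  · have h1 : (rowSet s a p).card = (Finset.piAntidiag s (p - (s.card - 1))).card := by
      symm
      refine Finset.card_bij (fun x _ => fun b => x b + if b ∈ s ∧ b ≠ a then 1 else 0) ?_ ?_ ?_
      · intro x hx
        rw [Finset.mem_piAntidiag] at hx
        rw [rowSet, Finset.mem_filter, Finset.mem_piAntidiag]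
        refine ⟨⟨?_, ?_⟩, ?_⟩
        · rw [Finset.sum_add_distrib]
          have : ∑ b ∈ s, (if b ∈ s ∧ b ≠ a then 1 else 0) = s.card - 1 := by
            rw [← hone]
            apply Finset.sum_congr rfl
            intro b hb
            simp [hb]
          have h2 : ∑ b ∈ s, x b = _ := hx.1
          rw [this, h2]
          omega
        · intro i hi
          by_contra hc
          have : x i = 0 := by
            by_contra h'
            exact hc (hx.2 i h')
          simp [hc, this] at hi
        · intro b hb hne
          simp [hb, hne]
      · intro x _ y _ hxy
        funext b
        have := congrFun hxy b
        simpa using this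
      · intro y hy
        rw [rowSet, Finset.mem_filter, Finset.mem_piAntidiag] at hy
        have hle : ∀ b, (if b ∈ s ∧ b ≠ a then 1 else 0) ≤ y b := by
          intro b
          split_ifs with hb
          · exact hy.2 b hb.1 hb.2
          · exact Nat.zero_le _
        refine ⟨fun b => y b - if b ∈ s ∧ b ≠ a then 1 else 0, ?_, ?_⟩
        · rw [Finset.mem_piAntidiag]
          constructor
          · rw [Finset.sum_tsub_distrib _ (fun b _ => hle b)]
            have : ∑ b ∈ s, (if b ∈ s ∧ b ≠ a then 1 else 0) = s.card - 1 := by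
              rw [← hone]
              apply Finset.sum_congr rfl
              intro b hb
              simp [hb]
            have h2 : ∑ b ∈ s, y b = _ := hy.1.1
            rw [this, h2]
          · intro i hi
            apply hy.1.2
            intro h'
            simp [h'] at hi
        · funext b
          exact Nat.sub_add_cancel (hle b)
    rw [h1, card_piAntidiag' _ _ ⟨a, ha⟩]
    congr 1
    omega

lemma multi_vandermonde {α : Type*} [DecidableEq α] [Fintype α] (p : α → ℕ) (m : ℕ) :
    ∑ v ∈ Finset.piAntidiag (Finset.univ : Finset α) m, ∏ l, (p l).choose (v l) =
      (∑ l, p l).choose m := by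
  have h := PowerSeries.coeff_prod (R := ℕ) (fun l : α => ((1 + Polynomial.X) ^ p l : Polynomial ℕ)) m
    Finset.univ
  have h2 : (∏ j, (((1 + Polynomial.X) ^ p j : Polynomial ℕ) : PowerSeries ℕ))
      = (((1 + Polynomial.X) ^ (∑ l, p l) : Polynomial ℕ) : PowerSeries ℕ) := by
    rw [← Finset.prod_pow_eq_pow_sum]
    exact (map_prod (Polynomial.coeToPowerSeries.ringHom (R := ℕ)) _ _).symm
  rw [h2, Polynomial.coeff_coe, Polynomial.coeff_one_add_X_pow] at h
  simp only [Polynomial.coeff_coe, Polynomial.coeff_one_add_X_pow, Nat.cast_id] at h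
  rw [h]
  symm
  refine Finset.sum_bij (fun f _ => (f : α → ℕ)) ?_ ?_ ?_ ?_
  · intro f hf
    rw [Finset.mem_finsuppAntidiag] at hf
    rw [Finset.mem_piAntidiag]
    refine ⟨hf.1, fun i hi => hf.2 (by simpa using hi)⟩
  · intro f _ g _ h
    exact DFunLike.coe_injective h
  · intro f hf
    rw [Finset.mem_piAntidiag] at hf
    refine ⟨Finsupp.onFinset Finset.univ f hf.2, ?_, by simp⟩
    rw [Finset.mem_finsuppAntidiag]
    refine ⟨hf.1, ?_⟩
    intro i hi
    simp
  · intro f _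
    rfl

end Counting

section Rooted

variable {α β : Type*} [DecidableEq α] [DecidableEq β] [Fintype α] [Fintype β]

/-- Rooted structure at a right vertex `k`. -/
structure Rooted (U : BGraph α β) (k : β) (φ : α → β) (π : β → α) (r1 : α → ℕ) (r2 : β → ℕ) :
    Prop where
  hφ : ∀ a, (a, φ a) ∈ U
  hφr : ∀ a, r2 (φ a) < r1 a
  hπ : ∀ b, b ≠ k → (π b, b) ∈ U
  hπr : ∀ b, b ≠ k → r1 (π b) < r2 b
  all : ∀ a b, (a, b) ∈ U → b = φ a ∨ (b ≠ k ∧ a = π b)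

lemma rooted_of (U : BGraph α β) (k : β) (φ : α → β) (π : β → α) (r1 : α → ℕ) (r2 : β → ℕ)
    (hcard : U.card + 1 = Fintype.card α + Fintype.card β)
    (hφ : ∀ a, (a, φ a) ∈ U)
    (hφr : ∀ a, r2 (φ a) < r1 a)
    (hπ : ∀ b, b ≠ k → (π b, b) ∈ U)
    (hπr : ∀ b, b ≠ k → r1 (π b) < r2 b) : Rooted U k φ π r1 r2 := by
  refine ⟨hφ, hφr, hπ, hπr, ?_⟩
  let A : Finset (α × β) := Finset.univ.image fun a => (a, φ a)
  let B : Finset (α × β) := (Finset.univ.erase k).image fun b => (π b, b)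
  have hA : A.card = Fintype.card α := by
    rw [Finset.card_image_of_injective, Finset.card_univ]
    intro a a' h
    exact congrArg Prod.fst h
  have hB : B.card = Fintype.card β - 1 := by
    rw [Finset.card_image_of_injective, Finset.card_erase_of_mem (Finset.mem_univ _),
      Finset.card_univ]
    intro a a' h
    exact congrArg Prod.snd h
  have hdis : Disjoint A B := by
    rw [Finset.disjoint_left]
    rintro x hx hx'
    obtain ⟨a, _, rfl⟩ := Finset.mem_image.1 hx
    obtain ⟨b, hb, he⟩ := Finset.mem_image.1 hx'
    have hb := Finset.ne_of_mem_erase hb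
    simp only [Prod.mk.injEq] at he
    have h1 := hπr b hb
    have h2 := hφr a
    rw [he.1] at h1
    rw [← he.2] at h2
    omega
  have hpos : 0 < Fintype.card β := Fintype.card_pos_iff.2 ⟨k⟩
  have hU : A ∪ B = U := by
    apply Finset.eq_of_subset_of_card_le
    · intro x hx
      rcases Finset.mem_union.1 hx with hx | hx
      · obtain ⟨a, _, rfl⟩ := Finset.mem_image.1 hx
        exact hφ a
      · obtain ⟨b, hb, rfl⟩ := Finset.mem_image.1 hx
        exact hπ b (Finset.ne_of_mem_erase hb)
    · rw [Finset.card_union_of_disjoint hdis]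
      omega
  intro a b hab
  rw [← hU] at hab
  rcases Finset.mem_union.1 hab with hx | hx
  · obtain ⟨a', _, he⟩ := Finset.mem_image.1 hx
    simp only [Prod.mk.injEq] at he
    left
    rw [← he.1, he.2]
  · obtain ⟨b', hb, he⟩ := Finset.mem_image.1 hx
    simp only [Prod.mk.injEq] at he
    right
    rw [← he.2]
    exact ⟨Finset.ne_of_mem_erase hb, he.1.symm⟩

lemma toGraph_adj_lr_s7 (U : BGraph α β) (a : α) (b : β) :
    (toGraph U).Adj (Sum.inl a) (Sum.inr b) ↔ (a, b) ∈ U := by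
  simp [toGraph]

lemma toGraph_adj_inl (U : BGraph α β) (a : α) (y : α ⊕ β) (h : (toGraph U).Adj (Sum.inl a) y) :
    ∃ b, y = Sum.inr b ∧ (a, b) ∈ U := by
  cases y with
  | inl a' => simp [toGraph] at h
  | inr b => exact ⟨b, rfl, (toGraph_adj_lr_s7 U a b).1 h⟩

lemma toGraph_adj_inr (U : BGraph α β) (b : β) (y : α ⊕ β) (h : (toGraph U).Adj (Sum.inr b) y) :
    ∃ a, y = Sum.inl a ∧ (a, b) ∈ U := by
  cases y with
  | inr a' => simp [toGraph] at h
  | inl a => exact ⟨a, rfl, (toGraph_adj_lr_s7 U a b).1 h.symm⟩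

lemma closer {V : Type*} (G : SimpleGraph V) (x ρ : V) (h : G.Reachable x ρ) (hne : x ≠ ρ) :
    ∃ y, G.Adj x y ∧ G.dist y ρ < G.dist x ρ := by
  obtain ⟨w, hw⟩ := h.exists_walk_length_eq_dist
  cases w with
  | nil => exact absurd rfl hne
  | cons hadj w' =>
    refine ⟨_, hadj, ?_⟩
    have := G.dist_le w'
    rw [SimpleGraph.Walk.length_cons] at hw
    omega

lemma exists_rooted (U : BGraph α β) (hU : IsTreeOn U Finset.univ Finset.univ)
    (hcard : U.card + 1 = Fintype.card α + Fintype.card β) (hα : Nonempty α) (k : β) :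
    ∃ φ π r1 r2, Rooted U k φ π r1 r2 := by
  have hreach : ∀ x y, (toGraph U).Reachable x y := by
    intro x y
    apply hU.2.2
    · cases x <;> simp
    · cases y <;> simp
  have h1 : ∀ a : α, ∃ b : β, (a, b) ∈ U ∧
      (toGraph U).dist (Sum.inr b) (Sum.inr k) < (toGraph U).dist (Sum.inl a) (Sum.inr k) := by
    intro a
    obtain ⟨y, hy, hlt⟩ := closer _ _ _ (hreach (Sum.inl a) (Sum.inr k)) (by simp)
    obtain ⟨b, rfl, hb⟩ := toGraph_adj_inl _ _ _ hy
    exact ⟨b, hb, hlt⟩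
  have h2 : ∀ b : β, ∃ a : α, b ≠ k → (a, b) ∈ U ∧
      (toGraph U).dist (Sum.inl a) (Sum.inr k) < (toGraph U).dist (Sum.inr b) (Sum.inr k) := by
    intro b
    by_cases hb : b = k
    · exact ⟨hα.some, fun h => absurd hb h⟩
    obtain ⟨y, hy, hlt⟩ := closer _ _ _ (hreach (Sum.inr b) (Sum.inr k)) (by simpa using hb)
    obtain ⟨a, rfl, ha⟩ := toGraph_adj_inr _ _ _ hy
    exact ⟨a, fun _ => ⟨ha, hlt⟩⟩
  choose φ hφ using h1
  choose π hπ using h2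
  exact ⟨φ, π, _, _, rooted_of U k φ π (fun a => (toGraph U).dist (Sum.inl a) (Sum.inr k))
    (fun b => (toGraph U).dist (Sum.inr b) (Sum.inr k)) hcard (fun a => (hφ a).1)
    (fun a => (hφ a).2) (fun b hb => (hπ b hb).1) (fun b hb => (hπ b hb).2)⟩

lemma exists_rooted_left (U : BGraph α β) (hU : IsTreeOn U Finset.univ Finset.univ)
    (hcard : U.card + 1 = Fintype.card α + Fintype.card β) (hβ : Nonempty β) (k : α) :
    ∃ φ π r1 r2, Rooted (U.image Prod.swap) k φ π r1 r2 := by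
  have hreach : ∀ x y, (toGraph U).Reachable x y := by
    intro x y
    apply hU.2.2
    · cases x <;> simp
    · cases y <;> simp
  have h1 : ∀ a : β, ∃ b : α, (b, a) ∈ U ∧
      (toGraph U).dist (Sum.inl b) (Sum.inl k) < (toGraph U).dist (Sum.inr a) (Sum.inl k) := by
    intro a
    obtain ⟨y, hy, hlt⟩ := closer _ _ _ (hreach (Sum.inr a) (Sum.inl k)) (by simp)
    obtain ⟨b, rfl, hb⟩ := toGraph_adj_inr _ _ _ hy
    exact ⟨b, hb, hlt⟩
  have h2 : ∀ b : α, ∃ a : β, b ≠ k → (b, a) ∈ U ∧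
      (toGraph U).dist (Sum.inr a) (Sum.inl k) < (toGraph U).dist (Sum.inl b) (Sum.inl k) := by
    intro b
    by_cases hb : b = k
    · exact ⟨hβ.some, fun h => absurd hb h⟩
    obtain ⟨y, hy, hlt⟩ := closer _ _ _ (hreach (Sum.inl b) (Sum.inl k)) (by simpa using hb)
    obtain ⟨a, rfl, ha⟩ := toGraph_adj_inl _ _ _ hy
    exact ⟨a, fun _ => ⟨ha, hlt⟩⟩
  choose φ hφ using h1
  choose π hπ using h2
  exact ⟨φ, π, _, _, rooted_of _ k φ π (fun a => (toGraph U).dist (Sum.inr a) (Sum.inl k))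
    (fun b => (toGraph U).dist (Sum.inl b) (Sum.inl k))
    (by rw [Finset.card_image_of_injective _ Prod.swap_injective]; omega)
    (fun a => by simpa using (hφ a).1)
    (fun a => (hφ a).2) (fun b hb => by simpa using (hπ b hb).1) (fun b hb => (hπ b hb).2)⟩

/-- the indicator of the parent function -/
def topeMat (φ : α → β) : α → β → ℤ := fun a b => if b = φ a then 1 else 0

lemma topeMat_nonneg (φ : α → β) (a : α) (b : β) : 0 ≤ topeMat φ a b := by
  unfold topeMat; split_ifs <;> simp

lemma topeMat_row (φ : α → β) (a : α) : ∑ b, topeMat φ a b = 1 := by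
  simp [topeMat]

lemma RD_eq_sum (U : BGraph α β) (b : β) : (RD U b : ℤ) = ∑ a, ind U a b := by
  have : ∑ a, ind U a b = (((Finset.univ.filter fun a => (a, b) ∈ U).card : ℕ) : ℤ) := by
    simp [ind]
  rw [this]
  congr 1
  unfold RD
  refine Finset.card_bij (fun e _ => e.1) ?_ ?_ ?_
  · rintro ⟨x, y⟩ h
    simp only [Finset.mem_filter] at h
    simp only [Finset.mem_filter, Finset.mem_univ, true_and]
    rw [← h.2]; exact h.1
  · rintro ⟨x, y⟩ h ⟨x', y'⟩ h' he
    simp only [Finset.mem_filter] at h h' he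
    rw [Prod.mk.injEq, h.2, h'.2]
    exact ⟨he, rfl⟩
  · intro a ha
    simp only [Finset.mem_filter, Finset.mem_univ, true_and] at ha
    exact ⟨(a, b), by simp [ha], rfl⟩

lemma LD_eq_sum (U : BGraph α β) (a : α) : (LD U a : ℤ) = ∑ b, ind U a b := by
  have : ∑ b, ind U a b = (((Finset.univ.filter fun b => (a, b) ∈ U).card : ℕ) : ℤ) := by
    simp [ind]
  rw [this]
  congr 1
  unfold LD
  refine Finset.card_bij (fun e _ => e.2) ?_ ?_ ?_
  · rintro ⟨x, y⟩ h
    simp only [Finset.mem_filter] at h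
    simp only [Finset.mem_filter, Finset.mem_univ, true_and]
    rw [← h.2]; exact h.1
  · rintro ⟨x, y⟩ h ⟨x', y'⟩ h' he
    simp only [Finset.mem_filter] at h h' he
    rw [Prod.mk.injEq, h.2, h'.2]
    exact ⟨rfl, he⟩
  · intro b hb
    simp only [Finset.mem_filter, Finset.mem_univ, true_and] at hb
    exact ⟨(a, b), by simp [hb], rfl⟩

lemma RD_swap (U : BGraph α β) (a : α) : RD (U.image Prod.swap) a = LD U a := by
  have h1 := RD_eq_sum (U.image Prod.swap) a
  have h2 := LD_eq_sum U a
  have : ∀ b, ind (U.image Prod.swap) b a = ind U a b := by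
    intro b; simp [ind]
  simp only [this] at h1
  omega

namespace Rooted

variable {U : BGraph α β} {k : β} {φ : α → β} {π : β → α} {r1 : α → ℕ} {r2 : β → ℕ}

lemma ne_pi (h : Rooted U k φ π r1 r2) (b : β) (hb : b ≠ k) : φ (π b) ≠ b := by
  intro he
  have h1 := h.hφr (π b)
  have h2 := h.hπr b hb
  rw [he] at h1
  omega

lemma supp_tope (h : Rooted U k φ π r1 r2) : SuppOn (topeMat φ) U := by
  intro a b hab
  simp only [topeMat, ne_eq, ite_eq_right_iff, one_ne_zero, imp_false, not_not] at hab
  rw [hab]; exact h.hφ a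

lemma ind_eq (h : Rooted U k φ π r1 r2) (a : α) (b : β) :
    ind U a b = topeMat φ a b + if b ≠ k ∧ a = π b then 1 else 0 := by
  unfold ind topeMat
  by_cases hU : (a, b) ∈ U
  · rcases h.all a b hU with h1 | h1
    · have : ¬ (b ≠ k ∧ a = π b) := by
        rintro ⟨h2, h3⟩
        exact h.ne_pi b h2 (by rw [← h3, ← h1])
      rw [if_pos hU, if_pos h1, if_neg this]; rfl
    · have : b ≠ φ a := by
        intro h2
        exact h.ne_pi b h1.1 (by rw [← h1.2, ← h2])
      simp only [hU, this, if_true, if_false, h1.1, ne_eq, not_false_eq_true, true_and]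
      rw [if_pos h1.2]; rfl
  · have h1 : b ≠ φ a := by
      intro he
      exact hU (he ▸ h.hφ a)
    have h2 : ¬ (b ≠ k ∧ a = π b) := by
      rintro ⟨h2, h3⟩
      exact hU (h3 ▸ h.hπ b h2)
    simp [hU, h1, h2]

lemma tope_col (h : Rooted U k φ π r1 r2) (b : β) :
    ∑ a, topeMat φ a b = (RD U b : ℤ) - if b ≠ k then 1 else 0 := by
  rw [RD_eq_sum]
  simp only [h.ind_eq, Finset.sum_add_distrib]
  have : ∑ a, (if b ≠ k ∧ a = π b then (1 : ℤ) else 0) = if b ≠ k then 1 else 0 := by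
    by_cases hb : b = k <;> simp [hb]
  rw [this]; ring

/-- path flows -/
lemma path (h : Rooted U k φ π r1 r2) (a : α) : ∃ A : α → β → ℤ, SuppOn A U ∧
    (∀ x y, A x y < 0 → y ≠ k ∧ x = π y) ∧ 1 ≤ A a (φ a) ∧
    (∀ x, ∑ y, A x y = if x = a then 1 else 0) ∧ (∀ y, ∑ x, A x y = if y = k then 1 else 0) := by
  induction hr : r1 a using Nat.strong_induction_on generalizing a with
  | _ m ih =>
    by_cases hk : φ a = k
    · refine ⟨fun x y => if x = a ∧ y = k then 1 else 0, ?_, ?_, ?_, ?_, ?_⟩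
      · intro x y hxy
        simp only [ne_eq, ite_eq_right_iff, one_ne_zero, imp_false, not_not] at hxy
        rw [hxy.1, hxy.2, ← hk]
        exact h.hφ a
      · intro x y hxy
        exfalso
        dsimp only at hxy
        split_ifs at hxy <;> simp at hxy
      · simp [hk]
      · intro x
        by_cases hx : x = a <;> simp [hx]
      · intro y
        by_cases hx : y = k <;> simp [hx]
    · obtain ⟨A, hs, hneg, hA1, hrow, hcol⟩ := ih (r1 (π (φ a)))
        (by rw [← hr]; exact lt_trans (h.hπr _ hk) (h.hφr a)) (π (φ a)) rfl
      have hne : a ≠ π (φ a) := by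
        intro he
        have h1 := h.hπr _ hk
        have h2 := h.hφr a
        rw [← he] at h1
        omega
      refine ⟨fun x y => A x y + (if x = a ∧ y = φ a then 1 else 0)
        - (if x = π (φ a) ∧ y = φ a then 1 else 0), ?_, ?_, ?_, ?_, ?_⟩
      · intro x y hxy
        by_cases h1 : x = a ∧ y = φ a
        · rw [h1.1, h1.2]; exact h.hφ a
        · by_cases h2 : x = π (φ a) ∧ y = φ a
          · rw [h2.1, h2.2]; exact h.hπ _ hk
          · apply hs
            simpa [h1, h2] using hxy
      · intro x y hxy
        by_cases h2 : x = π (φ a) ∧ y = φ a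
        · rw [h2.1, h2.2]; exact ⟨hk, rfl⟩
        · apply hneg
          dsimp only at hxy
          rw [if_neg h2] at hxy
          split_ifs at hxy <;> omega
      · have : 0 ≤ A a (φ a) := by
          by_contra hc
          have := (hneg a (φ a) (by omega)).2
          exact hne this
        simp [hne, this]
      · intro x
        rw [Finset.sum_sub_distrib, Finset.sum_add_distrib, hrow]
        by_cases h1 : x = a
        · subst h1; simp [hne]
        · by_cases h2 : x = π (φ a) <;> simp [h1, h2, hne.symm]
      · intro y
        rw [Finset.sum_sub_distrib, Finset.sum_add_distrib, hcol]
        by_cases h1 : y = φ a <;> simp [h1]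

end Rooted

/-- Two compatible trees with the same left degrees are equal. -/
lemma LD_inj {T T' : BGraph α β} (hC : Compatible T T')
    (hT : IsTreeOn T Finset.univ Finset.univ) (hT' : IsTreeOn T' Finset.univ Finset.univ)
    (hc : T.card + 1 = Fintype.card α + Fintype.card β)
    (hc' : T'.card + 1 = Fintype.card α + Fintype.card β)
    (hLD : ∀ a, LD T a = LD T' a) : T ⊆ T' := by
  rintro ⟨a, b⟩ hab
  obtain ⟨φ, π, r1, r2, h⟩ := exists_rooted_left T hT hc ⟨b⟩ a
  obtain ⟨φ', π', r1', r2', h'⟩ := exists_rooted_left T' hT' hc' ⟨b⟩ a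
  have key := compat_eq hC (fun x y => topeMat φ y x) (fun x y => topeMat φ' y x)
    (fun x y hxy => by simpa using h.supp_tope y x hxy)
    (fun x y hxy => by simpa using h'.supp_tope y x hxy)
    (fun x y => topeMat_nonneg _ _ _) (fun x y => topeMat_nonneg _ _ _)
    ⟨fun x => by rw [h.tope_col, h'.tope_col, RD_swap, RD_swap, hLD],
     fun y => by rw [topeMat_row, topeMat_row]⟩
  have h1 := h.all b a (by simpa using hab)
  have h2 : a = φ b := by
    rcases h1 with h1 | h1
    · exact h1
    · exact absurd rfl h1.1
  have h3 := congrFun (congrFun key a) b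
  have h4 := h'.supp_tope b a
  simp only [topeMat, ← h2, if_true] at h3
  simpa using h4 (by simp only [topeMat]; rw [← h3]; simp)

/-- Half-open disjointness. -/
lemma half_open {T T' : BGraph α β} (hC : Compatible T T') {k : β}
    {φ : α → β} {π : β → α} {r1 : α → ℕ} {r2 : β → ℕ} (h : Rooted T k φ π r1 r2)
    {φ' : α → β} {π' : β → α} {r1' : α → ℕ} {r2' : β → ℕ} (h' : Rooted T' k φ' π' r1' r2')
    (f : α → β → ℤ) (hf : SuppOn f T) (hf' : SuppOn f T') (hf0 : ∀ a b, 0 ≤ f a b)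
    (hp : ∀ b, b ≠ k → 1 ≤ f (π b) b) (hp' : ∀ b, b ≠ k → 1 ≤ f (π' b) b) : T ⊆ T' := by
  rintro ⟨a, b⟩ hab
  rcases h.all a b hab with h1 | h1
  · obtain ⟨A, hs, hneg, hA1, hrow, hcol⟩ := h.path a
    obtain ⟨B, hs', hneg', hB1, hrow', hcol'⟩ := h'.path a
    let N : ℤ := (∑ x, ∑ y, |A x y|) + ∑ x, ∑ y, |B x y|
    have hle : ∀ (C : α → β → ℤ) x y, |C x y| ≤ ∑ x, ∑ y, |C x y| := by
      intro C x y
      calc |C x y| ≤ ∑ y, |C x y| :=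
            Finset.single_le_sum (f := fun y => |C x y|) (fun _ _ => abs_nonneg _) (Finset.mem_univ y)
        _ ≤ _ := Finset.single_le_sum (f := fun x => ∑ y, |C x y|)
            (fun _ _ => Finset.sum_nonneg fun _ _ => abs_nonneg _) (Finset.mem_univ x)
    have hNA : ∀ x y, -N ≤ A x y := by
      intro x y
      have h1 := hle A x y
      have h2 : 0 ≤ ∑ x, ∑ y, |B x y| :=
        Finset.sum_nonneg fun _ _ => Finset.sum_nonneg fun _ _ => abs_nonneg _
      have h3 := neg_abs_le (A x y)
      simp only [N]
      linarith
    have hNB : ∀ x y, -N ≤ B x y := by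
      intro x y
      have h1 := hle B x y
      have h2 : 0 ≤ ∑ x, ∑ y, |A x y| :=
        Finset.sum_nonneg fun _ _ => Finset.sum_nonneg fun _ _ => abs_nonneg _
      have h3 := neg_abs_le (B x y)
      simp only [N]
      linarith
    have hN0 : 0 ≤ N :=
      add_nonneg (Finset.sum_nonneg fun _ _ => Finset.sum_nonneg fun _ _ => abs_nonneg _)
        (Finset.sum_nonneg fun _ _ => Finset.sum_nonneg fun _ _ => abs_nonneg _)
    have key := compat_eq hC (fun x y => N * f x y + A x y) (fun x y => N * f x y + B x y)
      (by
        intro x y hxy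
        by_cases hx : f x y = 0
        · apply hs; simpa [hx] using hxy
        · exact hf x y hx)
      (by
        intro x y hxy
        by_cases hx : f x y = 0
        · apply hs'; simpa [hx] using hxy
        · exact hf' x y hx)
      (by
        intro x y
        by_cases hx : A x y < 0
        · obtain ⟨h2, h3⟩ := hneg x y hx
          have := hp y h2
          rw [← h3] at this
          have := hNA x y
          nlinarith
        · have := mul_nonneg hN0 (hf0 x y)
          linarith)
      (by
        intro x y
        by_cases hx : B x y < 0
        · obtain ⟨h2, h3⟩ := hneg' x y hx
          have := hp' y h2
          rw [← h3] at this
          have := hNB x y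
          nlinarith
        · have := mul_nonneg hN0 (hf0 x y)
          linarith)
      ⟨fun x => by simp only [Finset.sum_add_distrib, hrow, hrow'],
       fun y => by simp only [Finset.sum_add_distrib, hcol, hcol']⟩
    have h3 := congrFun (congrFun key a) b
    simp only [add_right_inj] at h3
    apply hs'
    rw [← h3, h1]
    omega
  · apply hf'
    have := hp b h1.1
    rw [← h1.2] at this
    omega

end Rooted

section Cover

lemma card_eq_sum_RD {α β : Type*} [DecidableEq α] [DecidableEq β] [Fintype α] [Fintype β]
    (U : BGraph α β) : U.card = ∑ b, RD U b :=
  Finset.card_eq_sum_card_fiberwise (fun _ _ => Finset.mem_univ _)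

lemma card_eq_sum_LD {α β : Type*} [DecidableEq α] [DecidableEq β] [Fintype α] [Fintype β]
    (U : BGraph α β) : U.card = ∑ a, LD U a :=
  Finset.card_eq_sum_card_fiberwise (fun _ _ => Finset.mem_univ _)

variable {n d : ℕ} {Tr : (Fin d → ℕ) → BGraph (Fin n) (Fin d)}

lemma tr_card (hRDeg : ∀ u : Fin d → ℕ, (∑ j, u j) + 1 = n → ∀ j, RD (Tr u) j = u j + 1)
    (u : Fin d → ℕ) (hu : (∑ j, u j) + 1 = n) :
    (Tr u).card + 1 = Fintype.card (Fin n) + Fintype.card (Fin d) := by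
  rw [card_eq_sum_RD]
  simp only [hRDeg u hu, Finset.sum_add_distrib, Fintype.card_fin, Finset.sum_const,
    Finset.card_univ, smul_eq_mul, mul_one]
  omega

lemma rooted_at (htree : ∀ u : Fin d → ℕ, (∑ j, u j) + 1 = n → IsTreeOn (Tr u) Finset.univ Finset.univ)
    (hRDeg : ∀ u : Fin d → ℕ, (∑ j, u j) + 1 = n → ∀ j, RD (Tr u) j = u j + 1)
    (u : Fin d → ℕ) (hu : (∑ j, u j) + 1 = n) (k : Fin d) :
    ∃ φ π r1 r2, Rooted (Tr u) k φ π r1 r2 :=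
  exists_rooted (Tr u) (htree u hu) (tr_card hRDeg u hu) ⟨⟨0, by omega⟩⟩ k

lemma sum_LD_prod
    (htree : ∀ u : Fin d → ℕ, (∑ j, u j) + 1 = n → IsTreeOn (Tr u) Finset.univ Finset.univ)
    (hRDeg : ∀ u : Fin d → ℕ, (∑ j, u j) + 1 = n → ∀ j, RD (Tr u) j = u j + 1)
    (hcompat : ∀ u u' : Fin d → ℕ, (∑ j, u j) + 1 = n → (∑ j, u' j) + 1 = n →
      Compatible (Tr u) (Tr u')) (hn : 1 ≤ n) (k : Fin d) (p : Fin n → ℕ) :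
    ∑ u ∈ Finset.piAntidiag (Finset.univ : Finset (Fin d)) (n - 1),
      ∏ a, (p a).choose (LD (Tr u) a - 1) = (∑ a, p a).choose (d - 1) := by
  have hd : 0 < d := k.pos
  have hmem : ∀ u : Fin d → ℕ, u ∈ Finset.piAntidiag (Finset.univ : Finset (Fin d)) (n - 1) ↔
      (∑ j, u j) + 1 = n := by
    intro u
    rw [Finset.mem_piAntidiag]
    constructor
    · intro h
      have h1 : ∑ j, u j = n - 1 := h.1
      omega
    · intro h
      exact ⟨(show ∑ j, u j = n - 1 by omega), fun _ _ => Finset.mem_univ _⟩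
  have hLD1 : ∀ u : Fin d → ℕ, (∑ j, u j) + 1 = n → ∀ a, 1 ≤ LD (Tr u) a := by
    intro u hu a
    obtain ⟨φ, π, r1, r2, h⟩ := rooted_at htree hRDeg u hu k
    exact Finset.card_pos.2 ⟨(a, φ a), by simp [h.hφ a]⟩
  have hinj : Set.InjOn (fun u : Fin d → ℕ => fun a => LD (Tr u) a - 1)
      (Finset.piAntidiag (Finset.univ : Finset (Fin d)) (n - 1)) := by
    intro u hu u' hu' he
    have hu : _ := (hmem u).1 hu
    have hu' : _ := (hmem u').1 hu'
    have hLD : ∀ a, LD (Tr u) a = LD (Tr u') a := by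
      intro a
      have h1 := congrFun he a
      have h2 := hLD1 u hu a
      have h3 := hLD1 u' hu' a
      dsimp only at h1
      omega
    have hsub := LD_inj (hcompat u u' hu hu') (htree u hu) (htree u' hu') (tr_card hRDeg u hu)
      (tr_card hRDeg u' hu') hLD
    have heq : Tr u = Tr u' := by
      apply Finset.eq_of_subset_of_card_le hsub
      have h1 := tr_card hRDeg u hu
      have h2 := tr_card hRDeg u' hu'
      omega
    funext j
    have h1 := hRDeg u hu j
    have h2 := hRDeg u' hu' j
    rw [heq] at h1
    omega
  have himg : (Finset.piAntidiag (Finset.univ : Finset (Fin d)) (n - 1)).image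
      (fun u : Fin d → ℕ => fun a => LD (Tr u) a - 1) =
      Finset.piAntidiag (Finset.univ : Finset (Fin n)) (d - 1) := by
    apply Finset.eq_of_subset_of_card_le
    · intro v hv
      obtain ⟨u, hu, rfl⟩ := Finset.mem_image.1 hv
      have hu := (hmem u).1 hu
      rw [Finset.mem_piAntidiag]
      refine ⟨?_, fun _ _ => Finset.mem_univ _⟩
      rw [Finset.sum_tsub_distrib _ (fun a _ => hLD1 u hu a), ← card_eq_sum_LD]
      have := tr_card hRDeg u hu
      simp only [Fintype.card_fin] at this
      simp only [Finset.sum_const, Finset.card_univ, Fintype.card_fin, smul_eq_mul, mul_one]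
      omega
    · rw [Finset.card_image_of_injOn hinj, card_piAntidiag' _ _ ⟨k, Finset.mem_univ _⟩,
        card_piAntidiag' _ _ ⟨⟨0, by omega⟩, Finset.mem_univ _⟩]
      simp only [Finset.card_univ, Fintype.card_fin]
      rw [show n - 1 + d - 1 = d - 1 + n - 1 by omega]
      apply le_of_eq
      apply Nat.choose_symm_of_eq_add
      omega
  rw [← multi_vandermonde, ← himg, Finset.sum_image hinj]

lemma coverage
    (htree : ∀ u : Fin d → ℕ, (∑ j, u j) + 1 = n → IsTreeOn (Tr u) Finset.univ Finset.univ)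
    (hRDeg : ∀ u : Fin d → ℕ, (∑ j, u j) + 1 = n → ∀ j, RD (Tr u) j = u j + 1)
    (hcompat : ∀ u u' : Fin d → ℕ, (∑ j, u j) + 1 = n → (∑ j, u' j) + 1 = n →
      Compatible (Tr u) (Tr u')) (hn : 1 ≤ n) (k : Fin d) (p : Fin n → ℕ) (q : Fin d → ℕ)
    (hq : ∀ b, b ≠ k → 1 ≤ q b) (hpq : ∑ b, q b = ∑ a, p a) :
    ∃ u : Fin d → ℕ, (∑ j, u j) + 1 = n ∧ ∃ g : Fin n → Fin d → ℕ,
      (∀ a b, g a b ≠ 0 → (a, b) ∈ Tr u) ∧ (∀ a, ∑ b, g a b = p a) ∧ ∀ b, ∑ a, g a b = q b := by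
  have hmem : ∀ u : Fin d → ℕ, u ∈ Finset.piAntidiag (Finset.univ : Finset (Fin d)) (n - 1) ↔
      (∑ j, u j) + 1 = n := by
    intro u
    rw [Finset.mem_piAntidiag]
    constructor
    · intro h
      have h1 : ∑ j, u j = n - 1 := h.1
      omega
    · intro h
      exact ⟨(show ∑ j, u j = n - 1 by omega), fun _ _ => Finset.mem_univ _⟩
  have hroot : ∀ u : Fin d → ℕ, ∃ φ π r1 r2, (∑ j, u j) + 1 = n → Rooted (Tr u) k φ π r1 r2 := by
    intro u
    by_cases hu : (∑ j, u j) + 1 = n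
    · obtain ⟨φ, π, r1, r2, h⟩ := rooted_at htree hRDeg u hu k
      exact ⟨φ, π, r1, r2, fun _ => h⟩
    · exact ⟨fun _ => k, fun _ => ⟨0, by omega⟩, fun _ => 0, fun _ => 0, fun h => absurd h hu⟩
  choose φ π r1 r2 hR using hroot
  let Nb : (Fin d → ℕ) → Fin n → Finset (Fin d) := fun u a =>
    Finset.univ.filter fun b => (a, b) ∈ Tr u
  have hNb : ∀ u a, (Nb u a).card = LD (Tr u) a := by
    intro u a
    have h1 := LD_eq_sum (Tr u) a
    have : ∑ b, ind (Tr u) a b = (((Nb u a).card : ℕ) : ℤ) := by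
      simp [ind, Nb]
    omega
  let X : Finset (Σ _ : Fin d → ℕ, Fin n → Fin d → ℕ) :=
    (Finset.piAntidiag (Finset.univ : Finset (Fin d)) (n - 1)).sigma fun u =>
      Fintype.piFinset fun a => rowSet (Nb u a) (φ u a) (p a)
  have hXmem : ∀ x ∈ X, (∑ j, x.1 j) + 1 = n ∧ (∀ a b, x.2 a b ≠ 0 → (a, b) ∈ Tr x.1) ∧
      (∀ a, ∑ b, x.2 a b = p a) ∧ (∀ b, b ≠ k → 1 ≤ x.2 (π x.1 b) b) := by
    rintro ⟨u, f⟩ hx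
    simp only [X, Finset.mem_sigma, hmem, Fintype.mem_piFinset, rowSet, Finset.mem_filter,
      Finset.mem_piAntidiag] at hx
    obtain ⟨hu, hf⟩ := hx
    have hs : ∀ a b, f a b ≠ 0 → (a, b) ∈ Tr u := by
      intro a b hab
      have := (hf a).1.2 b hab
      simpa [Nb] using this
    refine ⟨hu, hs, ?_, ?_⟩
    · intro a
      rw [← (hf a).1.1]
      symm
      apply Finset.sum_subset (Finset.subset_univ _)
      intro b _ hb
      by_contra h
      exact hb ((hf a).1.2 b h)
    · intro b hb
      refine (hf (π u b)).2 b ?_ ((hR u hu).ne_pi b hb).symm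
      simpa [Nb] using (hR u hu).hπ b hb
  have hmaps : ∀ x ∈ X, (fun b => ∑ a, x.2 a b) ∈
      rowSet (Finset.univ : Finset (Fin d)) k (∑ a, p a) := by
    intro x hx
    obtain ⟨hu, hs, hrow, hpos⟩ := hXmem x hx
    simp only [rowSet, Finset.mem_filter, Finset.mem_piAntidiag]
    refine ⟨⟨?_, fun _ _ => Finset.mem_univ _⟩, ?_⟩
    · rw [Finset.sum_comm]
      exact Finset.sum_congr rfl fun a _ => hrow a
    · intro b _ hb
      exact (hpos b hb).trans
        (Finset.single_le_sum (f := fun a => x.2 a b) (fun _ _ => Nat.zero_le _) (Finset.mem_univ _))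
  have hinj : ∀ x ∈ X, ∀ y ∈ X, (fun b => ∑ a, x.2 a b) = (fun b => ∑ a, y.2 a b) → x = y := by
    rintro ⟨u, f⟩ hx ⟨u', f'⟩ hy he
    obtain ⟨hu, hs, hrow, hpos⟩ := hXmem _ hx
    obtain ⟨hu', hs', hrow', hpos'⟩ := hXmem _ hy
    dsimp only at *
    have h1 := compat_eq (hcompat u u' hu hu') (fun a b => (f a b : ℤ)) (fun a b => (f' a b : ℤ))
      (fun a b h => hs a b (by simpa using h)) (fun a b h => hs' a b (by simpa using h))
      (fun _ _ => Int.natCast_nonneg _) (fun _ _ => Int.natCast_nonneg _)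
      ⟨fun a => by
        have h1 := hrow a
        have h2 := hrow' a
        rw [← h2] at h1
        show ∑ b, (f a b : ℤ) = ∑ b, (f' a b : ℤ)
        exact_mod_cast h1, fun b => by
        have h1 := congrFun he b
        show ∑ a, (f a b : ℤ) = ∑ a, (f' a b : ℤ)
        exact_mod_cast h1⟩
    have hff : f = f' := by
      funext a b
      have := congrFun (congrFun h1 a) b
      exact_mod_cast this
    subst hff
    have hsub := half_open (hcompat u u' hu hu') (hR u hu) (hR u' hu') (fun a b => (f a b : ℤ))
      (fun a b h => hs a b (by simpa using h)) (fun a b h => hs' a b (by simpa using h))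
      (fun _ _ => Int.natCast_nonneg _) (fun b hb => by exact_mod_cast hpos b hb)
      (fun b hb => by exact_mod_cast hpos' b hb)
    have heq : Tr u = Tr u' := by
      apply Finset.eq_of_subset_of_card_le hsub
      have h1 := tr_card hRDeg u hu
      have h2 := tr_card hRDeg u' hu'
      omega
    have : u = u' := by
      funext j
      have h1 := hRDeg u hu j
      have h2 := hRDeg u' hu' j
      rw [heq] at h1
      omega
    rw [this]
  have hcard : X.card = (∑ a, p a).choose (d - 1) := by
    rw [← sum_LD_prod htree hRDeg hcompat hn k p]
    simp only [X, Finset.card_sigma, Fintype.card_piFinset]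
    apply Finset.sum_congr rfl
    intro u hu
    have hu := (hmem u).1 hu
    apply Finset.prod_congr rfl
    intro a _
    rw [card_rowSet, hNb]
    simpa [Nb] using (hR u hu).hφ a
  have hQcard : (rowSet (Finset.univ : Finset (Fin d)) k (∑ a, p a)).card ≤ X.card := by
    rw [card_rowSet _ _ (Finset.mem_univ _), hcard]
    simp
  obtain ⟨x, hx, hxq⟩ := Finset.surj_on_of_inj_on_of_card_le
    (fun (x : Σ _ : Fin d → ℕ, Fin n → Fin d → ℕ) (_ : x ∈ X) => fun b => ∑ a, x.2 a b)
    hmaps (fun x y hx hy h => hinj x hx y hy h) hQcard q (by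
      simp only [rowSet, Finset.mem_filter, Finset.mem_piAntidiag]
      exact ⟨⟨hpq, fun _ _ => Finset.mem_univ _⟩, fun b _ hb => hq b hb⟩)
  obtain ⟨hu, hs, hrow, hpos⟩ := hXmem x hx
  exact ⟨x.1, hu, x.2, hs, hrow, fun b => (congrFun hxq b).symm⟩

/-- Genuine tree linkage. -/
lemma linkage
    (htree : ∀ u : Fin d → ℕ, (∑ j, u j) + 1 = n → IsTreeOn (Tr u) Finset.univ Finset.univ)
    (hRDeg : ∀ u : Fin d → ℕ, (∑ j, u j) + 1 = n → ∀ j, RD (Tr u) j = u j + 1)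
    (hcompat : ∀ u u' : Fin d → ℕ, (∑ j, u j) + 1 = n → (∑ j, u' j) + 1 = n →
      Compatible (Tr u) (Tr u')) (u : Fin d → ℕ) (hu : (∑ j, u j) + 1 = n)
    (e : Fin n × Fin d) (he : e ∈ Tr u) (hl : 2 ≤ LD (Tr u) e.1) (hr : 2 ≤ RD (Tr u) e.2) :
    ∃ u' : Fin d → ℕ, (∑ j, u' j) + 1 = n ∧ (Tr u).erase e ⊆ Tr u' ∧ e ∉ Tr u' := by
  have hm : ∀ a b, ind (Tr u) a b = ind ((Tr u).erase e) a b + ind {e} a b := by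
    intro a b
    by_cases h : (a, b) = e
    · simp [ind, h, he]
    · by_cases h2 : (a, b) ∈ Tr u <;> simp [ind, h, h2]
  have he1 : ∀ a, ∑ b, ind {e} a b = if a = e.1 then 1 else 0 := by
    intro a
    have : ∀ b, ind {e} a b = if a = e.1 ∧ b = e.2 then 1 else 0 := by
      intro b; simp [ind, Prod.ext_iff]
    simp only [this]
    by_cases h : a = e.1 <;> simp [h]
  have he2 : ∀ b, ∑ a, ind {e} a b = if b = e.2 then 1 else 0 := by
    intro b
    have : ∀ a, ind {e} a b = if a = e.1 ∧ b = e.2 then 1 else 0 := by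
      intro a; simp [ind, Prod.ext_iff]
    simp only [this]
    by_cases h : b = e.2 <;> simp [h]
  have hL : ∀ a, ∑ b, ind ((Tr u).erase e) a b = (LD (Tr u) a : ℤ) - if a = e.1 then 1 else 0 := by
    intro a
    rw [LD_eq_sum, ← he1, ← Finset.sum_sub_distrib]
    apply Finset.sum_congr rfl
    intro b _
    rw [hm]; ring
  have hRR : ∀ b, ∑ a, ind ((Tr u).erase e) a b = (RD (Tr u) b : ℤ) - if b = e.2 then 1 else 0 := by
    intro b
    rw [RD_eq_sum, ← he2, ← Finset.sum_sub_distrib]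
    apply Finset.sum_congr rfl
    intro a _
    rw [hm]; ring
  obtain ⟨u', hu', g, hg, hgr, hgc⟩ := coverage htree hRDeg hcompat (by omega) e.2
    (fun a => 2 * LD (Tr u) a - if a = e.1 then 3 else 0)
    (fun b => 2 * RD (Tr u) b - if b = e.2 then 3 else 0)
    (by
      intro b hb
      have := hRDeg u hu b
      simp only [hb, if_false]
      omega)
    (by
      rw [Finset.sum_tsub_distrib, Finset.sum_tsub_distrib, ← Finset.mul_sum, ← Finset.mul_sum,
        ← card_eq_sum_LD, ← card_eq_sum_RD]
      · simp
      · intro a _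
        split_ifs with h
        · subst h; omega
        · omega
      · intro a _
        split_ifs with h
        · subst h; omega
        · omega)
  refine ⟨u', hu', ?_⟩
  refine wall (hcompat u u' hu hu') e he rfl (fun a b => (g a b : ℤ))
    (fun a b h => hg a b (by simpa using h)) (fun _ _ => Int.natCast_nonneg _) ⟨?_, ?_⟩
  · intro a
    rw [← Finset.mul_sum, hL, Finset.sum_add_distrib, he1]
    have := hgr a
    have h2 : ∑ b, (g a b : ℤ) = ((∑ b, g a b : ℕ) : ℤ) := by push_cast; rfl
    rw [h2, this]
    split_ifs with h
    · subst h; omega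
    · omega
  · intro b
    rw [← Finset.mul_sum, hRR, Finset.sum_add_distrib, he2]
    have := hgc b
    have h2 : ∑ a, (g a b : ℤ) = ((∑ a, g a b : ℕ) : ℤ) := by push_cast; rfl
    rw [h2, this]
    split_ifs with h
    · subst h; omega
    · omega

end Cover

section Uniq

variable {α β : Type*} [DecidableEq α] [DecidableEq β] [Fintype α] [Fintype β]

lemma perturb {U V F : BGraph α β} (hC : Compatible U V) (hFU : F ⊆ U) (hFV : F ⊆ V)
    (f g : α → β → ℤ) (hf : SuppOn f U) (hg : SuppOn g V)
    (hf0 : ∀ a b, (a, b) ∉ F → 0 ≤ f a b) (hg0 : ∀ a b, (a, b) ∉ F → 0 ≤ g a b)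
    (hm : SameM f g) : f = g := by
  obtain ⟨N, hN⟩ : ∃ N : ℤ, ∀ a b, |f a b| ≤ N ∧ |g a b| ≤ N := by
    refine ⟨∑ a, ∑ b, (|f a b| + |g a b|), fun a b => ?_⟩
    have h1 : ∑ b, (|f a b| + |g a b|) ≤ ∑ a, ∑ b, (|f a b| + |g a b|) :=
      Finset.single_le_sum (f := fun a => ∑ b, (|f a b| + |g a b|))
        (fun a _ => Finset.sum_nonneg fun b _ => by positivity) (Finset.mem_univ a)
    have h2 : (|f a b| + |g a b|) ≤ ∑ b, (|f a b| + |g a b|) :=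
      Finset.single_le_sum (f := fun b => (|f a b| + |g a b|))
        (fun b _ => by positivity) (Finset.mem_univ b)
    have h3 := abs_nonneg (f a b)
    have h4 := abs_nonneg (g a b)
    constructor <;> linarith
  have key := compat_eq hC (fun a b => N * ind F a b + f a b) (fun a b => N * ind F a b + g a b)
    (by
      intro a b h
      by_cases hF : (a, b) ∈ F
      · exact hFU hF
      · apply hf
        intro h0
        apply h
        simp [ind, hF, h0])
    (by
      intro a b h
      by_cases hF : (a, b) ∈ F
      · exact hFV hF
      · apply hg
        intro h0
        apply h
        simp [ind, hF, h0])
    (by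
      intro a b
      by_cases hF : (a, b) ∈ F
      · have := abs_le.1 (hN a b).1
        simp only [ind, hF, if_true]
        linarith
      · have := hf0 a b hF
        simpa [ind, hF] using this)
    (by
      intro a b
      by_cases hF : (a, b) ∈ F
      · have := abs_le.1 (hN a b).2
        simp only [ind, hF, if_true]
        linarith
      · have := hg0 a b hF
        simpa [ind, hF] using this)
    ⟨fun a => by
      show ∑ b, (N * ind F a b + f a b) = ∑ b, (N * ind F a b + g a b)
      rw [Finset.sum_add_distrib, Finset.sum_add_distrib, hm.1 a], fun b => by
      show ∑ a, (N * ind F a b + f a b) = ∑ a, (N * ind F a b + g a b)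
      rw [Finset.sum_add_distrib, Finset.sum_add_distrib, hm.2 b]⟩
  funext a b
  have := congrFun (congrFun key a) b
  simpa using this

lemma ind_nonneg (U : BGraph α β) (a : α) (b : β) : 0 ≤ ind U a b := by
  unfold ind; split_ifs <;> simp

lemma circ_neg {T T' : BGraph α β} (hC : Compatible T T') (e e' : α × β)
    (hsub : T.erase e ⊆ T') (he' : e' ∈ T') (he'T : e' ∉ T) (c : α → β → ℤ) (hc : SuppOn c T)
    (hm : SameM c (ind {e'})) : c e.1 e.2 < 0 := by
  by_contra! hcon
  have h := perturb hC (Finset.erase_subset e T) hsub c (ind {e'}) hc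
    (by
      intro a b h
      have : (a, b) = e' := by
        by_contra h2
        exact h (by simp [ind, h2])
      rw [this]; exact he')
    (by
      intro a b h
      by_cases h2 : (a, b) = e
      · subst h2; exact hcon
      · by_contra h3
        exact h (Finset.mem_erase.2 ⟨h2, hc a b (fun h0 => h3 h0.ge)⟩))
    (fun a b _ => ind_nonneg _ a b) hm
  apply he'T
  apply hc e'.1 e'.2
  rw [h]
  simp [ind]

lemma link_uniq {T T' T'' : BGraph α β} (hC : Compatible T T') (hC' : Compatible T T'')
    (hC'' : Compatible T' T'') (e e' e'' : α × β)
    (hsub : T.erase e ⊆ T') (he' : e' ∈ T') (he'T : e' ∉ T)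
    (hsub' : T.erase e ⊆ T'') (he'' : e'' ∈ T'') (he''T : e'' ∉ T)
    (c c' : α → β → ℤ) (hc : SuppOn c T)
    (hm : SameM c (ind {e'})) (hc' : SuppOn c' T) (hm' : SameM c' (ind {e''})) : e' ∈ T'' := by
  have n1 := circ_neg hC e e' hsub he' he'T c hc hm
  have n2 := circ_neg hC' e e'' hsub' he'' he''T c' hc' hm'
  have hz : ∀ a b, (a, b) ∉ T.erase e →
      -c' e.1 e.2 * c a b + c e.1 e.2 * c' a b = 0 := by
    intro a b h
    by_cases h2 : (a, b) = e
    · subst h2; ring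
    · have h3 : (a, b) ∉ T := fun h3 => h (Finset.mem_erase.2 ⟨h2, h3⟩)
      have h4 : c a b = 0 := by
        by_contra h5; exact h3 (hc a b h5)
      have h5 : c' a b = 0 := by
        by_contra h5; exact h3 (hc' a b h5)
      rw [h4, h5]; ring
  have hS : SuppOn (fun a b => -c e.1 e.2 * ind {e''} a b +
      (-c' e.1 e.2 * c a b + c e.1 e.2 * c' a b)) T'' := by
    intro a b h
    by_contra h2
    apply h
    have h3 : (a, b) ≠ e'' := fun h3 => h2 (h3 ▸ he'')
    dsimp only
    rw [hz a b (fun h4 => h2 (hsub' h4))]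
    simp [ind, h3]
  have h := perturb hC'' hsub hsub' (fun a b => -c' e.1 e.2 * ind {e'} a b)
    (fun a b => -c e.1 e.2 * ind {e''} a b +
      (-c' e.1 e.2 * c a b + c e.1 e.2 * c' a b))
    (by
      intro a b h
      have : (a, b) = e' := by
        by_contra h2
        exact h (by simp [ind, h2])
      rw [this]; exact he')
    hS
    (fun a b _ => mul_nonneg (by linarith) (ind_nonneg _ a b))
    (fun a b h => by
      rw [hz a b h, add_zero]
      exact mul_nonneg (by linarith) (ind_nonneg _ a b))
    ⟨fun a => by
      simp only [Finset.sum_add_distrib, ← Finset.mul_sum, hm.1 a, hm'.1 a]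
      ring, fun b => by
      simp only [Finset.sum_add_distrib, ← Finset.mul_sum, hm.2 b, hm'.2 b]
      ring⟩
  apply hS e'.1 e'.2
  rw [← h]
  simp [ind]
  exact n2.ne

lemma ind_single_row (e : α × β) (a : α) : ∑ b, ind {e} a b = if a = e.1 then 1 else 0 := by
  have : ∀ b, ind {e} a b = if a = e.1 ∧ b = e.2 then 1 else 0 := by
    intro b; simp [ind, Prod.ext_iff]
  simp only [this]
  by_cases h : a = e.1 <;> simp [h]

lemma ind_single_col (e : α × β) (b : β) : ∑ a, ind {e} a b = if b = e.2 then 1 else 0 := by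
  have : ∀ a, ind {e} a b = if a = e.1 ∧ b = e.2 then 1 else 0 := by
    intro a; simp [ind, Prod.ext_iff]
  simp only [this]
  by_cases h : b = e.2 <;> simp [h]

lemma RD_exch {T T' : BGraph α β} (e e' : α × β) (h1 : T \ T' = {e}) (h2 : T' \ T = {e'}) (b : β) :
    (RD T b : ℤ) + (if b = e'.2 then 1 else 0) = RD T' b + if b = e.2 then 1 else 0 := by
  rw [RD_eq_sum, RD_eq_sum, ← ind_single_col, ← ind_single_col, ← Finset.sum_add_distrib,
    ← Finset.sum_add_distrib]
  apply Finset.sum_congr rfl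
  intro a _
  rw [← h1, ← h2]
  by_cases h3 : (a, b) ∈ T <;> by_cases h4 : (a, b) ∈ T' <;> simp [ind, h3, h4]

end Uniq

section Final

variable {n d : ℕ} {Tr : (Fin d → ℕ) → BGraph (Fin n) (Fin d)}

lemma sum_unit (t : Fin d → ℕ) (ht : (∑ j, t j) + 2 = n) (j : Fin d) :
    (∑ k, (t + unitVec j) k) + 1 = n := by
  have : ∑ k, unitVec j k = 1 := by simp [unitVec]
  simp only [Pi.add_apply, Finset.sum_add_distrib, this]
  omega

lemma leaf_mem
    (htree : ∀ u : Fin d → ℕ, (∑ j, u j) + 1 = n → IsTreeOn (Tr u) Finset.univ Finset.univ)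
    (hRDeg : ∀ u : Fin d → ℕ, (∑ j, u j) + 1 = n → ∀ j, RD (Tr u) j = u j + 1)
    (hcompat : ∀ u u' : Fin d → ℕ, (∑ j, u j) + 1 = n → (∑ j, u' j) + 1 = n →
      Compatible (Tr u) (Tr u'))
    (t : Fin d → ℕ) (ht : (∑ j, t j) + 2 = n) (jb j : Fin d) (i : Fin n)
    (hi : (i, jb) ∈ Tr (t + unitVec jb)) (hl : LD (Tr (t + unitVec jb)) i < 2) :
    (i, jb) ∈ Tr (t + unitVec j) := by
  have hu := sum_unit t ht jb
  have hu' := sum_unit t ht j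
  obtain ⟨φ, π, r1, r2, h⟩ := rooted_at htree hRDeg _ hu j
  obtain ⟨φ', π', r1', r2', h'⟩ := rooted_at htree hRDeg _ hu' jb
  have heq := compat_eq (hcompat _ _ hu hu') (topeMat φ) (topeMat φ') h.supp_tope h'.supp_tope
    (topeMat_nonneg φ) (topeMat_nonneg φ')
    ⟨fun a => by rw [topeMat_row, topeMat_row], fun b => by
      rw [h.tope_col, h'.tope_col, hRDeg _ hu, hRDeg _ hu']
      simp only [Pi.add_apply, unitVec]
      by_cases h1 : b = j <;> by_cases h2 : b = jb <;> simp [h1, h2] <;> split_ifs <;> simp_all⟩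
  have hφ : φ i = jb := by
    by_contra hne
    have : 2 ≤ LD (Tr (t + unitVec jb)) i := by
      unfold LD
      have h2 : ({(i, φ i), (i, jb)} : Finset (Fin n × Fin d)).card = 2 := by
        rw [Finset.card_pair]; simp [hne]
      rw [← h2]
      apply Finset.card_le_card
      intro x hx
      simp only [Finset.mem_insert, Finset.mem_singleton] at hx
      rcases hx with rfl | rfl
      · simp [h.hφ i]
      · simp [hi]
    omega
  apply h'.supp_tope
  rw [← heq]
  simp [topeMat, hφ]

lemma link_adj
    (htree : ∀ u : Fin d → ℕ, (∑ j, u j) + 1 = n → IsTreeOn (Tr u) Finset.univ Finset.univ)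
    (hRDeg : ∀ u : Fin d → ℕ, (∑ j, u j) + 1 = n → ∀ j, RD (Tr u) j = u j + 1)
    (hcompat : ∀ u u' : Fin d → ℕ, (∑ j, u j) + 1 = n → (∑ j, u' j) + 1 = n →
      Compatible (Tr u) (Tr u'))
    (t : Fin d → ℕ) (ht : (∑ j, t j) + 2 = n) (jb : Fin d) (i : Fin n)
    (hi : (i, jb) ∈ Tr (t + unitVec jb)) (hl : 2 ≤ LD (Tr (t + unitVec jb)) i) :
    ∃ j, (TLGraph Tr t).Adj jb j ∧ Tr (t + unitVec jb) \ Tr (t + unitVec j) = {(i, jb)} := by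
  have hu := sum_unit t ht jb
  obtain ⟨u', hu', hsub, hne⟩ := linkage htree hRDeg hcompat _ hu (i, jb) hi hl (by
    rw [hRDeg _ hu]; simp [unitVec])
  have h1 : Tr (t + unitVec jb) \ Tr u' = {(i, jb)} := by
    ext x
    simp only [Finset.mem_sdiff, Finset.mem_singleton]
    constructor
    · rintro ⟨h1, h2⟩
      by_contra h3
      exact h2 (hsub (Finset.mem_erase.2 ⟨h3, h1⟩))
    · rintro rfl
      exact ⟨hi, hne⟩
  have h2 : (Tr u' \ Tr (t + unitVec jb)).card = 1 := by
    have h3 := Finset.card_sdiff_add_card_inter (Tr (t + unitVec jb)) (Tr u')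
    have h4 := Finset.card_sdiff_add_card_inter (Tr u') (Tr (t + unitVec jb))
    rw [Finset.inter_comm] at h4
    have h5 := tr_card hRDeg _ hu
    have h6 := tr_card hRDeg _ hu'
    rw [h1, Finset.card_singleton] at h3
    omega
  obtain ⟨e', he'⟩ := Finset.card_eq_one.1 h2
  have hsw := RD_exch _ _ h1 he'
  have huu : u' = t + unitVec e'.2 := by
    funext b
    have := hsw b
    rw [hRDeg _ hu, hRDeg _ hu'] at this
    simp only [Pi.add_apply, unitVec] at this ⊢
    push_cast at this
    split_ifs at this ⊢ <;> omega
  refine ⟨e'.2, ?_, ?_⟩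
  · rw [TLGraph, SimpleGraph.fromRel_adj]
    refine ⟨?_, Or.inl ⟨?_, ?_⟩⟩
    · intro h
      rw [huu, ← h] at hne
      exact hne hi
    · rw [← huu, h1, Finset.card_singleton]
    · rw [← huu, h2]
  · rw [← huu, h1]

lemma adj_edges
    (hRDeg : ∀ u : Fin d → ℕ, (∑ j, u j) + 1 = n → ∀ j, RD (Tr u) j = u j + 1)
    (t : Fin d → ℕ) (ht : (∑ j, t j) + 2 = n) (jb j : Fin d) (h : (TLGraph Tr t).Adj jb j) :
    ∃ i i', Tr (t + unitVec jb) \ Tr (t + unitVec j) = {(i, jb)} ∧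
      Tr (t + unitVec j) \ Tr (t + unitVec jb) = {(i', j)} := by
  rw [TLGraph, SimpleGraph.fromRel_adj] at h
  obtain ⟨hne, h⟩ := h
  have h : diffOne (Tr (t + unitVec jb)) (Tr (t + unitVec j)) := by
    rcases h with h | h
    · exact h
    · exact ⟨h.2, h.1⟩
  obtain ⟨⟨i, b⟩, h1⟩ := Finset.card_eq_one.1 h.1
  obtain ⟨⟨i', b'⟩, h2⟩ := Finset.card_eq_one.1 h.2
  have hsw := RD_exch _ _ h1 h2
  have hb : b = jb ∧ b' = j := by
    have h3 := hsw jb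
    have h4 := hsw j
    rw [hRDeg _ (sum_unit t ht jb), hRDeg _ (sum_unit t ht j)] at h3 h4
    simp only [Pi.add_apply, unitVec, if_true, hne, hne.symm, if_false] at h3 h4
    push_cast at h3 h4
    constructor
    · by_contra hc
      rw [if_neg (fun h : jb = b => hc h.symm)] at h3
      split_ifs at h3 <;> omega
    · by_contra hc
      rw [if_neg (fun h : j = b' => hc h.symm)] at h4
      split_ifs at h4 <;> omega
  obtain ⟨rfl, rfl⟩ := hb
  exact ⟨i, i', h1, h2⟩

lemma adj_uniq
    (htree : ∀ u : Fin d → ℕ, (∑ j, u j) + 1 = n → IsTreeOn (Tr u) Finset.univ Finset.univ)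
    (hRDeg : ∀ u : Fin d → ℕ, (∑ j, u j) + 1 = n → ∀ j, RD (Tr u) j = u j + 1)
    (hcompat : ∀ u u' : Fin d → ℕ, (∑ j, u j) + 1 = n → (∑ j, u' j) + 1 = n →
      Compatible (Tr u) (Tr u'))
    (t : Fin d → ℕ) (ht : (∑ j, t j) + 2 = n) (jb j j' : Fin d) (h : (TLGraph Tr t).Adj jb j)
    (h' : (TLGraph Tr t).Adj jb j')
    (he : Tr (t + unitVec jb) \ Tr (t + unitVec j) = Tr (t + unitVec jb) \ Tr (t + unitVec j')) :
    j = j' := by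
  obtain ⟨i, x, h1, h2⟩ := adj_edges hRDeg t ht jb j h
  obtain ⟨i', x', h1', h2'⟩ := adj_edges hRDeg t ht jb j' h'
  have hu := sum_unit t ht
  rw [← he] at h1'
  have hx : (x, j) ∈ Tr (t + unitVec j) \ Tr (t + unitVec jb) := by rw [h2]; simp
  have hx' : (x', j') ∈ Tr (t + unitVec j') \ Tr (t + unitVec jb) := by rw [h2']; simp
  rw [Finset.mem_sdiff] at hx hx'
  have hsub : (Tr (t + unitVec jb)).erase (i, jb) ⊆ Tr (t + unitVec j) := by
    intro y hy
    rw [← Finset.sdiff_singleton_eq_erase, ← h1] at hy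
    simp only [Finset.mem_sdiff, not_and, not_not] at hy
    exact hy.2 hy.1
  have hsub' : (Tr (t + unitVec jb)).erase (i, jb) ⊆ Tr (t + unitVec j') := by
    intro y hy
    rw [← Finset.sdiff_singleton_eq_erase, ← h1, he] at hy
    simp only [Finset.mem_sdiff, not_and, not_not] at hy
    exact hy.2 hy.1
  have hpath : ∀ (a : Fin n) (k : Fin d), ∃ c, SuppOn c (Tr (t + unitVec jb)) ∧
      SameM c (ind {(a, k)}) := by
    intro a k
    obtain ⟨φ, π, r1, r2, hR⟩ := rooted_at htree hRDeg _ (hu jb) k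
    obtain ⟨A, hA, _, _, hr, hc⟩ := hR.path a
    exact ⟨A, hA, fun y => by rw [hr, ind_single_row], fun y => by rw [hc, ind_single_col]⟩
  obtain ⟨c, hc, hm⟩ := hpath x j
  obtain ⟨c', hc', hm'⟩ := hpath x' j'
  have hmem := link_uniq (hcompat _ _ (hu jb) (hu j)) (hcompat _ _ (hu jb) (hu j'))
    (hcompat _ _ (hu j) (hu j')) (i, jb) (x, j) (x', j') hsub hx.1 hx.2 hsub' hx'.1 hx'.2
    c c' hc hm hc' hm'
  have : (x, j) ∈ Tr (t + unitVec j') \ Tr (t + unitVec jb) := Finset.mem_sdiff.2 ⟨hmem, hx.2⟩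
  rw [h2'] at this
  simp only [Finset.mem_singleton, Prod.mk.injEq] at this
  exact this.2

end Final


theorem statement7 {n d : ℕ} (hn : 2 ≤ n)
    (Tr : (Fin d → ℕ) → BGraph (Fin n) (Fin d))
    (htree : ∀ u : Fin d → ℕ, (∑ j, u j) + 1 = n → IsTreeOn (Tr u) Finset.univ Finset.univ)
    (hRDeg : ∀ u : Fin d → ℕ, (∑ j, u j) + 1 = n → ∀ j, RD (Tr u) j = u j + 1)
    (hcompat : ∀ u u' : Fin d → ℕ, (∑ j, u j) + 1 = n → (∑ j, u' j) + 1 = n →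
      Compatible (Tr u) (Tr u'))
    (hlink : ∀ u : Fin d → ℕ, (∑ j, u j) + 1 = n → ∀ e ∈ Tr u,
      2 ≤ LD (Tr u) e.1 → 2 ≤ RD (Tr u) e.2 →
      ∃ u' : Fin d → ℕ, ((∑ j, u' j) + 1 = n) ∧ ∃ e' ∈ Tr u',
        (Tr u).erase e = (Tr u').erase e')
    (t : Fin d → ℕ) (ht : (∑ j, t j) + 2 = n) (jb : Fin d) :
    TLdeg Tr t jb + RD (interTree Tr t) jb = t jb + 2 := by
  classical
  have hu := sum_unit t ht
  have hT : RD (Tr (t + unitVec jb)) jb = t jb + 2 := by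
    rw [hRDeg _ (hu jb)]; simp [unitVec]
  rw [← hT]
  have hcard : TLdeg Tr t jb =
      ((Tr (t + unitVec jb)).filter fun e => e.2 = jb ∧ e ∉ interTree Tr t).card := by
    unfold TLdeg
    have hch : ∀ j, ∃ e : Fin n × Fin d, (TLGraph Tr t).Adj jb j →
        Tr (t + unitVec jb) \ Tr (t + unitVec j) = {e} ∧ e.2 = jb := by
      intro j
      by_cases h : (TLGraph Tr t).Adj jb j
      · obtain ⟨i, i', h1, h2⟩ := adj_edges hRDeg t ht jb j h
        exact ⟨(i, jb), fun _ => ⟨h1, rfl⟩⟩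
      · exact ⟨(⟨0, by omega⟩, jb), fun h' => absurd h' h⟩
    choose E hE using hch
    apply Finset.card_bij (fun j _ => E j)
    · intro j hj
      have hj : (TLGraph Tr t).Adj jb j := by simpa using hj
      obtain ⟨h1, h2⟩ := hE j hj
      have h3 : E j ∈ Tr (t + unitVec jb) \ Tr (t + unitVec j) := by rw [h1]; simp
      rw [Finset.mem_sdiff] at h3
      simp only [Finset.mem_filter, interTree, Finset.mem_univ, true_and]
      exact ⟨h3.1, h2, fun h => h3.2 (h j)⟩
    · intro j hj j' hj' heq
      have hj : (TLGraph Tr t).Adj jb j := by simpa using hj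
      have hj' : (TLGraph Tr t).Adj jb j' := by simpa using hj'
      apply adj_uniq htree hRDeg hcompat t ht jb j j' hj hj'
      rw [(hE j hj).1, (hE j' hj').1, heq]
    · rintro ⟨i, b⟩ he
      simp only [Finset.mem_filter, interTree, Finset.mem_univ, true_and] at he
      obtain ⟨h1, rfl, h2⟩ := he
      have hl : 2 ≤ LD (Tr (t + unitVec b)) i := by
        by_contra hl
        exact h2 fun j => leaf_mem htree hRDeg hcompat t ht b j i h1 (by omega)
      obtain ⟨j, hj, hj2⟩ := link_adj htree hRDeg hcompat t ht b i h1 hl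
      refine ⟨j, by simpa using hj, ?_⟩
      have := (hE j hj).1
      rw [hj2] at this
      exact (Finset.singleton_injective this).symm
  have hint : RD (interTree Tr t) jb =
      ((Tr (t + unitVec jb)).filter fun e => e.2 = jb ∧ e ∈ interTree Tr t).card := by
    unfold RD
    congr 1
    ext e
    simp only [Finset.mem_filter, interTree, Finset.mem_univ, true_and]
    constructor
    · rintro ⟨h1, h2⟩
      exact ⟨h1 jb, h2, h1⟩
    · rintro ⟨_, h2, h1⟩
      exact ⟨h1, h2⟩
  rw [hcard, hint]
  unfold RD
  rw [← Finset.card_filter_add_card_filter_not (s := (Tr (t + unitVec jb)).filter fun e => e.2 = jb)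
    (fun e => e ∈ interTree Tr t), Finset.filter_filter, Finset.filter_filter, add_comm]
end

section
/- In an extended generic (n,d)-tropical oriented matroid 𝒯̃, every semitype T ∈ 𝒯̃ is a refinement of some honest type T⁺ ∈ 𝒯̃; that is, there exists T⁺ ∈ 𝒯̃ with all coordinates nonempty such that G(T) ⊆ G(T⁺). -/
open Finset

/-- The graph of an `(n,d)`-(semi)type. -/
def typeGraph {n d : ℕ} (T : Fin n → Finset (Fin d)) : BGraph (Fin n) (Fin d) :=
  Finset.univ.filter fun e => e.2 ∈ T e.1

/-- An extended generic `(n,d)`-tropical oriented matroid. -/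
structure ExtGenericTOM (n d : ℕ) where
  semitypes : Set (Fin n → Finset (Fin d))
  acyclic : ∀ T ∈ semitypes, Acyclic (typeGraph T)
  boundary : ∀ j : Fin d, (fun _ => ({j} : Finset (Fin d))) ∈ semitypes
  surrounding : ∀ T ∈ semitypes, ∀ T' : Fin n → Finset (Fin d),
    typeGraph T' ⊆ typeGraph T → T' ∈ semitypes
  compat : ∀ T ∈ semitypes, ∀ T' ∈ semitypes, Compatible (typeGraph T) (typeGraph T')
  elimination : ∀ U ∈ semitypes, ∀ V ∈ semitypes, ∀ i : Fin n, ∃ W ∈ semitypes,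
    W i = U i ∪ V i ∧ ∀ i' : Fin n, i' ≠ i → W i' = U i' ∨ W i' = V i'

structure TOMF {n d : ℕ} (F : Set (Fin n → Finset (Fin d))) (X : Finset (Fin d)) : Prop where
  bd : ∀ j ∈ X, (fun _ => ({j} : Finset (Fin d))) ∈ F
  down : ∀ T ∈ F, ∀ T' : Fin n → Finset (Fin d), (∀ i, T' i ⊆ T i) → T' ∈ F
  elim : ∀ U ∈ F, ∀ V ∈ F, ∀ i : Fin n, ∃ W ∈ F,
    W i = U i ∪ V i ∧ ∀ i' : Fin n, i' ≠ i → W i' = U i' ∨ W i' = V i'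

theorem TOMF.path {n d : ℕ} {F : Set (Fin n → Finset (Fin d))} {X : Finset (Fin d)}
    (hF : TOMF F X) (U : Fin n → Finset (Fin d)) (hU : U ∈ F) :
    ∀ (m : ℕ) (V : Fin n → Finset (Fin d)), V ∈ F →
      (univ.filter fun i => U i ≠ V i).card ≤ m → U ≠ V →
      ∃ i, U i ≠ V i ∧ Function.update U i (U i ∪ V i) ∈ F := by
  intro m
  induction m with
  | zero =>
    intro V hV hm hne
    exfalso
    apply hne
    funext i
    by_contra h
    have : i ∈ (univ.filter fun i => U i ≠ V i) := by simp [h]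
    have := Finset.card_pos.mpr ⟨i, this⟩
    omega
  | succ m ih =>
    intro V hV hm hne
    obtain ⟨i0, hi0⟩ := Function.ne_iff.mp hne
    obtain ⟨W, hW, hW0, hW1⟩ := hF.elim U hU V hV i0
    let V' := Function.update W i0 (U i0)
    have hV' : V' ∈ F := by
      apply hF.down W hW
      intro i
      by_cases h : i = i0
      · subst h; simp [V', hW0]
      · simp [V', h]
    by_cases hUV : U = V'
    · refine ⟨i0, hi0, ?_⟩
      have : Function.update U i0 (U i0 ∪ V i0) = W := by
        funext i
        by_cases h : i = i0
        · subst h; simp [hW0]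
        · rw [hUV]; simp [V', h]
      rw [this]; exact hW
    · have key : ∀ i, U i ≠ V' i → i ≠ i0 ∧ V' i = V i := by
        intro i hi
        by_cases h : i = i0
        · subst h; simp [V'] at hi
        · refine ⟨h, ?_⟩
          simp only [V', Function.update_of_ne h] at hi ⊢
          rcases hW1 i h with h1 | h1
          · exact absurd h1.symm hi
          · exact h1
      have hlt : (univ.filter fun i => U i ≠ V' i).card <
          (univ.filter fun i => U i ≠ V i).card := by
        apply Finset.card_lt_card
        refine ⟨?_, ?_⟩
        · intro i hi
          simp only [mem_filter, mem_univ, true_and] at hi ⊢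
          rw [← (key i hi).2]; exact hi
        · intro hsub
          have : i0 ∈ (univ.filter fun i => U i ≠ V' i) := hsub (by simp [hi0])
          simp only [mem_filter, mem_univ, true_and] at this
          exact (key i0 this).1 rfl
      obtain ⟨i, h1, h2⟩ := ih V' hV' (by omega) hUV
      have e := (key i h1).2
      rw [e] at h1 h2
      exact ⟨i, h1, h2⟩

/-- those members which extend to something nonempty at `k` -/
def extAt {n d : ℕ} (F : Set (Fin n → Finset (Fin d))) (k : Fin n) :
    Set (Fin n → Finset (Fin d)) :=
  {T | ∃ T' ∈ F, (∀ i, T i ⊆ T' i) ∧ (T' k).Nonempty}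

theorem TOMF.extAt {n d : ℕ} {F : Set (Fin n → Finset (Fin d))} {X : Finset (Fin d)}
    (hF : TOMF F X) (k : Fin n) : TOMF (extAt F k) X := by
  refine ⟨?_, ?_, ?_⟩
  · intro j hj
    exact ⟨_, hF.bd j hj, fun i => Finset.Subset.refl _, by simp⟩
  · rintro T ⟨T1, h1, h2, h3⟩ T' hT'
    exact ⟨T1, h1, fun i => (hT' i).trans (h2 i), h3⟩
  · rintro U ⟨Up, hUp, hU, hUk⟩ V ⟨Vp, hVp, hV, hVk⟩ i
    have aux : ∀ U Up : Fin n → Finset (Fin d), Up ∈ F → (∀ i, U i ⊆ Up i) →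
        Function.update U k (Up k) ∈ F := by
      intro U Up hUp hU
      apply hF.down Up hUp
      intro i
      by_cases h : i = k
      · subst h; simp
      · simp [h, hU i]
    obtain ⟨W, hW, hW0, hW1⟩ := hF.elim _ (aux U Up hUp hU) _ (aux V Vp hVp hV) i
    by_cases hik : i = k
    · subst hik
      simp only [Function.update_self] at hW0
      refine ⟨Function.update W i (U i ∪ V i), ⟨W, hW, ?_, ?_⟩, by simp, ?_⟩
      · intro i'
        by_cases h : i' = i
        · subst h; simp only [Function.update_self, hW0]
          exact Finset.union_subset_union (hU _) (hV _)
        · simp [h]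
      · rw [hW0]; exact hUk.mono Finset.subset_union_left
      · intro i' h
        have := hW1 i' h
        simpa [h] using this
    · have hk := hW1 k (Ne.symm hik)
      simp only [Function.update_self] at hk
      rw [Function.update_of_ne hik, Function.update_of_ne hik] at hW0
      have hWk : (W k).Nonempty := by
        rcases hk with h | h <;> rw [h] <;> assumption
      have : ∃ S, S ⊆ W k ∧ (S = U k ∨ S = V k) := by
        rcases hk with h | h
        · exact ⟨U k, by rw [h]; exact hU k, Or.inl rfl⟩
        · exact ⟨V k, by rw [h]; exact hV k, Or.inr rfl⟩
      obtain ⟨S, hS, hS'⟩ := this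
      refine ⟨Function.update W k S, ⟨W, hW, ?_, hWk⟩, ?_, ?_⟩
      · intro i'
        by_cases h : i' = k
        · subst h; simpa using hS
        · simp [h]
      · simp [hik, hW0]
      · intro i' h
        by_cases h' : i' = k
        · subst h'; simpa using hS'
        · have := hW1 i' h
          simpa [h'] using this

theorem extAt_sub {n d : ℕ} {F : Set (Fin n → Finset (Fin d))} {X : Finset (Fin d)}
    (hF : TOMF F X) (k : Fin n) : extAt F k ⊆ F := by
  rintro T ⟨T1, h1, h2, h3⟩
  exact hF.down _ h1 _ h2

/-- The claim for row set `I`. -/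
def Claim {n d : ℕ} (G : Set (Fin n → Finset (Fin d))) (I : Finset (Fin n)) : Prop :=
  ∀ (F : Set (Fin n → Finset (Fin d))) (X : Finset (Fin d)), F ⊆ G → X.Nonempty → TOMF F X →
    ∀ T ∈ G, (∀ i, i ∉ I → T i = ∅) → (∀ i, T i ⊆ X) → T ∈ F

theorem ext_of_claim {n d : ℕ} {G : Set (Fin n → Finset (Fin d))} {I : Finset (Fin n)}
    (hC : ∀ I', I' ⊂ I → Claim G I')
    {F : Set (Fin n → Finset (Fin d))} {X : Finset (Fin d)} (hFG : F ⊆ G) (hX : X.Nonempty)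
    (hF : TOMF F X) (hFX : ∀ T ∈ F, ∀ i, T i ⊆ X) :
    ∀ (m : ℕ) (A : Finset (Fin n)), A ⊆ I → (I \ A).card ≤ m →
      ∀ T ∈ F, (∀ i, i ∉ A → T i = ∅) → (∀ i ∈ A, (T i).Nonempty) →
      ∃ T' ∈ F, (∀ i, T i ⊆ T' i) ∧ ∀ i ∈ I, (T' i).Nonempty := by
  intro m
  induction m with
  | zero =>
    intro A hA hm T hT h0 h1
    refine ⟨T, hT, fun i => Finset.Subset.refl _, ?_⟩
    intro i hi
    apply h1
    have : I \ A = ∅ := Finset.card_eq_zero.mp (by omega)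
    exact Finset.sdiff_eq_empty_iff_subset.mp this hi
  | succ m ih =>
    intro A hA hm T hT h0 h1
    by_cases hAI : A = I
    · subst hAI
      exact ⟨T, hT, fun i => Finset.Subset.refl _, h1⟩
    have hss : A ⊂ I := hA.ssubset_of_ne hAI
    obtain ⟨k, hkI, hkA⟩ := Finset.exists_of_ssubset hss
    have := hC A hss (extAt F k) X ((extAt_sub hF k).trans hFG) hX (hF.extAt k) T (hFG hT) h0
      (hFX T hT)
    obtain ⟨T1, hT1, hle, hne⟩ := this
    let T2 : Fin n → Finset (Fin d) := fun i => if i ∈ insert k A then T1 i else ∅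
    have hT2 : T2 ∈ F := by
      apply hF.down T1 hT1
      intro i
      simp only [T2]
      split_ifs <;> simp
    have hle2 : ∀ i, T i ⊆ T2 i := by
      intro i
      by_cases h : i ∈ A
      · simp [T2, h, hle i]
      · simp [h0 i h]
    obtain ⟨T', hT', h3, h4⟩ := ih (insert k A) (Finset.insert_subset hkI hA) (by
        have : (I \ insert k A).card < (I \ A).card := by
          apply Finset.card_lt_card
          refine ⟨Finset.sdiff_subset_sdiff le_rfl (Finset.subset_insert _ _), ?_⟩
          intro h
          have := h (Finset.mem_sdiff.mpr ⟨hkI, hkA⟩)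
          simp at this
        omega) T2 hT2 (by intro i hi; simp only [T2, if_neg hi]) (by
        intro i hi
        simp only [T2, if_pos hi]
        rcases Finset.mem_insert.mp hi with h | h
        · subst h; exact hne
        · exact (h1 i h).mono (hle i))
    exact ⟨T', hT', fun i => (hle2 i).trans (h3 i), h4⟩

theorem TOMF.cols {n d : ℕ} {F : Set (Fin n → Finset (Fin d))} {X : Finset (Fin d)}
    (hF : TOMF F X) {Y : Finset (Fin d)} (hY : Y ⊆ X) :
    TOMF {T | T ∈ F ∧ ∀ i, T i ⊆ Y} Y := by
  refine ⟨?_, ?_, ?_⟩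
  · intro j hj
    exact ⟨hF.bd j (hY hj), fun i => by simpa using hj⟩
  · rintro T ⟨h1, h2⟩ T' hT'
    exact ⟨hF.down T h1 T' hT', fun i => (hT' i).trans (h2 i)⟩
  · rintro U ⟨hU, hU'⟩ V ⟨hV, hV'⟩ i
    obtain ⟨W, hW, hW0, hW1⟩ := hF.elim U hU V hV i
    refine ⟨W, ⟨hW, ?_⟩, hW0, hW1⟩
    intro i'
    by_cases h : i' = i
    · subst h; rw [hW0]; exact Finset.union_subset (hU' _) (hV' _)
    · rcases hW1 i' h with h | h <;> rw [h]
      · exact hU' _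
      · exact hV' _

theorem crossing {n d : ℕ} {G : Set (Fin n → Finset (Fin d))} {I : Finset (Fin n)}
    (hC : ∀ I', I' ⊂ I → Claim G I')
    {F : Set (Fin n → Finset (Fin d))} {X : Finset (Fin d)} (hFG : F ⊆ G)
    (hF : TOMF F X) {Y : Finset (Fin d)} (hYX : Y ⊆ X) (hY : Y.Nonempty)
    (W : Fin n → Finset (Fin d)) (hW : W ∈ F) (A : Finset (Fin n)) (hA : A ⊂ I)
    (hW0 : ∀ i, i ∉ I → W i = ∅) (hWA : ∀ i ∈ A, W i ⊆ Y)
    (hWne : ∀ i ∈ A, (W i).Nonempty)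
    (hWB : ∀ i ∈ I, i ∉ A → Disjoint (W i) Y) :
    ∃ i ∈ I, i ∉ A ∧ ∃ j ∈ Y, Function.update W i (insert j (W i)) ∈ F := by
  let T : Fin n → Finset (Fin d) := fun i => if i ∈ A then W i else ∅
  have hT : T ∈ {T | T ∈ F ∧ ∀ i, T i ⊆ Y} := by
    refine ⟨hF.down W hW _ ?_, ?_⟩
    · intro i; simp only [T]; split_ifs <;> simp
    · intro i; simp only [T]; split_ifs with h
      · exact hWA i h
      · simp
  obtain ⟨T', ⟨hT'F, hT'Y⟩, hle, hne⟩ := ext_of_claim (F := {T | T ∈ F ∧ ∀ i, T i ⊆ Y}) hC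
    (fun T h => hFG h.1) hY (hF.cols hYX) (fun T h => h.2) _ A hA.subset le_rfl T hT
    (by intro i hi; simp [T, hi]) (by intro i hi; simpa [T, hi] using hWne i hi)
  let V : Fin n → Finset (Fin d) := fun i => if i ∈ A then W i else if i ∈ I then T' i else ∅
  have hV : V ∈ F := by
    apply hF.down T' hT'F
    intro i
    simp only [V]
    split_ifs with h1 h2
    · have := hle i
      simpa [T, h1] using this
    · simp
    · simp
  obtain ⟨k, hkI, hkA⟩ := Finset.exists_of_ssubset hA
  have hne' : W ≠ V := by
    intro h
    have h1 := congrFun h k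
    simp only [V, if_neg hkA, if_pos hkI] at h1
    have h2 := hWB k hkI hkA
    rw [h1] at h2
    obtain ⟨x, hx⟩ := hne k hkI
    exact Finset.disjoint_left.mp h2 hx (hT'Y k hx)
  obtain ⟨i, hi, hup⟩ := hF.path W hW _ V hV le_rfl hne'
  have hiA : i ∉ A := by
    intro h; simp [V, h] at hi
  have hiI : i ∈ I := by
    by_contra h
    simp [V, hiA, h, hW0] at hi
  obtain ⟨j, hj⟩ := hne i hiI
  refine ⟨i, hiI, hiA, j, hT'Y i hj, hF.down _ hup _ ?_⟩
  intro i'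
  by_cases h : i' = i
  · subst h
    simp only [Function.update_self, V, if_neg hiA, if_pos hiI]
    intro x hx
    rcases Finset.mem_insert.mp hx with h | h
    · subst h; simp [hj]
    · simp [h]
  · simp [h]

/-- the partial function type -/
def sg {n d : ℕ} (I : Finset (Fin n)) (f : Fin n → Fin d) : Fin n → Finset (Fin d) :=
  fun i => if i ∈ I then {f i} else ∅

/-- column counts -/
def cnt {n d : ℕ} (I : Finset (Fin n)) (f : Fin n → Fin d) (j : Fin d) : ℕ :=
  (I.filter fun i => f i = j).card

theorem cnt_sum {n d : ℕ} (I : Finset (Fin n)) (f : Fin n → Fin d) :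
    ∑ j, cnt I f j = I.card := by
  unfold cnt
  exact (Finset.card_eq_sum_card_fiberwise (fun i _ => Finset.mem_univ (f i))).symm

theorem cnt_update {n d : ℕ} (I : Finset (Fin n)) (f : Fin n → Fin d) (i : Fin n) (hi : i ∈ I)
    (j x : Fin d) :
    cnt I (Function.update f i j) x + (if x = f i then 1 else 0) =
      cnt I f x + (if x = j then 1 else 0) := by
  have key : ∀ g : Fin n → Fin d, cnt I g x =
      cnt (I.erase i) g x + (if x = g i then 1 else 0) := by
    intro g
    unfold cnt
    conv_lhs => rw [← Finset.insert_erase hi]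
    rw [Finset.filter_insert]
    by_cases h : g i = x
    · rw [if_pos h, if_pos h.symm, Finset.card_insert_of_notMem (by simp)]
    · rw [if_neg h, if_neg (Ne.symm h)]; simp
  have h2 : cnt (I.erase i) (Function.update f i j) x = cnt (I.erase i) f x := by
    unfold cnt
    congr 1
    apply Finset.filter_congr
    intro y hy
    rw [Function.update_of_ne (Finset.ne_of_mem_erase hy)]
  rw [key f, key (Function.update f i j), h2, Function.update_self]
  omega

theorem augment {n d : ℕ} {G : Set (Fin n → Finset (Fin d))} {I : Finset (Fin n)}
    (hC : ∀ I', I' ⊂ I → Claim G I')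
    {F : Set (Fin n → Finset (Fin d))} {X : Finset (Fin d)} (hFG : F ⊆ G)
    (hF : TOMF F X) (f : Fin n → Fin d) (hfX : ∀ i ∈ I, f i ∈ X)
    (j0 : Fin d) (O : Finset (Fin d)) (hO : ∃ i ∈ I, f i ∈ O) :
    ∀ (m : ℕ) (Y : Finset (Fin d)) (W : Fin n → Finset (Fin d)), Y ⊆ X → j0 ∈ Y →
      (X \ Y).card ≤ m → W ∈ F → (∀ i ∈ I, f i ∈ W i) →
      (∀ j ∈ Y, ∃ g : Fin n → Fin d, (∀ i ∈ I, g i ∈ W i) ∧ (∀ i, f i ∉ Y → g i = f i) ∧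
        (∀ i, f i ∈ Y → g i ∈ Y) ∧
        ∀ x, cnt I g x + (if x = j then 1 else 0) = cnt I f x + (if x = j0 then 1 else 0)) →
      ∃ j ∈ O, ∃ g : Fin n → Fin d, sg I g ∈ F ∧ (∀ i ∈ I, g i ∈ X) ∧
        ∀ x, cnt I g x + (if x = j then 1 else 0) = cnt I f x + (if x = j0 then 1 else 0) := by
  intro m
  induction m with
  | zero =>
    intro Y W hYX hj0 hm hW hfW hg
    have hXY : X ⊆ Y := Finset.sdiff_eq_empty_iff_subset.mp (Finset.card_eq_zero.mp (by omega))
    obtain ⟨i, hi, hiO⟩ := hO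
    obtain ⟨g, h1, h2, h3, h4⟩ := hg (f i) (hXY (hfX i hi))
    refine ⟨f i, hiO, g, hF.down W hW _ ?_, ?_, h4⟩
    · intro i'
      simp only [sg]
      split_ifs with h
      · simpa using h1 i' h
      · simp
    · intro i' hi'
      exact hYX (h3 i' (hXY (hfX i' hi')))
  | succ m ih =>
    intro Y W hYX hj0 hm hW hfW hg
    by_cases hYO : ∃ j ∈ Y, j ∈ O
    · obtain ⟨j, hjY, hjO⟩ := hYO
      obtain ⟨g, h1, h2, h3, h4⟩ := hg j hjY
      refine ⟨j, hjO, g, hF.down W hW _ ?_, ?_, h4⟩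
      · intro i'
        simp only [sg]
        split_ifs with h
        · simpa using h1 i' h
        · simp
      · intro i' hi'
        by_cases h : f i' ∈ Y
        · exact hYX (h3 i' h)
        · rw [h2 i' h]; exact hfX i' hi'
    · push Not at hYO
      let W' : Fin n → Finset (Fin d) := fun i =>
        if i ∈ I then (if f i ∈ Y then W i ∩ Y else {f i}) else ∅
      have hW' : W' ∈ F := by
        apply hF.down W hW
        intro i
        simp only [W']
        split_ifs with h1 h2
        · exact Finset.inter_subset_left
        · simpa using hfW i h1
        · simp
      obtain ⟨i0, hi0, hi0O⟩ := hO
      have hi0Y : f i0 ∉ Y := fun h => hYO _ h hi0O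
      obtain ⟨i, hiI, hiA, j, hjY, hup⟩ := crossing hC hFG hF hYX ⟨j0, hj0⟩ W' hW'
        (I.filter fun i => f i ∈ Y)
        (by
          refine ⟨Finset.filter_subset _ _, fun h => ?_⟩
          have := h hi0
          simp only [mem_filter] at this
          exact hi0Y this.2)
        (by intro i hi; simp [W', hi])
        (by
          intro i hi
          simp only [mem_filter] at hi
          simp only [W', if_pos hi.1, if_pos hi.2]
          exact Finset.inter_subset_right)
        (by
          intro i hi
          simp only [mem_filter] at hi
          simp only [W', if_pos hi.1, if_pos hi.2]
          exact ⟨f i, Finset.mem_inter.mpr ⟨hfW i hi.1, hi.2⟩⟩)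
        (by
          intro i hi hi'
          simp only [mem_filter, not_and] at hi'
          simp only [W', if_pos hi, if_neg (hi' hi)]
          simpa using hi' hi)
      have hfi : f i ∉ Y := by
        simp only [mem_filter, not_and] at hiA
        exact hiA hiI
      have hsub : ∀ i', W' i' ⊆ Function.update W' i (insert j (W' i)) i' := by
        intro i'
        by_cases h : i' = i
        · subst h; simp
        · simp [h]
      have hgW : ∀ g : Fin n → Fin d, (∀ i ∈ I, g i ∈ W i) → (∀ i, f i ∉ Y → g i = f i) →
          (∀ i, f i ∈ Y → g i ∈ Y) → ∀ i ∈ I, g i ∈ W' i := by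
        intro g h1 h2 h3 i hi
        by_cases h : f i ∈ Y
        · simp only [W', if_pos hi, if_pos h]
          exact Finset.mem_inter.mpr ⟨h1 i hi, h3 i h⟩
        · simp only [W', if_pos hi, if_neg h]
          simp [h2 i h]
      apply ih (insert (f i) Y) _ (Finset.insert_subset (hfX i hiI) hYX)
        (Finset.mem_insert_of_mem hj0) _ hup
      · intro i' hi'
        exact hsub i' (hgW f hfW (fun _ _ => rfl) (fun _ h => h) i' hi')
      · intro x hx
        rcases Finset.mem_insert.mp hx with hx | hx
        · subst hx
          obtain ⟨g, h1, h2, h3, h4⟩ := hg j hjY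
          refine ⟨Function.update g i j, ?_, ?_, ?_, ?_⟩
          · intro i' hi'
            by_cases h : i' = i
            · subst h; simp
            · have := hsub i' (hgW g h1 h2 h3 i' hi')
              have e : Function.update g i j i' = g i' := Function.update_of_ne h _ _
              rw [e]
              exact this
          · intro i' hi'
            simp only [mem_insert, not_or] at hi'
            have h : i' ≠ i := by rintro rfl; exact hi'.1 rfl
            rw [Function.update_of_ne h]
            exact h2 i' hi'.2
          · intro i' hi'
            by_cases h : i' = i
            · subst h; simp [hjY]
            · rw [Function.update_of_ne h]
              by_cases h' : f i' ∈ Y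
              · exact Finset.mem_insert_of_mem (h3 i' h')
              · rw [h2 i' h']; exact hi'
          · intro x
            have e1 := cnt_update I g i hiI j x
            have e2 := h4 x
            rw [h2 i hfi] at e1
            omega
        · obtain ⟨g, h1, h2, h3, h4⟩ := hg x hx
          refine ⟨g, ?_, ?_, ?_, h4⟩
          · intro i' hi'
            exact hsub i' (hgW g h1 h2 h3 i' hi')
          · intro i' hi'
            simp only [mem_insert, not_or] at hi'
            exact h2 i' hi'.2
          · intro i' hi'
            by_cases h' : f i' ∈ Y
            · exact Finset.mem_insert_of_mem (h3 i' h')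
            · rw [h2 i' h']; exact hi'
      · have : (X \ insert (f i) Y).card < (X \ Y).card := by
          apply Finset.card_lt_card
          refine ⟨Finset.sdiff_subset_sdiff le_rfl (Finset.subset_insert _ _), ?_⟩
          intro h
          have := h (Finset.mem_sdiff.mpr ⟨hfX i hiI, hfi⟩)
          simp at this
        omega

theorem exists_tope {n d : ℕ} {G : Set (Fin n → Finset (Fin d))} {I : Finset (Fin n)}
    (hC : ∀ I', I' ⊂ I → Claim G I')
    {F : Set (Fin n → Finset (Fin d))} {X : Finset (Fin d)} (hFG : F ⊆ G) 
    (hF : TOMF F X) (t : Fin n → Fin d) (htX : ∀ i ∈ I, t i ∈ X) :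
    ∀ (m : ℕ) (f : Fin n → Fin d), sg I f ∈ F → (∀ i ∈ I, f i ∈ X) →
      ∑ x, (cnt I t x - cnt I f x) ≤ m →
      ∃ g : Fin n → Fin d, sg I g ∈ F ∧ ∀ x, cnt I g x = cnt I t x := by
  intro m
  induction m with
  | zero =>
    intro f hf hfX hm
    refine ⟨f, hf, ?_⟩
    have h1 : ∀ x ∈ (univ : Finset (Fin d)), cnt I t x ≤ cnt I f x := by
      intro x hx
      have := (Finset.sum_eq_zero_iff.mp (Nat.le_zero.mp hm)) x hx
      omega
    have h2 := (Finset.sum_eq_sum_iff_of_le h1).mp (by rw [cnt_sum, cnt_sum])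
    intro x
    exact (h2 x (Finset.mem_univ x)).symm
  | succ m ih =>
    intro f hf hfX hm
    by_cases heq : ∀ x, cnt I f x = cnt I t x
    · exact ⟨f, hf, heq⟩
    have hlt1 : ∃ x, cnt I f x < cnt I t x := by
      by_contra h
      push Not at h
      have h2 := (Finset.sum_eq_sum_iff_of_le (fun x (_ : x ∈ univ) => h x)).mp
        (by rw [cnt_sum, cnt_sum])
      exact heq fun x => (h2 x (Finset.mem_univ x)).symm
    have hlt2 : ∃ x, cnt I t x < cnt I f x := by
      by_contra h
      push Not at h
      have h2 := (Finset.sum_eq_sum_iff_of_le (fun x (_ : x ∈ univ) => h x)).mp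
        (by rw [cnt_sum, cnt_sum])
      exact heq fun x => h2 x (Finset.mem_univ x)
    obtain ⟨j0, hj0⟩ := hlt1
    obtain ⟨j1, hj1⟩ := hlt2
    have hne : ∀ (g : Fin n → Fin d) (x : Fin d), 0 < cnt I g x → ∃ i ∈ I, g i = x := by
      intro g x h
      obtain ⟨i, hi⟩ := Finset.card_pos.mp h
      simp only [mem_filter] at hi
      exact ⟨i, hi⟩
    have hj0X : j0 ∈ X := by
      obtain ⟨i, hi, rfl⟩ := hne t j0 (by omega)
      exact htX i hi
    obtain ⟨i1, hi1, hi1'⟩ := hne f j1 (by omega)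
    obtain ⟨j, hjO, g, hgF, hgX, hgc⟩ := augment hC hFG hF f hfX j0
      (univ.filter fun x => cnt I t x < cnt I f x) ⟨i1, hi1, by simpa [hi1'] using hj1⟩ _
      {j0} (sg I f) (by simpa using hj0X) (by simp) le_rfl hf
      (by intro i hi; simp [sg, hi])
      (by
        intro j hj
        have hj := Finset.mem_singleton.mp hj
        subst hj
        exact ⟨f, by intro i hi; simp [sg, hi], fun _ _ => rfl, fun _ h => h, fun _ => rfl⟩)
    simp only [mem_filter, mem_univ, true_and] at hjO
    apply ih g hgF hgX
    have : ∑ x, (cnt I t x - cnt I g x) < ∑ x, (cnt I t x - cnt I f x) := by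
      apply Finset.sum_lt_sum
      · intro x _
        have := hgc x
        by_cases hx : x = j
        · subst hx; rw [if_pos rfl] at this; omega
        · rw [if_neg hx] at this; omega
      · refine ⟨j0, Finset.mem_univ _, ?_⟩
        have := hgc j0
        rw [if_pos rfl, if_neg (by rintro rfl; omega)] at this
        omega
    omega

theorem claim_all {n d : ℕ} {G : Set (Fin n → Finset (Fin d))}
    (hdown : ∀ T ∈ G, ∀ T' : Fin n → Finset (Fin d), (∀ i, T' i ⊆ T i) → T' ∈ G)
    (huniq : ∀ (I : Finset (Fin n)) (f g : Fin n → Fin d), sg I f ∈ G → sg I g ∈ G →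
      (∀ x, cnt I f x = cnt I g x) → ∀ i ∈ I, f i = g i) (I : Finset (Fin n)) : Claim G I := by
  induction I using Finset.strongInduction with
  | H I hC =>
  intro F X hFG hX hF
  have main : ∀ (m : ℕ), ∀ T ∈ G, ∑ i, (T i).card ≤ m → (∀ i, i ∉ I → T i = ∅) →
      (∀ i, T i ⊆ X) → T ∈ F := by
    intro m
    induction m using Nat.strong_induction_on with
    | _ m ih =>
    intro T hT hm h0 hTX
    by_cases h2 : ∃ i, 1 < (T i).card
    · obtain ⟨i, hi⟩ := h2
      obtain ⟨a, ha, b, hb, hab⟩ := Finset.one_lt_card.mp hi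
      have aux : ∀ a ∈ T i, Function.update T i ((T i).erase a) ∈ F := by
        intro a ha
        have hle : ∀ i', Function.update T i ((T i).erase a) i' ⊆ T i' := by
          intro i'
          by_cases h : i' = i
          · subst h; simp [Finset.erase_subset]
          · simp [h]
        have hlt : ∑ i', (Function.update T i ((T i).erase a) i').card < ∑ i', (T i').card := by
          apply Finset.sum_lt_sum
          · intro i' _
            exact Finset.card_le_card (hle i')
          · refine ⟨i, Finset.mem_univ _, ?_⟩
            rw [Function.update_self]
            exact Finset.card_erase_lt_of_mem ha
        refine ih _ (lt_of_lt_of_le hlt hm) _ (hdown T hT _ hle) le_rfl ?_ ?_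
        · intro i' hi'
          have := hle i'
          rw [h0 i' hi'] at this
          exact Finset.subset_empty.mp this
        · intro i'
          exact (hle i').trans (hTX i')
      obtain ⟨W, hW, hW0, hW1⟩ := hF.elim _ (aux a ha) _ (aux b hb) i
      have : W = T := by
        funext i'
        by_cases h : i' = i
        · subst h
          rw [hW0]
          ext x
          simp only [Function.update_self, mem_union, mem_erase]
          constructor
          · rintro (h | h) <;> exact h.2
          · intro hx
            by_cases hxa : x = a
            · right; exact ⟨by rw [hxa]; exact hab, hx⟩
            · left; exact ⟨hxa, hx⟩
        · have := hW1 i' h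
          simpa [h] using this
      rw [← this]; exact hW
    · push Not at h2
      by_cases he : ∃ i ∈ I, T i = ∅
      · obtain ⟨k, hk, hke⟩ := he
        refine hC (I.erase k) (Finset.erase_ssubset hk) F X hFG hX hF T hT ?_ hTX
        intro i hi
        by_cases h : i = k
        · rw [h]; exact hke
        · exact h0 i (fun h' => hi (Finset.mem_erase.mpr ⟨h, h'⟩))
      · push Not at he
        obtain ⟨x0, hx0⟩ := hX
        have hex : ∀ i, ∃ x, i ∈ I → T i = {x} := by
          intro i
          by_cases hi : i ∈ I
          · have h1 := Finset.card_pos.mpr (Finset.nonempty_iff_ne_empty.mpr (by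
              simpa [Finset.nonempty_iff_ne_empty] using he i hi))
            obtain ⟨x, hx⟩ := Finset.card_eq_one.mp (le_antisymm (h2 i) h1)
            exact ⟨x, fun _ => hx⟩
          · exact ⟨x0, fun h => absurd h hi⟩
        choose t ht using hex
        have hTt : T = sg I t := by
          funext i
          by_cases hi : i ∈ I
          · simp [sg, hi, ht i hi]
          · simp [sg, hi, h0 i hi]
        have htX : ∀ i ∈ I, t i ∈ X := by
          intro i hi
          apply hTX i
          rw [ht i hi]; simp
        obtain ⟨g, hg, hgc⟩ := exists_tope hC hFG hF t htX _ (fun _ => x0)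
          (hF.down _ (hF.bd x0 hx0) _ (by
            intro i; simp only [sg]; split_ifs <;> simp)) (fun _ _ => hx0) le_rfl
        have := huniq I g t (hFG hg) (hTt ▸ hT) hgc
        rw [hTt]
        have e : sg I t = sg I g := by
          funext i
          simp only [sg]
          split_ifs with h
          · rw [this i h]
          · rfl
        rw [e]; exact hg
  intro T hT h0 hTX
  exact main _ T hT le_rfl h0 hTX

theorem uniq_of_compat {n d : ℕ} (I : Finset (Fin n)) (f g : Fin n → Fin d)
    (hc : Compatible (typeGraph (sg I f)) (typeGraph (sg I g)))
    (hcnt : ∀ x, cnt I f x = cnt I g x) : ∀ i ∈ I, f i = g i := by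
  classical
  by_contra hcon
  push Not at hcon
  obtain ⟨i0, hi0, hne0⟩ := hcon
  let D := {x : Fin d // ∃ i ∈ I, f i = x ∧ g i ≠ x}
  have hbal : ∀ i ∈ I, f i ≠ g i → ∃ i' ∈ I, f i' = g i ∧ g i' ≠ g i := by
    intro i hi hne
    by_contra h
    push Not at h
    have : cnt I f (g i) < cnt I g (g i) := by
      apply Finset.card_lt_card
      refine ⟨?_, ?_⟩
      · intro i' hi'
        simp only [mem_filter] at hi' ⊢
        exact ⟨hi'.1, h i' hi'.1 hi'.2⟩
      · intro hs
        have := hs (Finset.mem_filter.mpr ⟨hi, rfl⟩)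
        simp only [mem_filter] at this
        exact hne this.2
    have := hcnt (g i)
    omega
  choose s hsI hsf hsg using fun x : D => x.2
  let nx : D → D := fun x => ⟨g (s x), hbal (s x) (hsI x) (by rw [hsf]; exact (hsg x).symm)⟩
  have hnx : ∀ x, nx x ≠ x := by
    intro x h
    exact hsg x (congrArg Subtype.val h)
  have hbij := Function.bijOn_periodicPts nx
  let x0 : D := ⟨f i0, i0, hi0, rfl, Ne.symm hne0⟩
  have hper : ∃ x, x ∈ Function.periodicPts nx := by
    obtain ⟨a, b, hab, h⟩ := Finite.exists_ne_map_eq_of_infinite (fun k : ℕ => nx^[k] x0)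
    wlog hlt : a < b generalizing a b
    · exact this b a hab.symm h.symm (by omega)
    refine ⟨nx^[a] x0, b - a, by omega, ?_⟩
    rw [Function.IsPeriodicPt, Function.IsFixedPt, ← Function.iterate_add_apply,
      Nat.sub_add_cancel hlt.le]
    exact h.symm
  obtain ⟨p, hp⟩ := hper
  let P : Finset D := univ.filter fun x => x ∈ Function.periodicPts nx
  have hP : ∀ x, x ∈ P ↔ x ∈ Function.periodicPts nx := by intro x; simp [P]
  have sinj : ∀ x y, s x = s y → x = y := by
    intro x y h
    apply Subtype.ext
    rw [← hsf x, ← hsf y, h]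
  let M : BGraph (Fin n) (Fin d) := P.image fun x => (s x, x.1)
  let M' : BGraph (Fin n) (Fin d) := P.image fun x => (s x, (nx x).1)
  have hM : ∀ a b, (a, b) ∈ M ↔ ∃ x ∈ P, s x = a ∧ x.1 = b := by
    intro a b; simp only [M, mem_image, Prod.mk.injEq]
  have hM' : ∀ a b, (a, b) ∈ M' ↔ ∃ x ∈ P, s x = a ∧ (nx x).1 = b := by
    intro a b; simp only [M', mem_image, Prod.mk.injEq]
  have heq := hc (P.image s) (P.image Subtype.val) M M' ?_ ?_ ?_ ?_
  · have h1 : (s p, p.1) ∈ M' := by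
      rw [← heq, hM]; exact ⟨p, (hP p).mpr hp, rfl, rfl⟩
    obtain ⟨x, _, h2, h3⟩ := (hM' _ _).mp h1
    have := sinj _ _ h2
    subst this
    exact hnx x (Subtype.ext h3)
  · rintro ⟨a, b⟩ h
    obtain ⟨x, _, rfl, rfl⟩ := (hM _ _).mp h
    refine Finset.mem_filter.mpr ⟨Finset.mem_univ _, ?_⟩
    simp [sg, hsI, hsf]
  · rintro ⟨a, b⟩ h
    obtain ⟨x, _, rfl, rfl⟩ := (hM' _ _).mp h
    refine Finset.mem_filter.mpr ⟨Finset.mem_univ _, ?_⟩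
    simp [sg, hsI, nx]
  · refine ⟨?_, ?_, ?_⟩
    · rintro ⟨a, b⟩ h
      obtain ⟨x, hx, rfl, rfl⟩ := (hM _ _).mp h
      exact ⟨Finset.mem_image_of_mem _ hx, Finset.mem_image_of_mem _ hx⟩
    · intro a ha
      obtain ⟨x, hx, rfl⟩ := Finset.mem_image.mp ha
      refine ⟨x.1, (hM _ _).mpr ⟨x, hx, rfl, rfl⟩, ?_⟩
      intro b hb
      obtain ⟨y, hy, h1, rfl⟩ := (hM _ _).mp hb
      rw [sinj _ _ h1]
    · intro b hb
      obtain ⟨x, hx, rfl⟩ := Finset.mem_image.mp hb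
      refine ⟨s x, (hM _ _).mpr ⟨x, hx, rfl, rfl⟩, ?_⟩
      intro a ha
      obtain ⟨y, hy, rfl, h1⟩ := (hM _ _).mp ha
      rw [Subtype.ext h1]
  · refine ⟨?_, ?_, ?_⟩
    · rintro ⟨a, b⟩ h
      obtain ⟨x, hx, rfl, rfl⟩ := (hM' _ _).mp h
      exact ⟨Finset.mem_image_of_mem _ hx,
        Finset.mem_image_of_mem _ ((hP _).mpr (hbij.mapsTo ((hP x).mp hx)))⟩
    · intro a ha
      obtain ⟨x, hx, rfl⟩ := Finset.mem_image.mp ha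
      refine ⟨(nx x).1, (hM' _ _).mpr ⟨x, hx, rfl, rfl⟩, ?_⟩
      intro b hb
      obtain ⟨y, hy, h1, rfl⟩ := (hM' _ _).mp hb
      rw [sinj _ _ h1]
    · intro b hb
      obtain ⟨x, hx, rfl⟩ := Finset.mem_image.mp hb
      obtain ⟨y, hy, hyx⟩ := hbij.surjOn ((hP x).mp hx)
      refine ⟨s y, (hM' _ _).mpr ⟨y, (hP y).mpr hy, rfl, congrArg Subtype.val hyx⟩, ?_⟩
      intro a ha
      obtain ⟨z, hz, rfl, h1⟩ := (hM' _ _).mp ha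
      have h2 : nx z = nx y := by rw [hyx]; exact Subtype.ext h1
      rw [hbij.injOn ((hP z).mp hz) hy h2]

theorem typeGraph_sub {n d : ℕ} (T T' : Fin n → Finset (Fin d)) :
    typeGraph T ⊆ typeGraph T' ↔ ∀ i, T i ⊆ T' i := by
  constructor
  · intro h i j hj
    have : (i, j) ∈ typeGraph T' := h (by simpa [typeGraph] using hj)
    simpa [typeGraph] using this
  · rintro h ⟨i, j⟩ hj
    simp only [typeGraph, mem_filter, mem_univ, true_and] at hj ⊢
    exact h i hj

theorem statement13 {n d : ℕ} (hd : 1 ≤ d) (𝒯 : ExtGenericTOM n d) :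
    ∀ T ∈ 𝒯.semitypes, ∃ Tp ∈ 𝒯.semitypes,
      (∀ i, (Tp i).Nonempty) ∧ typeGraph T ⊆ typeGraph Tp := by
  intro T hT
  have hF : TOMF 𝒯.semitypes univ :=
    ⟨fun j _ => 𝒯.boundary j,
      fun T hT T' h => 𝒯.surrounding T hT T' ((typeGraph_sub _ _).mpr h), 𝒯.elimination⟩
  have hC := claim_all hF.down
    (fun I f g hf hg h => uniq_of_compat I f g (𝒯.compat _ hf _ hg) h)
  obtain ⟨Tp, h1, h2, h3⟩ := ext_of_claim (I := univ) (fun I' _ => hC I') (Set.Subset.refl _)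
    ⟨⟨0, hd⟩, Finset.mem_univ _⟩ hF (fun _ _ _ => Finset.subset_univ _) _
    (univ.filter fun i => (T i).Nonempty) (Finset.subset_univ _) le_rfl T hT
    (by intro i hi; simpa [Finset.not_nonempty_iff_eq_empty] using hi)
    (by intro i hi; simpa using hi)
  exact ⟨Tp, h1, fun i => h3 i (Finset.mem_univ i), (typeGraph_sub _ _).mpr h2⟩
end
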